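/- Suppose H_N(0) = o(N^{d−2α}) as N → ∞, that the hypotheses of the relative-entropy theorem hold (d = 1, α ∈ (0,1/2), 0 < κ ≤ α, κ < 1 − 2α; or d ≥ 2, α > 0, 0 < κ ≤ α, κ < 1), and in addition that α < d/2. Then for every t ∈ [0,T], every continuous φ : 𝕋^d → ℝ and every ε > 0, μ_{N,t}{ η : | N^{α−d} Σ_{x ∈ 𝕋_N^d} (η_x − ϱ*) φ(x/N − N^κ λ t m) − ∫_{𝕋^d} ρ^{(α,κ)}(t,u) φ(u) du | > ε } → 0 as N → ∞, where ρ^{(α,κ)}(t,u) = ρ^ini(u) if κ < α and ρ^{(α,κ)}(t,u) = ρ(t,u) if κ = α. -/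

import Mathlib

open Real Filter

noncomputable section

/-- The discrete torus `𝕋_N^d`, realized as `d`-tuples of residues mod `N`. -/
abbrev Site (N d : ℕ) := Fin d → Fin N

/-- Configurations of the generalized exclusion process: at most `K` particles per site. -/
abbrev GCfg (N d K : ℕ) := Site N d → Fin (K + 1)

/-- Cyclic successor on `Fin N`. -/
def finCycAdd {N : ℕ} (a : Fin N) : Fin N :=
  ⟨(a.val + 1) % N, Nat.mod_lt _ (Nat.lt_of_le_of_lt (Nat.zero_le _) a.isLt)⟩

/-- Cyclic predecessor on `Fin N`. -/
def finCycSub {N : ℕ} (a : Fin N) : Fin N :=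
  ⟨(a.val + (N - 1)) % N, Nat.mod_lt _ (Nat.lt_of_le_of_lt (Nat.zero_le _) a.isLt)⟩

/-- The neighbour `x + e_i` (if `b = true`) resp. `x − e_i` (if `b = false`) of a site. -/
def siteMove {N d : ℕ} (x : Site N d) (i : Fin d) (b : Bool) : Site N d :=
  Function.update x i (if b then finCycAdd (x i) else finCycSub (x i))

/-- The configuration `η^{x,y}` obtained from `η` when one particle jumps from `x` to `y`. -/
def cfgJump {N d K : ℕ} (η : GCfg N d K) (x y : Site N d) : GCfg N d K := fun z =>
  if z = x then ⟨(η x).val - 1, lt_of_le_of_lt (Nat.sub_le _ _) (η x).isLt⟩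
  else if z = y then ⟨min ((η y).val + 1) K, Nat.lt_succ_of_le (min_le_right _ _)⟩
  else η z

/-- The jump rate `c_{x,i}(η) = p_i η_x (K − η_{x+e_i})`, with directions indexed by
`(i,b) ∈ Fin d × Bool`: `(i,true)` is `e_i` and `(i,false)` is `−e_i = e_{i+d}`. -/
def jumpRate {N d K : ℕ} (p : Fin d → Bool → ℝ) (η : GCfg N d K)
    (x : Site N d) (i : Fin d) (b : Bool) : ℝ :=
  p i b * ((η x).val : ℝ) * ((K : ℝ) - ((η (siteMove x i b)).val : ℝ))

/-- The generator `L_N` of the asymmetric generalized exclusion process. -/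
def genL {N d K : ℕ} (p : Fin d → Bool → ℝ) (f : GCfg N d K → ℝ) (η : GCfg N d K) : ℝ :=
  ∑ i : Fin d, ∑ b : Bool, ∑ x : Site N d,
    jumpRate p η x i b * (f (cfgJump η x (siteMove x i b)) - f η)

/-- The `Binomial (K, ϱ/K)` weight of the occupation number `k`. -/
def binomW (K : ℕ) (ϱ : ℝ) (k : ℕ) : ℝ :=
  (K.choose k : ℝ) * (ϱ / K) ^ k * (1 - ϱ / K) ^ (K - k)

/-- The product measure on configurations with `Binomial (K, ϱ_x/K)` marginals. -/
def prodBinom {N d K : ℕ} (ϱ : Site N d → ℝ) (η : GCfg N d K) : ℝ :=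
  ∏ x : Site N d, binomW K (ϱ x) (η x).val

/-- The relative entropy `H(μ|ν) = Σ_η f(η) log f(η) ν(η)` with `f = μ/ν`. -/
def relEnt {Ω : Type*} [Fintype Ω] (μ ν : Ω → ℝ) : ℝ :=
  ∑ η : Ω, (μ η / ν η) * Real.log (μ η / ν η) * ν η

/-- The Dirichlet form `D_N(f;ν)`. -/
def dirichletForm {N d K : ℕ} (p : Fin d → Bool → ℝ) (f ν : GCfg N d K → ℝ) : ℝ :=
  ∑ i : Fin d, ∑ b : Bool, ∑ x : Site N d, ∑ η : GCfg N d K,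
    jumpRate p η x i b *
      (Real.sqrt (f (cfgJump η x (siteMove x i b))) - Real.sqrt (f η)) ^ 2 * ν η

/-- The macroscopic coordinates `x/N ∈ 𝕋^d` of a site. -/
def siteCoord {N d : ℕ} (x : Site N d) : Fin d → ℝ := fun j => (x j : ℝ) / N

/-- The slowly varying density profile
`ϱ_N(t,u) = ϱ* + N^{−α} ρ(N^{κ−α} t, u − N^κ λ t m)`, with `λ = K − 2ϱ*`. -/
def profileGE (d K : ℕ) (ϱs α κ : ℝ) (m : Fin d → ℝ) (ρ : ℝ → (Fin d → ℝ) → ℝ)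
    (N : ℕ) (t : ℝ) (u : Fin d → ℝ) : ℝ :=
  ϱs + (N : ℝ) ^ (-α) * ρ ((N : ℝ) ^ (κ - α) * t)
    (fun j => u j - (N : ℝ) ^ κ * ((K : ℝ) - 2 * ϱs) * t * m j)

end

/-! ### Entropy inequality and Gaussian linearization -/

/-- The Donsker–Varadhan inequality on a finite space. -/
theorem sum_mul_le_relEnt_add_log {Ω : Type*} [Fintype Ω] [Nonempty Ω] {μ ν : Ω → ℝ}
    (hν : ∀ η, 0 < ν η) (hμ : ∀ η, 0 ≤ μ η) (hμ1 : ∑ η, μ η = 1) (g : Ω → ℝ) :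
    ∑ η, μ η * g η ≤ relEnt μ ν + Real.log (∑ η, ν η * Real.exp (g η)) := by
  set Z := ∑ η, ν η * Real.exp (g η) with hZ
  have hZpos : 0 < Z := Finset.sum_pos (fun η _ => mul_pos (hν η) (Real.exp_pos _))
    Finset.univ_nonempty
  have key : ∀ η, μ η * g η - (μ η / ν η) * Real.log (μ η / ν η) * ν η - μ η * Real.log Z
      ≤ ν η * Real.exp (g η) / Z - μ η := by
    intro η
    rcases (hμ η).eq_or_lt with h | h
    · rw [← h]
      have : 0 ≤ ν η * Real.exp (g η) / Z :=
        div_nonneg (mul_nonneg (hν η).le (Real.exp_pos _).le) hZpos.le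
      simpa using this
    · have h1 : (μ η / ν η) * Real.log (μ η / ν η) * ν η = μ η * Real.log (μ η / ν η) := by
        have := (hν η).ne'
        field_simp
      rw [h1]
      have hpos : 0 < ν η * Real.exp (g η) / (Z * μ η) :=
        div_pos (mul_pos (hν η) (Real.exp_pos _)) (mul_pos hZpos h)
      have h2 := Real.log_le_sub_one_of_pos hpos
      have h3 : Real.log (ν η * Real.exp (g η) / (Z * μ η))
          = g η - Real.log (μ η / ν η) - Real.log Z := by
        rw [Real.log_div (mul_pos (hν η) (Real.exp_pos _)).ne' (mul_pos hZpos h).ne',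
          Real.log_mul (hν η).ne' (Real.exp_pos _).ne', Real.log_mul hZpos.ne' h.ne',
          Real.log_div h.ne' (hν η).ne', Real.log_exp]
        ring
      rw [h3] at h2
      have h4 := mul_le_mul_of_nonneg_left h2 h.le
      have h5 : μ η * (ν η * Real.exp (g η) / (Z * μ η) - 1) = ν η * Real.exp (g η) / Z - μ η := by
        have := h.ne'
        have := hZpos.ne'
        field_simp
      rw [h5] at h4
      linarith
  have hs := Finset.sum_le_sum (fun η (_ : η ∈ Finset.univ) => key η)
  simp only [Finset.sum_sub_distrib, ← Finset.sum_mul, ← Finset.sum_div, hμ1] at hs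
  rw [← hZ, div_self hZpos.ne'] at hs
  unfold relEnt
  linarith

theorem relEnt_nonneg {Ω : Type*} [Fintype Ω] [Nonempty Ω] {μ ν : Ω → ℝ}
    (hν : ∀ η, 0 < ν η) (hν1 : ∑ η, ν η = 1) (hμ : ∀ η, 0 ≤ μ η) (hμ1 : ∑ η, μ η = 1) :
    0 ≤ relEnt μ ν := by
  have := sum_mul_le_relEnt_add_log hν hμ hμ1 (fun _ => 0)
  simpa [hν1] using this

/-- The vector `ω` of random variables is sub-Gaussian with variance proxy `S`. -/
def IsSubGauss {Ω Λ : Type*} [Fintype Ω] [Fintype Λ] (ν : Ω → ℝ) (ω : Ω → Λ → ℝ) (S : ℝ) : Prop :=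
  ∀ c : Λ → ℝ, ∑ η, ν η * Real.exp (∑ x, c x * ω η x) ≤ Real.exp (S / 2 * ∑ x, c x ^ 2)

theorem sum_linear_le_relEnt {Ω Λ : Type*} [Fintype Ω] [Nonempty Ω] [Fintype Λ] {μ ν : Ω → ℝ}
    (hν : ∀ η, 0 < ν η) (hμ : ∀ η, 0 ≤ μ η) (hμ1 : ∑ η, μ η = 1)
    {ω : Ω → Λ → ℝ} {S : ℝ} (hS : IsSubGauss ν ω S) (c : Λ → ℝ) :
    ∑ η, μ η * ∑ x, c x * ω η x ≤ relEnt μ ν + S / 2 * ∑ x, c x ^ 2 := by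
  refine (sum_mul_le_relEnt_add_log hν hμ hμ1 _).trans ?_
  gcongr
  rw [Real.log_le_iff_le_exp]
  · exact hS c
  · exact Finset.sum_pos (fun η _ => mul_pos (hν η) (Real.exp_pos _)) Finset.univ_nonempty

open ProbabilityTheory MeasureTheory in
theorem integral_exp_sq_gaussian {u : ℝ} (hu1 : u ≤ 1 / 2) :
    ∫ z, Real.exp (u / 2 * z ^ 2) ∂(gaussianReal 0 1) = (√(1 - u))⁻¹ := by
  rw [integral_gaussianReal_eq_integral_smul one_ne_zero]
  have h : ∀ x : ℝ, gaussianPDFReal 0 1 x • Real.exp (u / 2 * x ^ 2)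
      = (√(2 * π))⁻¹ * Real.exp (-((1 - u) / 2) * x ^ 2) := by
    intro x
    simp only [gaussianPDFReal, smul_eq_mul, NNReal.coe_one, mul_one, sub_zero]
    rw [mul_assoc, ← Real.exp_add]
    congr 2
    ring
  simp_rw [h]
  rw [integral_const_mul, integral_gaussian]
  have h1 : (0 : ℝ) < 1 - u := by linarith
  have : π / ((1 - u) / 2) = (2 * π) / (1 - u) := by field_simp
  rw [this, Real.sqrt_div (by positivity)]
  have : √(2 * π) ≠ 0 := by positivity
  field_simp

theorem inv_sqrt_one_sub_le_exp {u : ℝ} (hu0 : 0 ≤ u) (hu1 : u ≤ 1 / 2) :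
    (√(1 - u))⁻¹ ≤ Real.exp u := by
  have h1 : (0 : ℝ) < 1 - u := by linarith
  have h2 : 0 < √(1 - u) := Real.sqrt_pos.2 h1
  rw [← Real.log_le_iff_le_exp (inv_pos.2 h2), Real.log_inv, Real.log_sqrt h1.le]
  have := Real.one_sub_inv_le_log_of_pos h1
  have h3 : (1 - u)⁻¹ ≤ 1 + 2 * u := by
    rw [inv_le_iff_one_le_mul₀ h1]
    nlinarith
  linarith

open ProbabilityTheory MeasureTheory in
theorem sum_exp_diag_quadratic_le {Ω Λ : Type*} [Fintype Ω] [Fintype Λ] [DecidableEq Λ]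
    {ν : Ω → ℝ}
    {ω : Ω → Λ → ℝ} {S : ℝ} (hS0 : 0 ≤ S) (hS : IsSubGauss ν ω S)
    (b : Λ → Λ → ℝ) (hb : ∀ i j, ∑ x, b i x * b j x = if i = j then 1 else 0)
    (l : Λ → ℝ) (hl0 : ∀ j, 0 ≤ l j) (hl1 : ∀ j, S * l j ≤ 1 / 2) :
    ∑ η, ν η * Real.exp (∑ j, l j / 2 * (∑ x, b j x * ω η x) ^ 2)
      ≤ Real.exp (S * ∑ j, l j) := by
  set G : Measure (Λ → ℝ) := Measure.pi (fun _ => gaussianReal 0 1) with hG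
  set s : Λ → ℝ := fun j => √(l j) with hs
  have hss : ∀ j, s j ^ 2 = l j := fun j => Real.sq_sqrt (hl0 j)
  set c : Ω → Λ → ℝ := fun η j => s j * ∑ x, b j x * ω η x with hc
  have lin1 : ∀ t : ℝ, ∫ z, Real.exp (t * z) ∂(gaussianReal 0 1) = Real.exp (t ^ 2 / 2) := by
    intro t
    have := congrFun (mgf_id_gaussianReal (μ := 0) (v := 1)) t
    simpa [mgf] using this
  have lin : ∀ η, Real.exp (∑ j, l j / 2 * (∑ x, b j x * ω η x) ^ 2)
      = ∫ z, ∏ j, Real.exp (c η j * z j) ∂G := by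
    intro η
    rw [hG, integral_fintype_prod_eq_prod (fun j z => Real.exp (c η j * z)), Real.exp_sum]
    refine Finset.prod_congr rfl fun j _ => ?_
    rw [lin1, hc]
    simp only
    rw [mul_pow, hss]
    congr 1
    ring
  have intg1 : ∀ η, Integrable (fun z : Λ → ℝ => ∏ j, Real.exp (c η j * z j)) G := fun η =>
    Integrable.fintype_prod (f := fun j z => Real.exp (c η j * z))
      fun j => integrable_exp_mul_gaussianReal _
  have hsq : ∀ j, ∫ z, Real.exp ((S * l j) / 2 * z ^ 2) ∂(gaussianReal 0 1)
      = (√(1 - S * l j))⁻¹ := fun j => integral_exp_sq_gaussian (hl1 j)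
  have intg2 : Integrable (fun z : Λ → ℝ => ∏ j, Real.exp ((S * l j) / 2 * z j ^ 2)) G := by
    refine Integrable.fintype_prod (f := fun j z => Real.exp ((S * l j) / 2 * z ^ 2))
      fun j => Integrable.of_integral_ne_zero ?_
    rw [hsq]
    have : 0 < 1 - S * l j := by linarith [hl1 j]
    positivity
  calc ∑ η, ν η * Real.exp (∑ j, l j / 2 * (∑ x, b j x * ω η x) ^ 2)
      = ∫ z, ∑ η, ν η * ∏ j, Real.exp (c η j * z j) ∂G := by
        rw [integral_finsetSum _ (fun η _ => (intg1 η).const_mul _)]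
        refine Finset.sum_congr rfl fun η _ => ?_
        rw [lin, integral_const_mul]
    _ ≤ ∫ z, ∏ j, Real.exp ((S * l j) / 2 * z j ^ 2) ∂G := by
        refine integral_mono (integrable_finsetSum _ fun η _ => (intg1 η).const_mul _) intg2 ?_
        intro z
        simp only
        have h1 : ∀ η, ∏ j, Real.exp (c η j * z j)
            = Real.exp (∑ x, (∑ j, z j * s j * b j x) * ω η x) := by
          intro η
          rw [← Real.exp_sum]
          congr 1
          simp only [hc, Finset.mul_sum, Finset.sum_mul]
          rw [Finset.sum_comm]
          refine Finset.sum_congr rfl fun x _ => Finset.sum_congr rfl fun j _ => by ring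
        simp_rw [h1]
        refine (hS _).trans (le_of_eq ?_)
        rw [← Real.exp_sum]
        congr 1
        have h2 : ∑ x, (∑ j, z j * s j * b j x) ^ 2 = ∑ j, l j * z j ^ 2 := by
          simp_rw [pow_two, Finset.sum_mul_sum]
          rw [Finset.sum_comm]
          refine Finset.sum_congr rfl fun j _ => ?_
          rw [Finset.sum_comm]
          have : ∀ i, ∑ x, z j * s j * b j x * (z i * s i * b i x)
              = (z j * s j * (z i * s i)) * if j = i then 1 else 0 := by
            intro i
            rw [← hb, Finset.mul_sum]
            refine Finset.sum_congr rfl fun x _ => by ring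
          simp_rw [this]
          simp only [mul_ite, mul_one, mul_zero, Finset.sum_ite_eq, Finset.mem_univ, if_true]
          rw [← hss j]
          ring
        rw [h2, Finset.mul_sum]
        refine Finset.sum_congr rfl fun j _ => by ring
    _ = ∏ j, (√(1 - S * l j))⁻¹ := by
        rw [hG, integral_fintype_prod_eq_prod (fun j z => Real.exp ((S * l j) / 2 * z ^ 2))]
        exact Finset.prod_congr rfl fun j _ => hsq j
    _ ≤ ∏ j, Real.exp (S * l j) := by
        refine Finset.prod_le_prod (fun j _ => by positivity) fun j _ => ?_
        exact inv_sqrt_one_sub_le_exp (mul_nonneg hS0 (hl0 j)) (hl1 j)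
    _ = Real.exp (S * ∑ j, l j) := by
        rw [← Real.exp_sum, Finset.mul_sum]

/-- Spectral decomposition of the quadratic form `v ↦ ‖C v‖²`. -/
theorem exists_diagonalization {Λ ι : Type*} [Fintype Λ] [DecidableEq Λ] [Fintype ι]
    (C : ι → Λ → ℝ) {B : ℝ} (hB : ∀ v : Λ → ℝ, ∑ k, (∑ x, C k x * v x) ^ 2 ≤ B * ∑ x, v x ^ 2) :
    ∃ (b : Λ → Λ → ℝ) (l : Λ → ℝ),
      (∀ i j, ∑ x, b i x * b j x = if i = j then 1 else 0) ∧ (∀ j, 0 ≤ l j) ∧ (∀ j, l j ≤ B) ∧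
      (∑ j, l j = ∑ k, ∑ x, C k x ^ 2) ∧
      ∀ v : Λ → ℝ, ∑ k, (∑ x, C k x * v x) ^ 2 = ∑ j, l j * (∑ x, b j x * v x) ^ 2 := by
  classical
  set A : Matrix ι Λ ℝ := Matrix.of C with hA
  have hM := Matrix.isHermitian_conjTranspose_mul_self A
  set b := hM.eigenvectorBasis with hb
  have horth : ∀ i j, ∑ x, b i x * b j x = if i = j then 1 else 0 := by
    intro i j
    rw [← OrthonormalBasis.inner_eq_ite b i j, EuclideanSpace.inner_eq_star_dotProduct]
    simp [dotProduct, mul_comm]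
  have hquad : ∀ v w : Λ → ℝ, ∑ k, (∑ x, C k x * v x) * (∑ x, C k x * w x)
      = v ⬝ᵥ ((A.conjTranspose * A).mulVec w) := by
    intro v w
    rw [← Matrix.mulVec_mulVec, Matrix.dotProduct_mulVec, Matrix.conjTranspose_eq_transpose_of_trivial,
      Matrix.vecMul_transpose]
    rfl
  have heig : ∀ (v : Λ → ℝ) j, ∑ k, (∑ x, C k x * v x) * (∑ x, C k x * b j x)
      = hM.eigenvalues j * ∑ x, b j x * v x := by
    intro v j
    rw [hquad, hM.mulVec_eigenvectorBasis j, dotProduct_smul, smul_eq_mul, dotProduct_comm]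
    rfl
  have hexp : ∀ (v : Λ → ℝ) x, v x = ∑ j, (∑ y, b j y * v y) * b j x := by
    intro v x
    have h := b.sum_repr' (WithLp.toLp 2 v)
    have h2 := congrArg (fun w : EuclideanSpace ℝ Λ => w x) h
    simp only [WithLp.ofLp_sum, Finset.sum_apply, PiLp.smul_apply, smul_eq_mul] at h2
    rw [← h2]
    refine Finset.sum_congr rfl fun j _ => ?_
    rw [EuclideanSpace.inner_eq_star_dotProduct]
    simp [dotProduct, mul_comm]
  refine ⟨fun j x => b j x, hM.eigenvalues, horth, ?_, ?_, ?_, ?_⟩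
  · intro j
    have h := heig (b j) j
    rw [horth, if_pos rfl, mul_one] at h
    rw [← h]
    exact Finset.sum_nonneg fun k _ => mul_self_nonneg _
  · intro j
    have h := heig (b j) j
    rw [horth, if_pos rfl, mul_one] at h
    have h2 := hB (b j)
    have h3 := horth j j
    simp only [if_true] at h3
    simp_rw [pow_two] at h2
    rw [h, h3, mul_one] at h2
    exact h2
  · have h := hM.trace_eq_sum_eigenvalues
    simp only [RCLike.ofReal_real_eq_id, id] at h
    rw [← h, Matrix.trace, Finset.sum_comm]
    refine Finset.sum_congr rfl fun x _ => ?_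
    simp [Matrix.mul_apply, hA, pow_two]
  · intro v
    have h1 : ∀ k, ∑ x, C k x * v x = ∑ j, (∑ y, b j y * v y) * ∑ x, C k x * b j x := by
      intro k
      conv_lhs => rw [Finset.sum_congr rfl fun x _ => by rw [hexp v x]]
      simp_rw [Finset.mul_sum]
      rw [Finset.sum_comm]
      refine Finset.sum_congr rfl fun j _ => Finset.sum_congr rfl fun x _ => by ring
    have h2 : ∀ k, (∑ x, C k x * v x) ^ 2
        = ∑ j, (∑ y, b j y * v y) * ((∑ x, C k x * v x) * ∑ x, C k x * b j x) := by
      intro k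
      rw [pow_two]
      conv_lhs => rw [h1 k]
      rw [Finset.sum_mul, ]
      refine Finset.sum_congr rfl fun j _ => ?_
      rw [← h1 k]
      ring
    simp_rw [h2]
    rw [Finset.sum_comm]
    refine Finset.sum_congr rfl fun j _ => ?_
    rw [← Finset.mul_sum, heig]
    ring

/-- Entropy bound for sums of squares of linear statistics. -/
theorem sum_quadratic_le_relEnt {Ω Λ ι : Type*} [Fintype Ω] [Nonempty Ω] [Fintype Λ] [Fintype ι]
    {μ ν : Ω → ℝ} (hν : ∀ η, 0 < ν η) (hμ : ∀ η, 0 ≤ μ η) (hμ1 : ∑ η, μ η = 1)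
    {ω : Ω → Λ → ℝ} {S : ℝ} (hS0 : 0 < S) (hS : IsSubGauss ν ω S)
    (C : ι → Λ → ℝ) {B : ℝ} (hB0 : 0 < B)
    (hB : ∀ v : Λ → ℝ, ∑ k, (∑ x, C k x * v x) ^ 2 ≤ B * ∑ x, v x ^ 2) :
    ∑ η, μ η * ∑ k, (∑ x, C k x * ω η x) ^ 2
      ≤ 4 * S * (B * relEnt μ ν + ∑ k, ∑ x, C k x ^ 2) := by
  classical
  obtain ⟨b, l, hb, hl0, hlB, htr, hdiag⟩ := exists_diagonalization C hB
  set g := (2 * S * B)⁻¹ with hg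
  have hgpos : 0 < g := by positivity
  have h1 := sum_exp_diag_quadratic_le hS0.le hS b hb (fun j => g * l j)
    (fun j => mul_nonneg hgpos.le (hl0 j)) (fun j => by
      have : S * (g * l j) ≤ S * (g * B) := by gcongr; exact hlB j
      refine this.trans (le_of_eq ?_)
      rw [hg]
      field_simp)
  have h2 : ∀ η, ∑ j, g * l j / 2 * (∑ x, b j x * ω η x) ^ 2
      = g / 2 * ∑ k, (∑ x, C k x * ω η x) ^ 2 := by
    intro η
    rw [hdiag, Finset.mul_sum]
    refine Finset.sum_congr rfl fun j _ => by ring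
  simp_rw [h2] at h1
  have h3 := sum_mul_le_relEnt_add_log hν hμ hμ1
    (fun η => g / 2 * ∑ k, (∑ x, C k x * ω η x) ^ 2)
  have h4 : Real.log (∑ η, ν η * Real.exp (g / 2 * ∑ k, (∑ x, C k x * ω η x) ^ 2))
      ≤ S * ∑ j, g * l j := by
    rw [Real.log_le_iff_le_exp]
    · exact h1
    · exact Finset.sum_pos (fun η _ => mul_pos (hν η) (Real.exp_pos _)) Finset.univ_nonempty
  rw [← Finset.mul_sum, htr] at h4
  have h5 : ∑ η, μ η * (g / 2 * ∑ k, (∑ x, C k x * ω η x) ^ 2)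
      = g / 2 * ∑ η, μ η * ∑ k, (∑ x, C k x * ω η x) ^ 2 := by
    rw [Finset.mul_sum]
    refine Finset.sum_congr rfl fun η _ => by ring
  rw [h5] at h3
  set E := ∑ η, μ η * ∑ k, (∑ x, C k x * ω η x) ^ 2
  set t := ∑ k, ∑ x, C k x ^ 2 with ht
  have ht0 : 0 ≤ t := Finset.sum_nonneg fun k _ => Finset.sum_nonneg fun x _ => sq_nonneg _
  have h6 : g / 2 * E ≤ relEnt μ ν + S * (g * t) := by linarith
  have h7 := mul_le_mul_of_nonneg_left h6 (show (0 : ℝ) ≤ 4 * S * B by positivity)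
  have h8 : 4 * S * B * (g / 2 * E) = E := by rw [hg]; field_simp; norm_num
  have h9 : 4 * S * B * (S * (g * t)) = 2 * S * t := by rw [hg]; field_simp; norm_num
  nlinarith [mul_nonneg hS0.le ht0]

/-! ### The product binomial measure -/

/-- The centred and normalized occupation variables. -/
noncomputable def omVar {N d K : ℕ} (a : Site N d → ℝ) (η : GCfg N d K) (x : Site N d) : ℝ :=
  (((η x).val : ℝ) - a x) / (a x * (K - a x))

theorem binomW_pos {K : ℕ} {a : ℝ} (h0 : 0 < a) (h1 : a < K) {k : ℕ} (hk : k ≤ K) :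
    0 < binomW K a k := by
  have hK : (0 : ℝ) < K := h0.trans h1
  have h2 : 0 < 1 - a / K := by
    rw [sub_pos, div_lt_one hK]
    exact h1
  have := Nat.choose_pos hk
  unfold binomW
  positivity

theorem sum_binomW (K : ℕ) (a : ℝ) : ∑ k : Fin (K + 1), binomW K a k = 1 := by
  have h := congrArg (Polynomial.eval (a / K)) (bernsteinPolynomial.sum ℝ K)
  rw [Polynomial.eval_finsetSum, Finset.sum_range] at h
  simpa [bernsteinPolynomial, binomW] using h

theorem sum_binomW_mul {K : ℕ} (hK : 1 ≤ K) (a : ℝ) :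
    ∑ k : Fin (K + 1), binomW K a k * (k : ℝ) = a := by
  have h := congrArg (Polynomial.eval (a / K)) (bernsteinPolynomial.sum_smul ℝ K)
  rw [Polynomial.eval_finsetSum, Finset.sum_range] at h
  have hK' : (K : ℝ) ≠ 0 := by positivity
  simp only [bernsteinPolynomial, nsmul_eq_mul, Polynomial.eval_mul, Polynomial.eval_pow,
    Polynomial.eval_natCast, Polynomial.eval_X, Polynomial.eval_sub, Polynomial.eval_one] at h
  rw [mul_div_cancel₀ _ hK'] at h
  conv_rhs => rw [← h]
  refine Finset.sum_congr rfl fun k _ => ?_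
  unfold binomW
  ring

theorem prodBinom_pos {N d K : ℕ} {a : Site N d → ℝ} (h0 : ∀ x, 0 < a x) (h1 : ∀ x, a x < K)
    (η : GCfg N d K) : 0 < prodBinom a η :=
  Finset.prod_pos fun x _ => binomW_pos (h0 x) (h1 x) (Nat.lt_succ_iff.1 (η x).isLt)

theorem sum_prodBinom_mul_prod {N d K : ℕ} (a : Site N d → ℝ)
    (F : Site N d → Fin (K + 1) → ℝ) :
    ∑ η : GCfg N d K, prodBinom a η * ∏ x, F x (η x)
      = ∏ x, ∑ k : Fin (K + 1), binomW K (a x) k * F x k := by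
  rw [Finset.prod_univ_sum, Fintype.piFinset_univ]
  refine Finset.sum_congr rfl fun η _ => ?_
  rw [prodBinom, Finset.prod_mul_distrib]

theorem sum_prodBinom {N d K : ℕ} (a : Site N d → ℝ) :
    ∑ η : GCfg N d K, prodBinom a η = 1 := by
  have := sum_prodBinom_mul_prod (K := K) a (fun _ _ => 1)
  simpa [sum_binomW] using this

/-- A crude version of Hoeffding's lemma for finite sums. -/
theorem sum_exp_le_of_mean_zero {ι : Type*} [Fintype ι] {w X : ι → ℝ} (hw : ∀ i, 0 ≤ w i)
    (hw1 : ∑ i, w i = 1) (hmean : ∑ i, w i * X i = 0) {σ : ℝ} (hσ : 0 < σ)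
    (hX : ∀ i, |X i| ≤ σ) (c : ℝ) :
    ∑ i, w i * Real.exp (c * X i) ≤ Real.exp (σ ^ 2 / 2 * c ^ 2) := by
  have h1 : ∀ i, Real.exp (c * X i) ≤ Real.cosh (c * σ) + X i / σ * Real.sinh (c * σ) := by
    intro i
    have ⟨hl, hu⟩ := abs_le.1 (hX i)
    have hp : 0 ≤ (1 + X i / σ) / 2 := by
      have : -1 ≤ X i / σ := by rw [le_div_iff₀ hσ]; linarith
      linarith
    have hq : 0 ≤ (1 - X i / σ) / 2 := by
      have : X i / σ ≤ 1 := by rw [div_le_iff₀ hσ]; linarith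
      linarith
    have := convexOn_exp.2 (Set.mem_univ (c * σ)) (Set.mem_univ (-(c * σ))) hp hq (by ring)
    simp only [smul_eq_mul] at this
    have he : (1 + X i / σ) / 2 * (c * σ) + (1 - X i / σ) / 2 * -(c * σ) = c * X i := by
      field_simp
      ring
    rw [he] at this
    rw [Real.cosh_eq, Real.sinh_eq]
    linarith
  calc ∑ i, w i * Real.exp (c * X i)
      ≤ ∑ i, w i * (Real.cosh (c * σ) + X i / σ * Real.sinh (c * σ)) := by
        gcongr with i
        · exact hw i
        · exact h1 i
    _ = (∑ i, w i) * Real.cosh (c * σ) + (∑ i, w i * X i) * (Real.sinh (c * σ) / σ) := by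
        rw [Finset.sum_mul, Finset.sum_mul, ← Finset.sum_add_distrib]
        refine Finset.sum_congr rfl fun i _ => by ring
    _ = Real.cosh (c * σ) := by rw [hw1, hmean]; ring
    _ ≤ _ := by
        refine (Real.cosh_le_exp_half_sq _).trans (Real.exp_le_exp.2 (le_of_eq ?_))
        ring

theorem abs_omVar_le {N d K : ℕ} {a : Site N d → ℝ} {c₀ : ℝ} (hc : 0 < c₀)
    (h0 : ∀ x, c₀ ≤ a x) (h1 : ∀ x, a x ≤ K - c₀) (η : GCfg N d K) (x : Site N d) :
    |omVar a η x| ≤ K / c₀ ^ 2 := by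
  have h2 := h0 x
  have h3 := h1 x
  have h4 : ((η x).val : ℝ) ≤ K := by exact_mod_cast Nat.lt_succ_iff.1 (η x).isLt
  have h5 : (0 : ℝ) ≤ ((η x).val : ℝ) := by positivity
  have h6 : c₀ ^ 2 ≤ a x * (K - a x) := by nlinarith
  unfold omVar
  rw [abs_div, abs_of_pos (show 0 < a x * (K - a x) by nlinarith [sq_pos_of_pos hc])]
  refine div_le_div₀ (by linarith) ?_ (by positivity) h6
  rw [abs_le]
  constructor <;> linarith

theorem isSubGauss_omVar {N d K : ℕ} (hK : 1 ≤ K) {a : Site N d → ℝ} {c₀ : ℝ} (hc : 0 < c₀)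
    (h0 : ∀ x, c₀ ≤ a x) (h1 : ∀ x, a x ≤ K - c₀) :
    IsSubGauss (prodBinom (K := K) a) (omVar a) ((K / c₀ ^ 2) ^ 2) := by
  intro c
  have hK0 : (0 : ℝ) < K := by positivity
  set X : Site N d → Fin (K + 1) → ℝ := fun x k => ((k : ℝ) - a x) / (a x * (K - a x)) with hX
  have e : ∀ η : GCfg N d K, Real.exp (∑ x, c x * omVar a η x)
      = ∏ x, Real.exp (c x * X x (η x)) := fun η => by
    rw [← Real.exp_sum]
    rfl
  simp_rw [e]
  rw [sum_prodBinom_mul_prod a (fun x k => Real.exp (c x * X x k)), Finset.mul_sum, Real.exp_sum]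
  have hb : ∀ x (k : Fin (K + 1)), 0 ≤ binomW K (a x) k := fun x k =>
    (binomW_pos (by linarith [h0 x]) (by linarith [h1 x]) (Nat.lt_succ_iff.1 k.isLt)).le
  refine Finset.prod_le_prod (fun x _ => Finset.sum_nonneg fun k _ =>
    mul_nonneg (hb x k) (Real.exp_pos _).le) fun x _ => ?_
  refine sum_exp_le_of_mean_zero (hb x) (sum_binomW K (a x)) ?_ (by positivity) ?_ (c x)
  · simp only [hX, mul_div_assoc']
    rw [← Finset.sum_div]
    simp_rw [mul_sub]
    rw [Finset.sum_sub_distrib, sum_binomW_mul hK, ← Finset.sum_mul, sum_binomW]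
    simp
  · intro k
    exact abs_omVar_le hc h0 h1 (fun _ => k) x

/-! ### Change of variables along a jump -/

theorem cfgJump_apply_of_ne {N d K : ℕ} (η : GCfg N d K) {x y z : Site N d} (hx : z ≠ x)
    (hy : z ≠ y) : cfgJump η x y z = η z := by
  simp [cfgJump, hx, hy]

theorem cfgJump_cfgJump {N d K : ℕ} {η : GCfg N d K} {x y : Site N d} (hxy : x ≠ y)
    (hx : (η x).val ≠ 0) (hy : (η y).val ≠ K) : cfgJump (cfgJump η x y) y x = η := by
  funext z
  have h1 := (η x).isLt
  have h2 := (η y).isLt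
  by_cases hzy : z = y
  · subst hzy
    apply Fin.ext
    simp [cfgJump, hxy.symm]
    omega
  · by_cases hzx : z = x
    · subst hzx
      apply Fin.ext
      simp [cfgJump, hxy]
      omega
    · simp [cfgJump, hzx, hzy]

theorem binomW_succ_mul {K : ℕ} {a : ℝ} (h0 : 0 < a) (h1 : a < K) {k : ℕ} (hk : k + 1 ≤ K) :
    binomW K a (k + 1) * (k + 1) * (K - a) = binomW K a k * (K - k) * a := by
  have hK : (0 : ℝ) < K := h0.trans h1
  have hc : (K.choose (k + 1) : ℝ) * (k + 1) = K.choose k * (K - k) := by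
    have := Nat.choose_succ_right_eq K k
    have h2 : ((K - k : ℕ) : ℝ) = K - k := by
      rw [Nat.cast_sub (by omega)]
    rw [← h2]
    exact_mod_cast this
  obtain ⟨j, rfl⟩ := Nat.exists_eq_add_of_le hk
  have e1 : k + 1 + j - (k + 1) = j := by omega
  have e2 : k + 1 + j - k = j + 1 := by omega
  unfold binomW
  rw [e1, e2, pow_succ, pow_succ]
  set M : ℝ := ((k + 1 + j : ℕ) : ℝ)
  have h3 : a / M * (M - a) = (1 - a / M) * a := by
    field_simp
  linear_combination ((a / M) ^ k * (a / M) * (1 - a / M) ^ j * (M - a)) * hc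
    + ((k + 1 + j).choose k * (M - k) * (a / M) ^ k * (1 - a / M) ^ j) * h3

theorem prodBinom_cfgJump {N d K : ℕ} {a : Site N d → ℝ} (h0 : ∀ x, 0 < a x) (h1 : ∀ x, a x < K)
    {η : GCfg N d K} {x y : Site N d} (hxy : x ≠ y) (hx : (η x).val ≠ 0) (hy : (η y).val ≠ K) :
    prodBinom a (cfgJump η x y) *
        ((((cfgJump η x y) y).val : ℝ) * (K - ((cfgJump η x y) x).val)
          * (a x * (K - a y) / ((K - a x) * a y)))
      = prodBinom a η * ((η x).val * (K - (η y).val)) := by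
  have hs : ∀ ξ : GCfg N d K, prodBinom a ξ = binomW K (a x) (ξ x).val *
      (binomW K (a y) (ξ y).val * ∏ z ∈ (Finset.univ.erase x).erase y, binomW K (a z) (ξ z).val) := by
    intro ξ
    rw [Finset.mul_prod_erase _ (fun z => binomW K (a z) (ξ z).val)
      (Finset.mem_erase.2 ⟨hxy.symm, Finset.mem_univ y⟩),
      Finset.mul_prod_erase _ (fun z => binomW K (a z) (ξ z).val) (Finset.mem_univ x)]
    rfl
  have hr : ∏ z ∈ (Finset.univ.erase x).erase y, binomW K (a z) (cfgJump η x y z).val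
      = ∏ z ∈ (Finset.univ.erase x).erase y, binomW K (a z) (η z).val := by
    refine Finset.prod_congr rfl fun z hz => ?_
    rw [cfgJump_apply_of_ne]
    · exact Finset.ne_of_mem_erase (Finset.mem_of_mem_erase hz)
    · exact Finset.ne_of_mem_erase hz
  rw [hs, hs η, hr]
  have hvx : ((cfgJump η x y) x).val = (η x).val - 1 := by simp [cfgJump]
  have hvy : ((cfgJump η x y) y).val = (η y).val + 1 := by
    have := (η y).isLt
    simp [cfgJump, hxy.symm]
    omega
  have hly := (η y).isLt
  have hlx := (η x).isLt
  rw [hvx, hvy]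
  obtain ⟨k, hk⟩ := Nat.exists_eq_succ_of_ne_zero hx
  rw [hk] at hlx ⊢
  have b1 := binomW_succ_mul (h0 x) (h1 x) (show k + 1 ≤ K by omega)
  have b2 := binomW_succ_mul (h0 y) (h1 y) (show (η y).val + 1 ≤ K by omega)
  have hne1 : (K : ℝ) - a x ≠ 0 := by linarith [h1 x]
  have hne2 := (h0 y).ne'
  simp only [Nat.succ_eq_add_one, Nat.add_sub_cancel, Nat.cast_add, Nat.cast_one]
  set P := ∏ z ∈ (Finset.univ.erase x).erase y, binomW K (a z) (η z).val
  rw [show binomW K (a x) k * (binomW K (a y) ((η y).val + 1) * P) *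
      (((η y).val + 1 : ℝ) * (K - k) * (a x * (K - a y) / ((K - a x) * a y)))
      = (binomW K (a x) k * (K - k) * a x) *
        (binomW K (a y) ((η y).val + 1) * ((η y).val + 1 : ℝ) * (K - a y)) * P
          / ((K - a x) * a y) by ring, ← b1, b2]
  field_simp

theorem sum_prodBinom_cfgJump {N d K : ℕ} {a : Site N d → ℝ} (h0 : ∀ x, 0 < a x)
    (h1 : ∀ x, a x < K) {x y : Site N d} (hxy : x ≠ y) (F : GCfg N d K → ℝ) :
    ∑ η, prodBinom a η * ((η x).val * ((K : ℝ) - (η y).val)) * F (cfgJump η x y)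
      = ∑ η, prodBinom a η * ((η y).val * ((K : ℝ) - (η x).val)
          * (a x * (K - a y) / ((K - a x) * a y))) * F η := by
  classical
  rw [← Finset.sum_filter_of_ne (p := fun η : GCfg N d K => (η x).val ≠ 0 ∧ (η y).val ≠ K),
    ← Finset.sum_filter_of_ne (p := fun η : GCfg N d K => (η y).val ≠ 0 ∧ (η x).val ≠ K)
      (s := Finset.univ) (f := fun η => prodBinom a η * ((η y).val * ((K : ℝ) - (η x).val)
          * (a x * (K - a y) / ((K - a x) * a y))) * F η)]
  · refine Finset.sum_nbij' (fun η => cfgJump η x y) (fun η => cfgJump η y x) ?_ ?_ ?_ ?_ ?_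
    · intro η hη
      have hη := (Finset.mem_filter.1 hη).2
      have h2 := (η x).isLt
      have h3 := (η y).isLt
      simp [cfgJump, hxy.symm]
      omega
    · intro η hη
      have hη := (Finset.mem_filter.1 hη).2
      have h2 := (η x).isLt
      have h3 := (η y).isLt
      simp [cfgJump, hxy]
      omega
    · intro η hη
      have hη := (Finset.mem_filter.1 hη).2
      exact cfgJump_cfgJump hxy hη.1 hη.2
    · intro η hη
      have hη := (Finset.mem_filter.1 hη).2
      exact cfgJump_cfgJump hxy.symm hη.1 hη.2
    · intro η hη
      have hη := (Finset.mem_filter.1 hη).2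
      rw [prodBinom_cfgJump h0 h1 hxy hη.1 hη.2]
  · intro η _ hne
    contrapose! hne
    by_cases h : (η y).val = 0
    · simp [h]
    · simp [hne h]
  · intro η _ hne
    contrapose! hne
    by_cases h : (η x).val = 0
    · simp [h]
    · simp [hne h]

/-! ### The generator applied to a density -/

theorem siteMove_true {N d : ℕ} [NeZero N] (x : Site N d) (i : Fin d) :
    siteMove x i true = x + Pi.single i 1 := by
  funext j
  by_cases h : j = i
  · subst h
    apply Fin.ext
    simp [siteMove, finCycAdd, Fin.val_add]
  · simp [siteMove, h]

theorem siteMove_false {N d : ℕ} [NeZero N] (x : Site N d) (i : Fin d) :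
    siteMove x i false = x - Pi.single i 1 := by
  funext j
  by_cases h : j = i
  · subst h
    apply Fin.ext
    have hN := NeZero.ne N
    simp only [siteMove, finCycSub, Function.update_self, Pi.sub_apply, Pi.single_eq_same,
      Fin.sub_def, Fin.val_one', Bool.false_eq_true, if_false]
    rcases Nat.lt_or_ge 1 N with h1 | h1
    · rw [Nat.mod_eq_of_lt h1, add_comm]
    · have : N = 1 := by omega
      subst this
      simp
  · simp [siteMove, h]

theorem single_one_ne_zero {N d : ℕ} [NeZero N] (hN : 2 ≤ N) (i : Fin d) :
    (Pi.single i 1 : Site N d) ≠ 0 := by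
  have : Fact (1 < N) := ⟨hN⟩
  intro h
  have h1 := congrArg Fin.val (congrFun h i)
  simp [Nat.mod_eq_of_lt (show 1 < N by omega)] at h1

theorem siteMove_ne {N d : ℕ} [NeZero N] (hN : 2 ≤ N) (x : Site N d) (i : Fin d) (b : Bool) :
    x ≠ siteMove x i b := by
  have := single_one_ne_zero hN i
  cases b
  · rw [siteMove_false]
    intro h
    exact this (by simpa using h.symm)
  · rw [siteMove_true]
    intro h
    exact this (by simpa using h.symm)

theorem exchange_identity {K a b s t : ℝ} (ha : a ≠ 0) (hb : b ≠ 0) (ha1 : K - a ≠ 0)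
    (hb1 : K - b ≠ 0) :
    t * (K - s) * (a * (K - b) / ((K - a) * b)) - s * (K - t)
      = K * (a * (K - b)) * (((t - b) / (b * (K - b)) - (s - a) / (a * (K - a)))
        + (b - a) * ((s - a) / (a * (K - a))) * ((t - b) / (b * (K - b)))) := by
  field_simp
  ring

theorem sum_jump_sub {N d K : ℕ} {a : Site N d → ℝ} (h0 : ∀ x, 0 < a x)
    (h1 : ∀ x, a x < K) {x y : Site N d} (hxy : x ≠ y) (F : GCfg N d K → ℝ) :
    ∑ η, prodBinom a η * ((η x).val * ((K : ℝ) - (η y).val)) * (F (cfgJump η x y) - F η)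
      = ∑ η, prodBinom a η * F η * (K * (a x * (K - a y)) * ((omVar a η y - omVar a η x)
          + (a y - a x) * omVar a η x * omVar a η y)) := by
  have e : ∀ η, prodBinom a η * ((η x).val * ((K : ℝ) - (η y).val)) * (F (cfgJump η x y) - F η)
      = prodBinom a η * ((η x).val * ((K : ℝ) - (η y).val)) * F (cfgJump η x y)
        - prodBinom a η * ((η x).val * ((K : ℝ) - (η y).val)) * F η := fun η => mul_sub _ _ _
  simp_rw [e]
  rw [Finset.sum_sub_distrib, sum_prodBinom_cfgJump h0 h1 hxy, ← Finset.sum_sub_distrib]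
  refine Finset.sum_congr rfl fun η _ => ?_
  unfold omVar
  rw [← exchange_identity (h0 x).ne' (h0 y).ne' (by linarith [h1 x]) (by linarith [h1 y])]
  ring

/-- The coefficient of `ω_x` in `L_N^* 1`, up to the factor `K`. -/
noncomputable def linCoef {N d : ℕ} [NeZero N] (K : ℕ) (p : Fin d → Bool → ℝ) (a : Site N d → ℝ)
    (x : Site N d) : ℝ :=
  ∑ i, (p i true * (a (x - Pi.single i 1) * (K - a x) - a x * (K - a (x + Pi.single i 1)))
    + p i false * (a (x + Pi.single i 1) * (K - a x) - a x * (K - a (x - Pi.single i 1))))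

/-- The coefficient of `ω_x ω_{x+e_i}` in `L_N^* 1`, up to the factor `K`. -/
noncomputable def quadCoef {N d : ℕ} [NeZero N] (K : ℕ) (p : Fin d → Bool → ℝ) (a : Site N d → ℝ)
    (i : Fin d) (x : Site N d) : ℝ :=
  p i true * (a x * (K - a (x + Pi.single i 1)) * (a (x + Pi.single i 1) - a x))
    + p i false * (a (x + Pi.single i 1) * (K - a x) * (a x - a (x + Pi.single i 1)))

theorem sum_dir_identity {N d : ℕ} [NeZero N] (K : ℕ) (p : Fin d → Bool → ℝ) (a w : Site N d → ℝ)
    (i : Fin d) :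
    ∑ b : Bool, ∑ x, p i b * (K * (a x * (K - a (siteMove x i b))) * ((w (siteMove x i b) - w x)
          + (a (siteMove x i b) - a x) * w x * w (siteMove x i b)))
      = K * (∑ x, (p i true * (a (x - Pi.single i 1) * (K - a x)
            - a x * (K - a (x + Pi.single i 1)))
          + p i false * (a (x + Pi.single i 1) * (K - a x)
            - a x * (K - a (x - Pi.single i 1)))) * w x
        + ∑ x, quadCoef K p a i x * (w x * w (x + Pi.single i 1))) := by
  simp only [Fintype.sum_bool, siteMove_true, siteMove_false]
  set e : Site N d := Pi.single i 1
  have s1 := Fintype.sum_equiv (Equiv.subRight e) (fun x => a (x - e) * (K - a x) * w x)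
    (fun x => a x * (K - a (x + e)) * w (x + e)) (fun x => by simp)
  have s2 := Fintype.sum_equiv (Equiv.addRight e) (fun x => a (x + e) * (K - a x) * w x)
    (fun x => a x * (K - a (x - e)) * w (x - e)) (fun x => by simp)
  have s3 := Fintype.sum_equiv (Equiv.addRight e)
    (fun x => a (x + e) * (K - a x) * (a x - a (x + e)) * (w x * w (x + e)))
    (fun x => a x * (K - a (x - e)) * (a (x - e) - a x) * (w (x - e) * w x)) (fun x => by simp)
  have l1 : ∑ x, p i true * (K * (a x * (K - a (x + e))) * ((w (x + e) - w x)
          + (a (x + e) - a x) * w x * w (x + e)))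
      = K * (p i true * (∑ x, a x * (K - a (x + e)) * w (x + e))
        - p i true * (∑ x, a x * (K - a (x + e)) * w x)
        + p i true * ∑ x, a x * (K - a (x + e)) * (a (x + e) - a x) * (w x * w (x + e))) := by
    simp only [Finset.mul_sum, ← Finset.sum_sub_distrib, ← Finset.sum_add_distrib]
    refine Finset.sum_congr rfl fun x _ => by ring
  have l2 : ∑ x, p i false * (K * (a x * (K - a (x - e))) * ((w (x - e) - w x)
          + (a (x - e) - a x) * w x * w (x - e)))
      = K * (p i false * (∑ x, a x * (K - a (x - e)) * w (x - e))
        - p i false * (∑ x, a x * (K - a (x - e)) * w x)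
        + p i false * ∑ x, a x * (K - a (x - e)) * (a (x - e) - a x) * (w (x - e) * w x)) := by
    simp only [Finset.mul_sum, ← Finset.sum_sub_distrib, ← Finset.sum_add_distrib]
    refine Finset.sum_congr rfl fun x _ => by ring
  rw [l1, l2, ← s1, ← s2, ← s3]
  simp only [quadCoef, Finset.mul_sum, ← Finset.sum_sub_distrib, ← Finset.sum_add_distrib]
  refine Finset.sum_congr rfl fun x _ => by ring

theorem sum_prodBinom_genL {N d K : ℕ} [NeZero N] (hN : 2 ≤ N) (p : Fin d → Bool → ℝ)
    {a : Site N d → ℝ} (h0 : ∀ x, 0 < a x) (h1 : ∀ x, a x < K) (f : GCfg N d K → ℝ) :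
    ∑ η, prodBinom a η * genL p f η
      = ∑ η, prodBinom a η * f η * (K * (∑ x, linCoef K p a x * omVar a η x
        + ∑ i, ∑ x, quadCoef K p a i x * (omVar a η x * omVar a η (x + Pi.single i 1)))) := by
  have h2 : ∀ η : GCfg N d K, (K : ℝ) * (∑ x, linCoef K p a x * omVar a η x
        + ∑ i, ∑ x, quadCoef K p a i x * (omVar a η x * omVar a η (x + Pi.single i 1)))
      = ∑ i, ∑ b : Bool, ∑ x, p i b * (K * (a x * (K - a (siteMove x i b))) *
          ((omVar a η (siteMove x i b) - omVar a η x)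
          + (a (siteMove x i b) - a x) * omVar a η x * omVar a η (siteMove x i b))) := by
    intro η
    simp_rw [sum_dir_identity]
    rw [← Finset.mul_sum, Finset.sum_add_distrib]
    congr 2
    rw [Finset.sum_comm]
    refine Finset.sum_congr rfl fun x _ => ?_
    rw [linCoef, Finset.sum_mul]
  simp_rw [h2, genL, Finset.mul_sum]
  rw [Finset.sum_comm]
  conv_rhs => rw [Finset.sum_comm]
  refine Finset.sum_congr rfl fun i _ => ?_
  rw [Finset.sum_comm]
  conv_rhs => rw [Finset.sum_comm]
  refine Finset.sum_congr rfl fun b _ => ?_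
  rw [Finset.sum_comm]
  conv_rhs => rw [Finset.sum_comm]
  refine Finset.sum_congr rfl fun x _ => ?_
  have h3 := congrArg (fun r => p i b * r) (sum_jump_sub h0 h1 (siteMove_ne hN x i b) f)
  simp only [Finset.mul_sum] at h3
  refine (Finset.sum_congr rfl fun η _ => ?_).trans (h3.trans (Finset.sum_congr rfl fun η _ => ?_))
  · unfold jumpRate
    ring
  · ring

/-! ### Entropy production -/

theorem mul_log_sub_log_le {s t : ℝ} (hs : 0 < s) (ht : 0 < t) :
    s * (Real.log t - Real.log s) ≤ -(√t - √s) ^ 2 + (t - s) := by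
  have h1 : Real.log t - Real.log s = 2 * Real.log (√t / √s) := by
    rw [Real.log_div (Real.sqrt_pos.2 ht).ne' (Real.sqrt_pos.2 hs).ne', Real.log_sqrt ht.le,
      Real.log_sqrt hs.le]
    ring
  have h2 := Real.log_le_sub_one_of_pos (div_pos (Real.sqrt_pos.2 ht) (Real.sqrt_pos.2 hs))
  have h3 := Real.sq_sqrt hs.le
  have h4 := Real.sq_sqrt ht.le
  have h5 : s * (√t / √s) = √s * √t := by
    have := (Real.sqrt_pos.2 hs).ne'
    field_simp
    rw [h3]
  rw [h1]
  nlinarith [mul_le_mul_of_nonneg_left h2 hs.le]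

theorem jumpRate_nonneg {N d K : ℕ} {p : Fin d → Bool → ℝ} (hp : ∀ i b, 0 ≤ p i b)
    (η : GCfg N d K) (x : Site N d) (i : Fin d) (b : Bool) : 0 ≤ jumpRate p η x i b := by
  have h4 : (((η (siteMove x i b)).val : ℕ) : ℝ) ≤ K := by
    exact_mod_cast Nat.lt_succ_iff.1 (η (siteMove x i b)).isLt
  unfold jumpRate
  exact mul_nonneg (mul_nonneg (hp i b) (by positivity)) (by linarith)

theorem sum_genL_log_le {N d K : ℕ} {p : Fin d → Bool → ℝ} (hp : ∀ i b, 0 ≤ p i b)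
    {ν f : GCfg N d K → ℝ} (hν : ∀ η, 0 < ν η) (hf : ∀ η, 0 < f η) :
    ∑ η, genL p (fun η => Real.log (f η)) η * (f η * ν η)
      ≤ -dirichletForm p f ν + ∑ η, ν η * genL p f η := by
  have h1 : dirichletForm p f ν = ∑ η, ν η * ∑ i : Fin d, ∑ b : Bool, ∑ x : Site N d,
      jumpRate p η x i b * (√(f (cfgJump η x (siteMove x i b))) - √(f η)) ^ 2 := by
    unfold dirichletForm
    simp_rw [Finset.mul_sum]
    conv_rhs => rw [Finset.sum_comm]
    refine Finset.sum_congr rfl fun i _ => ?_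
    conv_rhs => rw [Finset.sum_comm]
    refine Finset.sum_congr rfl fun b _ => ?_
    conv_rhs => rw [Finset.sum_comm]
    refine Finset.sum_congr rfl fun x _ => Finset.sum_congr rfl fun η _ => by ring
  rw [h1, ← Finset.sum_neg_distrib, ← Finset.sum_add_distrib]
  refine Finset.sum_le_sum fun η _ => ?_
  unfold genL
  rw [← mul_neg, ← mul_add, ← mul_assoc, mul_comm _ (ν η), mul_comm _ (f η)]
  refine mul_le_mul_of_nonneg_left ?_ (hν η).le
  simp only [Finset.mul_sum, ← Finset.sum_neg_distrib, ← Finset.sum_add_distrib]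
  refine Finset.sum_le_sum fun i _ => Finset.sum_le_sum fun b _ => Finset.sum_le_sum fun x _ => ?_
  have := mul_le_mul_of_nonneg_left (mul_log_sub_log_le (hf η) (hf (cfgJump η x (siteMove x i b))))
    (jumpRate_nonneg hp η x i b)
  linarith

/-! ### Integration by parts along a bond -/

theorem abs_sum_mul_omVar_sub_le {N d K : ℕ} {a : Site N d → ℝ} {c₀ : ℝ} (hc : 0 < c₀)
    (h0 : ∀ x, c₀ ≤ a x) (h1 : ∀ x, a x ≤ K - c₀) {x y : Site N d} (hxy : x ≠ y)
    {f h : GCfg N d K → ℝ} (hf : ∀ η, 0 ≤ f η) (hh : ∀ η, h (cfgJump η x y) = h η)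
    {β : ℝ} (hβ : 0 < β) :
    |∑ η, prodBinom a η * f η * (h η * (omVar a η y - omVar a η x))|
      ≤ β * ∑ η, prodBinom a η * ((η x).val * ((K : ℝ) - (η y).val))
            * (√(f (cfgJump η x y)) - √(f η)) ^ 2
        + (K ^ 2 + K ^ 4 / c₀ ^ 2) / (2 * (K * c₀ ^ 2) ^ 2) / β
            * ∑ η, prodBinom a η * f η * h η ^ 2
        + |a y - a x| * (K / c₀ ^ 2) ^ 2 * ∑ η, prodBinom a η * f η * |h η| := by
  have hpos : ∀ z, 0 < a z := fun z => hc.trans_le (h0 z)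
  have hlt : ∀ z, a z < K := fun z => by linarith [h1 z]
  have hK : (0 : ℝ) < K := (hpos x).trans (hlt x)
  have hν : ∀ η : GCfg N d K, 0 < prodBinom a η := prodBinom_pos hpos hlt
  have hval : ∀ (η : GCfg N d K) z, (0 : ℝ) ≤ ((η z).val : ℝ) ∧ ((η z).val : ℝ) ≤ K := fun η z =>
    ⟨by positivity, by exact_mod_cast Nat.lt_succ_iff.1 (η z).isLt⟩
  set r : GCfg N d K → ℝ := fun η => (η x).val * ((K : ℝ) - (η y).val) with hr
  have hr0 : ∀ η, 0 ≤ r η := fun η => mul_nonneg (hval η x).1 (by linarith [(hval η y).2])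
  have hrK : ∀ η, r η ≤ K ^ 2 := fun η => by
    rw [pow_two]
    exact mul_le_mul (hval η x).2 (by linarith [(hval η y).1]) (by linarith [(hval η y).2]) hK.le
  set q := K * (a x * (K - a y)) with hq
  have hqc : K * c₀ ^ 2 ≤ q := by
    rw [hq, pow_two]
    have : c₀ ≤ K - a y := by linarith [h1 y]
    exact mul_le_mul_of_nonneg_left (mul_le_mul (h0 x) this hc.le (hpos x).le) hK.le
  have hq0 : 0 < q := lt_of_lt_of_le (by positivity) hqc
  have hJ := sum_jump_sub hpos hlt hxy (fun η => f η * h η)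
  have hid : ∑ η, prodBinom a η * f η * (h η * (omVar a η y - omVar a η x))
      = q⁻¹ * ∑ η, prodBinom a η * r η * (h η * (f (cfgJump η x y) - f η))
        - (a y - a x) * ∑ η, prodBinom a η * f η * (h η * (omVar a η x * omVar a η y)) := by
    have e : ∀ η, prodBinom a η * r η * (h η * (f (cfgJump η x y) - f η))
        = prodBinom a η * ((η x).val * ((K : ℝ) - (η y).val)) *
          ((fun η => f η * h η) (cfgJump η x y) - (fun η => f η * h η) η) := by
      intro η
      simp only [hh, hr]
      ring
    simp_rw [e]
    rw [hJ, Finset.mul_sum, Finset.mul_sum, ← Finset.sum_sub_distrib]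
    refine Finset.sum_congr rfl fun η _ => ?_
    rw [← hq]
    field_simp
    ring
  have hsecond : |(a y - a x) * ∑ η, prodBinom a η * f η * (h η * (omVar a η x * omVar a η y))|
      ≤ |a y - a x| * (K / c₀ ^ 2) ^ 2 * ∑ η, prodBinom a η * f η * |h η| := by
    rw [abs_mul, mul_assoc]
    refine mul_le_mul_of_nonneg_left ?_ (abs_nonneg _)
    refine (Finset.abs_sum_le_sum_abs _ _).trans ?_
    rw [Finset.mul_sum]
    refine Finset.sum_le_sum fun η _ => ?_
    rw [abs_mul, abs_of_nonneg (mul_nonneg (hν η).le (hf η)), abs_mul, abs_mul]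
    have b1 := abs_omVar_le hc h0 h1 η x
    have b2 := abs_omVar_le hc h0 h1 η y
    have b3 := mul_le_mul b1 b2 (abs_nonneg _) (by positivity)
    have := mul_le_mul_of_nonneg_left b3 (mul_nonneg (mul_nonneg (hν η).le (hf η)) (abs_nonneg (h η)))
    linarith
  set b' := K * c₀ ^ 2 * β with hb'
  have hb'0 : 0 < b' := by positivity
  have hpt : ∀ η, |prodBinom a η * r η * (h η * (f (cfgJump η x y) - f η))|
      ≤ b' * (prodBinom a η * r η * (√(f (cfgJump η x y)) - √(f η)) ^ 2)
        + (2 * b')⁻¹ * (prodBinom a η * r η * (h η ^ 2 * (f (cfgJump η x y) + f η))) := by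
    intro η
    set s := √(f η) with hs
    set t := √(f (cfgJump η x y)) with ht
    have hs2 : s ^ 2 = f η := Real.sq_sqrt (hf _)
    have ht2 : t ^ 2 = f (cfgJump η x y) := Real.sq_sqrt (hf _)
    have hs0 : 0 ≤ s := Real.sqrt_nonneg _
    have ht0 : 0 ≤ t := Real.sqrt_nonneg _
    have hw : 0 ≤ prodBinom a η * r η := mul_nonneg (hν η).le (hr0 η)
    rw [abs_mul, abs_of_nonneg hw, abs_mul, ← hs2, ← ht2]
    have h6 : |t ^ 2 - s ^ 2| = |t - s| * (t + s) := by
      rw [show t ^ 2 - s ^ 2 = (t - s) * (t + s) by ring, abs_mul, abs_of_nonneg (add_nonneg ht0 hs0)]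
    have h7 : |h η| * (|t - s| * (t + s))
        ≤ b' * (t - s) ^ 2 + (2 * b')⁻¹ * (h η ^ 2 * (t ^ 2 + s ^ 2)) := by
      have e1 : |t - s| ^ 2 = (t - s) ^ 2 := sq_abs _
      have e2 : |h η| ^ 2 = h η ^ 2 := sq_abs _
      rw [← e1, ← e2]
      set A := |t - s|
      set H := |h η|
      have e3 : (2 * b')⁻¹ * (H ^ 2 * (t ^ 2 + s ^ 2)) = (H ^ 2 * (t ^ 2 + s ^ 2)) / (2 * b') := by
        rw [div_eq_inv_mul]
      rw [e3]
      have hle : H ^ 2 * (t + s) ^ 2 / (4 * b') ≤ (H ^ 2 * (t ^ 2 + s ^ 2)) / (2 * b') := by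
        rw [div_le_div_iff₀ (by positivity) (by positivity)]
        have : H ^ 2 * (t + s) ^ 2 ≤ H ^ 2 * (2 * (t ^ 2 + s ^ 2)) := by
          refine mul_le_mul_of_nonneg_left ?_ (sq_nonneg _)
          nlinarith [sq_nonneg (t - s)]
        nlinarith
      refine le_trans ?_ (add_le_add_right hle _)
      have : b' * A ^ 2 + H ^ 2 * (t + s) ^ 2 / (4 * b') - H * (A * (t + s))
          = (2 * b' * A - H * (t + s)) ^ 2 / (4 * b') := by
        field_simp
        ring
      have h8 : 0 ≤ (2 * b' * A - H * (t + s)) ^ 2 / (4 * b') := by positivity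
      linarith
    rw [h6]
    have := mul_le_mul_of_nonneg_left h7 hw
    linarith
  have hS2 : ∑ η, prodBinom a η * r η * (h η ^ 2 * (f (cfgJump η x y) + f η))
      ≤ (K ^ 2 + K ^ 4 / c₀ ^ 2) * ∑ η, prodBinom a η * f η * h η ^ 2 := by
    have e : ∑ η, prodBinom a η * r η * (h η ^ 2 * (f (cfgJump η x y) + f η))
        = ∑ η, prodBinom a η * ((η x).val * ((K : ℝ) - (η y).val)) *
            ((fun η => f η * h η ^ 2) (cfgJump η x y))
          + ∑ η, prodBinom a η * r η * (h η ^ 2 * f η) := by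
      rw [← Finset.sum_add_distrib]
      refine Finset.sum_congr rfl fun η _ => ?_
      simp only [hh, hr]
      ring
    rw [e, sum_prodBinom_cfgJump hpos hlt hxy (fun η => f η * h η ^ 2), add_mul, add_comm, Finset.mul_sum, Finset.mul_sum]
    have hw : ∀ η, 0 ≤ prodBinom a η * f η * h η ^ 2 := fun η =>
      mul_nonneg (mul_nonneg (hν η).le (hf η)) (sq_nonneg _)
    refine add_le_add (Finset.sum_le_sum fun η _ => ?_) (Finset.sum_le_sum fun η _ => ?_)
    · have := mul_le_mul_of_nonneg_right (hrK η) (hw η)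
      linarith
    · have g1 : a x * (K - a y) / ((K - a x) * a y) ≤ K ^ 2 / c₀ ^ 2 := by
        have j1 : c₀ ≤ K - a x := by linarith [h1 x]
        have j2 : K - a y ≤ K := by linarith [hpos y]
        have j3 : 0 ≤ K - a y := by linarith [hlt y]
        refine div_le_div₀ (by positivity) ?_ (by positivity) ?_
        · rw [pow_two]
          exact mul_le_mul (hlt x).le j2 j3 hK.le
        · rw [pow_two]
          exact mul_le_mul j1 (h0 y) hc.le (by linarith)
      have g2 : ((η y).val : ℝ) * ((K : ℝ) - (η x).val) ≤ K ^ 2 := by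
        rw [pow_two]
        exact mul_le_mul (hval η y).2 (by linarith [(hval η x).1]) (by linarith [(hval η x).2]) hK.le
      have g3 : (0 : ℝ) ≤ a x * (K - a y) / ((K - a x) * a y) := by
        have j1 : 0 < K - a x := by linarith [hlt x]
        have j3 : 0 < K - a y := by linarith [hlt y]
        have := hpos x
        have := hpos y
        positivity
      have g4 := mul_le_mul g2 g1 g3 (by positivity)
      have := mul_le_mul_of_nonneg_right g4 (hw η)
      have e2 : (K : ℝ) ^ 2 * (K ^ 2 / c₀ ^ 2) = K ^ 4 / c₀ ^ 2 := by ring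
      rw [e2] at this
      linarith
  have hfirst : |q⁻¹ * ∑ η, prodBinom a η * r η * (h η * (f (cfgJump η x y) - f η))|
      ≤ β * ∑ η, prodBinom a η * r η * (√(f (cfgJump η x y)) - √(f η)) ^ 2
        + (K ^ 2 + K ^ 4 / c₀ ^ 2) / (2 * (K * c₀ ^ 2) ^ 2) / β
            * ∑ η, prodBinom a η * f η * h η ^ 2 := by
    rw [abs_mul, abs_of_pos (inv_pos.2 hq0)]
    have hqi : q⁻¹ ≤ (K * c₀ ^ 2)⁻¹ := inv_anti₀ (by positivity) hqc
    have h9 : |∑ η, prodBinom a η * r η * (h η * (f (cfgJump η x y) - f η))|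
        ≤ b' * ∑ η, prodBinom a η * r η * (√(f (cfgJump η x y)) - √(f η)) ^ 2
          + (2 * b')⁻¹ * ((K ^ 2 + K ^ 4 / c₀ ^ 2) * ∑ η, prodBinom a η * f η * h η ^ 2) := by
      refine (Finset.abs_sum_le_sum_abs _ _).trans ((Finset.sum_le_sum fun η _ => hpt η).trans ?_)
      rw [Finset.sum_add_distrib, ← Finset.mul_sum, ← Finset.mul_sum]
      gcongr
    refine (mul_le_mul hqi h9 (abs_nonneg _) (by positivity)).trans (le_of_eq ?_)
    rw [hb']
    field_simp
  rw [hid]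
  refine (abs_sub _ _).trans ?_
  exact add_le_add hfirst hsecond

/-! ### Flows on the discrete torus -/

theorem add_nsmul_single_apply_of_ne {N d : ℕ} [NeZero N] (y : Site N d) (r : ℕ) {i j : Fin d}
    (h : i ≠ j) : (y + r • (Pi.single j 1 : Site N d)) i = y i := by
  simp [h]

theorem val_nsmul_one {N : ℕ} [NeZero N] (r : ℕ) : (r • (1 : Fin N)).val = r % N := by
  induction r with
  | zero => simp
  | succ r ih => rw [succ_nsmul, Fin.val_add, ih, Fin.coe_ofNat_eq_mod, ← Nat.add_mod]

theorem val_add_nsmul_single {N d : ℕ} [NeZero N] (y : Site N d) (r : ℕ) (j : Fin d)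
    (h : (y j).val + r < N) : ((y + r • (Pi.single j 1 : Site N d)) j).val = (y j).val + r := by
  rw [Pi.add_apply, Pi.smul_apply, Pi.single_eq_same, Fin.val_add, val_nsmul_one,
    Nat.add_mod_mod, Nat.mod_eq_of_lt h]

/-- `q` is a probability vector bounded by `c` and supported in the box with sides `s`. -/
structure IsBoxKernel {N d : ℕ} (q : Site N d → ℝ) (s : Fin d → ℕ) (c : ℝ) : Prop where
  nonneg : ∀ y, 0 ≤ q y
  le : ∀ y, q y ≤ c
  sum_eq : ∑ y, q y = 1
  supp : ∀ y, q y ≠ 0 → ∀ i, (y i).val < s i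

theorem sum_shift {G : Type*} [AddCommGroup G] [Fintype G] (e : G) (q v : G → ℝ) :
    ∑ y, q (y - e) * v y = ∑ y, q y * v (y + e) :=
  (Fintype.sum_equiv (Equiv.addRight e) (fun y => q y * v (y + e)) (fun y => q (y - e) * v y)
    (fun y => by simp)).symm

/-- Doubling the side of a box in the direction `j`. -/
theorem IsBoxKernel.double {N d : ℕ} [NeZero N] {q : Site N d → ℝ} {s : Fin d → ℕ} {c : ℝ}
    (hq : IsBoxKernel q s c) (j : Fin d) (hs : 2 * s j ≤ N) :
    ∃ q' Φ : Site N d → ℝ, IsBoxKernel q' (Function.update s j (2 * s j)) (c / 2) ∧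
      (∀ z, 0 ≤ Φ z) ∧ (∀ z, Φ z ≤ s j * c) ∧ (∑ z, Φ z ≤ s j) ∧
      (∀ z, Φ z ≠ 0 → ∀ i, (z i).val < Function.update s j (2 * s j) i) ∧
      ∀ v : Site N d → ℝ, ∑ y, q y * v y - ∑ y, q' y * v y
        = ∑ z, Φ z * (v z - v (z + Pi.single j 1)) := by
  set e : Site N d := Pi.single j 1 with he
  have hc : 0 ≤ c := (hq.nonneg 0).trans (hq.le 0)
  have hsupp : ∀ r ≤ s j, ∀ z, q (z - r • e) ≠ 0 →
      (∀ i, (z i).val < Function.update s j (2 * s j) i) ∧ r ≤ (z j).val := by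
    intro r hr z hz
    have h1 := hq.supp _ hz
    have h2 : z = (z - r • e) + r • e := by simp
    have h3 : (z j).val = ((z - r • e) j).val + r := by
      conv_lhs => rw [h2]
      exact val_add_nsmul_single _ _ _ (by have := h1 j; omega)
    refine ⟨fun i => ?_, by omega⟩
    by_cases hij : i = j
    · subst hij
      have := h1 i
      rw [Function.update_self]
      omega
    · rw [Function.update_of_ne hij]
      have := h1 i
      rw [← add_nsmul_single_apply_of_ne (z - r • e) r hij, ← he, ← h2] at this
      exact this
  refine ⟨fun y => (q y + q (y - s j • e)) / 2,
    fun z => (∑ r ∈ Finset.range (s j), q (z - r • e)) / 2, ⟨?_, ?_, ?_, ?_⟩, ?_, ?_, ?_, ?_, ?_⟩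
  · intro y
    have := hq.nonneg y
    have := hq.nonneg (y - s j • e)
    positivity
  · intro y
    by_cases h : q (y - s j • e) = 0
    · simp only [h]
      linarith [hq.le y]
    · have h1 := (hsupp _ le_rfl y h).2
      have h2 : q y = 0 := by
        by_contra h3
        have := hq.supp y h3 j
        omega
      simp only [h2]
      linarith [hq.le (y - s j • e)]
  · have h1 := sum_shift (s j • e) q (fun _ => 1)
    simp only [mul_one, hq.sum_eq] at h1
    rw [← Finset.sum_div, Finset.sum_add_distrib, hq.sum_eq, h1]
    norm_num
  · intro y hy i
    by_cases h : q (y - s j • e) = 0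
    · have h1 : q y ≠ 0 := by
        intro h2
        simp [h, h2] at hy
      have h2 := hq.supp y h1 i
      by_cases hij : i = j
      · subst hij
        rw [Function.update_self]
        omega
      · rwa [Function.update_of_ne hij]
    · exact (hsupp _ le_rfl y h).1 i
  · intro z
    have := Finset.sum_nonneg fun r (_ : r ∈ Finset.range (s j)) => hq.nonneg (z - r • e)
    positivity
  · intro z
    have h1 := Finset.sum_le_sum fun r (_ : r ∈ Finset.range (s j)) => hq.le (z - r • e)
    rw [Finset.sum_const, Finset.card_range, nsmul_eq_mul] at h1
    have : 0 ≤ s j * c := by positivity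
    linarith
  · rw [← Finset.sum_div, Finset.sum_comm]
    have h1 : ∀ r : ℕ, ∑ z, q (z - r • e) = 1 := by
      intro r
      have := sum_shift (r • e) q (fun _ => 1)
      simpa [hq.sum_eq] using this
    simp only [h1, Finset.sum_const, Finset.card_range, nsmul_eq_mul, mul_one]
    have : (0 : ℝ) ≤ s j := by positivity
    linarith
  · intro z hz
    have h1 : ∑ r ∈ Finset.range (s j), q (z - r • e) ≠ 0 := by
      intro h
      simp [h] at hz
    obtain ⟨r, hr, hr2⟩ := Finset.exists_ne_zero_of_sum_ne_zero h1
    exact (hsupp r (Finset.mem_range.1 hr).le z hr2).1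
  · intro v
    have h1 : ∀ r : ℕ, ∑ z, q (z - r • e) * (v z - v (z + e))
        = ∑ y, q y * v (y + r • e) - ∑ y, q y * v (y + (r + 1) • e) := by
      intro r
      have := sum_shift (r • e) q (fun z => v z - v (z + e))
      rw [this, ← Finset.sum_sub_distrib]
      refine Finset.sum_congr rfl fun y _ => ?_
      rw [add_smul, one_smul, add_assoc, mul_sub]
    have h2 : ∑ z, (∑ r ∈ Finset.range (s j), q (z - r • e)) / 2 * (v z - v (z + e))
        = (∑ r ∈ Finset.range (s j), ∑ z, q (z - r • e) * (v z - v (z + e))) / 2 := by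
      rw [Finset.sum_comm, Finset.sum_div]
      refine Finset.sum_congr rfl fun z _ => ?_
      rw [← Finset.sum_mul]
      ring
    rw [h2, Finset.sum_congr rfl fun r _ => h1 r,
      Finset.sum_range_sub' (fun r => ∑ y, q y * v (y + r • e))]
    have h3 : ∑ y, (q y + q (y - s j • e)) / 2 * v y
        = (∑ y, q y * v y + ∑ y, q y * v (y + s j • e)) / 2 := by
      rw [← sum_shift (s j • e) q v, ← Finset.sum_add_distrib, Finset.sum_div]
      refine Finset.sum_congr rfl fun z _ => by ring
    rw [h3]
    simp only [zero_smul, add_zero]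
    ring

theorem IsBoxKernel.double_on {N d : ℕ} [NeZero N] {q : Site N d → ℝ} {l : ℕ} {c : ℝ}
    (hq : IsBoxKernel q (fun _ => l) c) (hl : 2 * l ≤ N) (A : Finset (Fin d)) :
    ∃ (q' : Site N d → ℝ) (Φ : Fin d → Site N d → ℝ),
      IsBoxKernel q' (fun i => if i ∈ A then 2 * l else l) (c / 2 ^ A.card) ∧
      (∀ j z, 0 ≤ Φ j z) ∧ (∀ j z, Φ j z ≤ l * c) ∧ (∀ j, ∑ z, Φ j z ≤ l) ∧
      (∀ j z, Φ j z ≠ 0 → ∀ i, (z i).val < 2 * l) ∧ (∀ j ∉ A, ∀ z, Φ j z = 0) ∧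
      ∀ v : Site N d → ℝ, ∑ y, q y * v y - ∑ y, q' y * v y
        = ∑ j, ∑ z, Φ j z * (v z - v (z + Pi.single j 1)) := by
  have hc : 0 ≤ c := (hq.nonneg 0).trans (hq.le 0)
  induction A using Finset.induction_on with
  | empty =>
    refine ⟨q, fun _ _ => 0, by simpa using hq, ?_, ?_, ?_, ?_, ?_, ?_⟩
    · intro j z
      exact le_rfl
    · intro j z
      positivity
    · simp
    · simp
    · simp
    · simp
  | insert j A hj ih =>
    obtain ⟨q₁, Φ, hq₁, h0, hle, hsum, hsupp, hzero, hid⟩ := ih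
    obtain ⟨q₂, Ψ, hq₂, k0, kle, ksum, ksupp, kid⟩ := hq₁.double j (by simp [hj, hl])
    have hs : Function.update (fun i => if i ∈ A then 2 * l else l) j
        (2 * (if j ∈ A then 2 * l else l)) = fun i => if i ∈ insert j A then 2 * l else l := by
      funext i
      by_cases hij : i = j
      · subst hij
        simp [hj]
      · simp [hij]
    have hc2 : c / 2 ^ A.card ≤ c := div_le_self hc (one_le_pow₀ (by norm_num))
    rw [hs] at hq₂ ksupp
    simp only [hj, if_false] at kle ksum
    refine ⟨q₂, Function.update Φ j Ψ, ?_, ?_, ?_, ?_, ?_, ?_, ?_⟩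
    · rw [Finset.card_insert_of_notMem hj, pow_succ, ← div_div]
      exact hq₂
    · intro i z
      by_cases hij : i = j
      · subst hij
        rw [Function.update_self]
        exact k0 z
      · rw [Function.update_of_ne hij]
        exact h0 i z
    · intro i z
      by_cases hij : i = j
      · subst hij
        rw [Function.update_self]
        exact (kle z).trans (by gcongr)
      · rw [Function.update_of_ne hij]
        exact hle i z
    · intro i
      by_cases hij : i = j
      · subst hij
        rw [Function.update_self]
        exact ksum
      · rw [Function.update_of_ne hij]
        exact hsum i
    · intro i z
      by_cases hij : i = j
      · subst hij
        rw [Function.update_self]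
        intro h i'
        have := ksupp z h i'
        dsimp only at this
        split_ifs at this <;> omega
      · rw [Function.update_of_ne hij]
        exact hsupp i z
    · intro i hi z
      rw [Finset.mem_insert, not_or] at hi
      rw [Function.update_of_ne hi.1]
      exact hzero i hi.2 z
    · intro v
      have h1 : ∑ i, ∑ z, Function.update Φ j Ψ i z * (v z - v (z + Pi.single i 1))
          = ∑ i, (∑ z, Φ i z * (v z - v (z + Pi.single i 1))
            + if i = j then ∑ z, Ψ z * (v z - v (z + Pi.single j 1)) else 0) := by
        refine Finset.sum_congr rfl fun i _ => ?_
        by_cases hij : i = j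
        · subst hij
          simp [hzero i hj]
        · simp [hij]
      rw [h1, Finset.sum_add_distrib, ← hid, Finset.sum_ite_eq' Finset.univ j, ← kid]
      simp

/-- A flow from the Dirac mass at the origin to a box of side `2 ^ m`. -/
theorem exists_box_flow {N d : ℕ} [NeZero N] {n : ℕ} (hn : 2 ^ n ≤ N) {γ : ℝ}
    (hγ : ∀ k < n, (2 : ℝ) ^ (2 * k) / (2 ^ d) ^ k ≤ γ) (m : ℕ) (hm : m ≤ n) :
    ∃ (q : Site N d → ℝ) (Φ : Fin d → Site N d → ℝ),
      IsBoxKernel q (fun _ => 2 ^ m) (1 / (2 ^ d) ^ m) ∧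
      (∀ j z, 0 ≤ Φ j z) ∧ (∀ j, ∑ z, Φ j z ≤ 2 ^ m) ∧
      (∀ j, ∑ z, Φ j z ^ 2 ≤ m ^ 2 * γ) ∧
      (∀ j z, Φ j z ≠ 0 → ∀ i, (z i).val < 2 ^ m) ∧
      ∀ v : Site N d → ℝ, v 0 - ∑ y, q y * v y
        = ∑ j, ∑ z, Φ j z * (v z - v (z + Pi.single j 1)) := by
  induction m with
  | zero =>
    refine ⟨fun y => if y = 0 then 1 else 0, fun _ _ => 0, ⟨?_, ?_, ?_, ?_⟩, ?_, ?_, ?_, ?_, ?_⟩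
    · intro y
      split_ifs <;> norm_num
    · intro y
      simp only [pow_zero, div_one]
      split_ifs <;> norm_num
    · simp
    · intro y hy i
      have : y = 0 := by
        by_contra h
        simp [h] at hy
      simp [this]
    · intro j z
      exact le_rfl
    · simp
    · simp
    · simp
    · simp
  | succ m ih =>
    obtain ⟨q, Φ, hq, h0, hsum, hsq, hsupp, hid⟩ := ih (by omega)
    have hl : 2 * 2 ^ m ≤ N := by
      rw [← pow_succ']
      exact (Nat.pow_le_pow_right (by norm_num) hm).trans hn
    obtain ⟨q', Ψ, hq', k0, kle, ksum, ksupp, -, kid⟩ := hq.double_on hl Finset.univ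
    simp only [Finset.mem_univ, if_true, Finset.card_univ, Fintype.card_fin] at hq'
    rw [← pow_succ', div_div, ← pow_succ] at hq'
    push_cast at ksum kle
    refine ⟨q', fun j z => Φ j z + Ψ j z, hq', ?_, ?_, ?_, ?_, ?_⟩
    · intro j z
      exact add_nonneg (h0 j z) (k0 j z)
    · intro j
      rw [Finset.sum_add_distrib, pow_succ]
      linarith [hsum j, ksum j]
    · intro j
      have hγm := hγ m (by omega)
      have hγ0 : 0 ≤ γ := le_trans (by positivity) hγm
      have h1 : ∑ z, Ψ j z ^ 2 ≤ γ := by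
        calc ∑ z, Ψ j z ^ 2 ≤ ∑ z, (2 ^ m * (1 / (2 ^ d) ^ m)) * Ψ j z := by
              refine Finset.sum_le_sum fun z _ => ?_
              rw [pow_two]
              exact mul_le_mul_of_nonneg_right (kle j z) (k0 j z)
          _ ≤ (2 ^ m * (1 / (2 ^ d) ^ m)) * 2 ^ m := by
              rw [← Finset.mul_sum]
              exact mul_le_mul_of_nonneg_left (ksum j) (by positivity)
          _ = (2 : ℝ) ^ (2 * m) / (2 ^ d) ^ m := by
              rw [two_mul, pow_add]
              ring
          _ ≤ γ := hγm
      rcases Nat.eq_zero_or_pos m with hm0 | hm0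
      · subst hm0
        have hz : ∀ z, Φ j z ^ 2 = 0 := by
          have h2 := hsq j
          simp only [CharP.cast_eq_zero, ne_eq, OfNat.ofNat_ne_zero, not_false_eq_true, zero_pow,
            zero_mul] at h2
          have h3 := le_antisymm h2 (Finset.sum_nonneg fun z _ => sq_nonneg (Φ j z))
          intro z
          exact (Finset.sum_eq_zero_iff_of_nonneg fun z _ => sq_nonneg _).1 h3 z (Finset.mem_univ z)
        have hz' : ∀ z, Φ j z = 0 := fun z => pow_eq_zero_iff (two_ne_zero) |>.1 (hz z)
        simpa [hz'] using h1
      · have hm1 : (0 : ℝ) < m := by exact_mod_cast hm0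
        have h2 : ∀ z, (Φ j z + Ψ j z) ^ 2
            ≤ (1 + 1 / m) * Φ j z ^ 2 + (1 + m) * Ψ j z ^ 2 := by
          intro z
          have : (1 + 1 / (m : ℝ)) * Φ j z ^ 2 + (1 + m) * Ψ j z ^ 2 - (Φ j z + Ψ j z) ^ 2
              = (Φ j z - m * Ψ j z) ^ 2 / m := by
            field_simp
            ring
          have h4 : 0 ≤ (Φ j z - m * Ψ j z) ^ 2 / m := by positivity
          linarith
        calc ∑ z, (Φ j z + Ψ j z) ^ 2
            ≤ (1 + 1 / m) * ∑ z, Φ j z ^ 2 + (1 + m) * ∑ z, Ψ j z ^ 2 := by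
              rw [Finset.mul_sum, Finset.mul_sum, ← Finset.sum_add_distrib]
              exact Finset.sum_le_sum fun z _ => h2 z
          _ ≤ (1 + 1 / m) * (m ^ 2 * γ) + (1 + m) * γ := by
              gcongr
              exact hsq j
          _ = ((m + 1 : ℕ) : ℝ) ^ 2 * γ := by
              push_cast
              field_simp
              ring
    · intro j z hz i
      by_cases h : Ψ j z = 0
      · have h1 : Φ j z ≠ 0 := by
          intro h2
          simp [h, h2] at hz
        have := hsupp j z h1 i
        rw [pow_succ]
        omega
      · have := ksupp j z h i
        rw [pow_succ]
        omega
    · intro v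
      simp only [add_mul, Finset.sum_add_distrib]
      rw [← hid, ← kid]
      ring

/-- Young's inequality for a convolution with an `ℓ¹` kernel. -/
theorem sum_conv_sq_le {G : Type*} [AddCommGroup G] [Fintype G] {q : G → ℝ} (hq : ∀ y, 0 ≤ q y)
    (v : G → ℝ) :
    ∑ z, (∑ y, q (z - y) * v y) ^ 2 ≤ (∑ y, q y) ^ 2 * ∑ y, v y ^ 2 := by
  have h1 : ∀ z, ∑ y, q (z - y) = ∑ y, q y := fun z =>
    Fintype.sum_equiv (Equiv.subLeft z) _ _ (fun y => by simp)
  have h1' : ∀ y, ∑ z, q (z - y) = ∑ y, q y := fun y =>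
    Fintype.sum_equiv (Equiv.subRight y) _ _ (fun z => by simp)
  have h2 : ∀ z, (∑ y, q (z - y) * v y) ^ 2 ≤ (∑ y, q y) * ∑ y, q (z - y) * v y ^ 2 := by
    intro z
    rw [← h1 z]
    exact Finset.sum_sq_le_sum_mul_sum_of_sq_le_mul _ (fun y _ => hq _)
      (fun y _ => mul_nonneg (hq _) (sq_nonneg _)) (fun y _ => le_of_eq (by ring))
  refine (Finset.sum_le_sum fun z _ => h2 z).trans (le_of_eq ?_)
  rw [← Finset.mul_sum, Finset.sum_comm]
  simp_rw [← Finset.sum_mul, h1']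
  rw [pow_two, mul_assoc, ← Finset.mul_sum]

/-- A flow from the Dirac mass at the origin to the law of the sum of two independent points of a
box of side `2 ^ n`. -/
theorem exists_double_box_flow {N d : ℕ} [NeZero N] {n : ℕ} (hn : 2 * 2 ^ n ≤ N) {γ : ℝ}
    (hγ : ∀ k < n, (2 : ℝ) ^ (2 * k) / (2 ^ d) ^ k ≤ γ) :
    ∃ (q : Site N d → ℝ) (Φ : Fin d → Site N d → ℝ),
      (∀ y, 0 ≤ q y) ∧ (∑ y, q y = 1) ∧ (∑ y, q y ^ 2 ≤ 1 / (2 ^ d) ^ n) ∧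
      (∀ j z, 0 ≤ Φ j z) ∧ (∀ j, ∑ z, Φ j z ≤ 2 * 2 ^ n) ∧
      (∀ j, ∑ z, Φ j z ^ 2 ≤ 4 * n ^ 2 * γ) ∧
      (∀ j z, Φ j z ≠ 0 → ∀ i, (z i).val < 2 * 2 ^ n) ∧
      ∀ v : Site N d → ℝ, v 0 - ∑ y, q y * ∑ y', q y' * v (y + y')
        = ∑ j, ∑ z, Φ j z * (v z - v (z + Pi.single j 1)) := by
  obtain ⟨q, Φ, hq, h0, hsum, hsq, hsupp, hid⟩ :=
    exists_box_flow (N := N) (d := d) (by omega : 2 ^ n ≤ N) hγ n le_rfl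
  have hconv : ∀ j, ∑ z, ∑ y, Φ j (z - y) * q y = ∑ z, Φ j z := by
    intro j
    rw [Finset.sum_comm]
    simp_rw [← Finset.sum_mul]
    have h1' : ∀ y, ∑ z, Φ j (z - y) = ∑ y, Φ j y := fun y =>
      Fintype.sum_equiv (Equiv.subRight y) _ _ (fun z => by simp)
    simp_rw [h1']
    rw [← Finset.mul_sum, hq.sum_eq, mul_one]
  refine ⟨q, fun j z => Φ j z + ∑ y, Φ j (z - y) * q y, hq.nonneg, hq.sum_eq, ?_, ?_, ?_, ?_, ?_, ?_⟩
  · calc ∑ y, q y ^ 2 ≤ ∑ y, (1 / (2 ^ d) ^ n) * q y := by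
          refine Finset.sum_le_sum fun y _ => ?_
          rw [pow_two]
          exact mul_le_mul_of_nonneg_right (hq.le y) (hq.nonneg y)
      _ = 1 / (2 ^ d) ^ n := by rw [← Finset.mul_sum, hq.sum_eq, mul_one]
  · intro j z
    exact add_nonneg (h0 j z) (Finset.sum_nonneg fun y _ => mul_nonneg (h0 _ _) (hq.nonneg _))
  · intro j
    rw [Finset.sum_add_distrib, hconv]
    linarith [hsum j]
  · intro j
    have h1 : ∑ z, (∑ y, Φ j (z - y) * q y) ^ 2 ≤ ∑ z, Φ j z ^ 2 := by
      have h2 := sum_conv_sq_le hq.nonneg (Φ j)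
      rw [hq.sum_eq, one_pow, one_mul] at h2
      refine le_trans (le_of_eq (Finset.sum_congr rfl fun z _ => ?_)) h2
      congr 1
      exact Fintype.sum_equiv (Equiv.subLeft z) _ _ (fun y => by simp [mul_comm])
    calc ∑ z, (Φ j z + ∑ y, Φ j (z - y) * q y) ^ 2
        ≤ ∑ z, (2 * Φ j z ^ 2 + 2 * (∑ y, Φ j (z - y) * q y) ^ 2) := by
          refine Finset.sum_le_sum fun z _ => ?_
          nlinarith [sq_nonneg (Φ j z - ∑ y, Φ j (z - y) * q y)]
      _ ≤ 4 * n ^ 2 * γ := by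
          rw [Finset.sum_add_distrib, ← Finset.mul_sum, ← Finset.mul_sum]
          linarith [hsq j]
  · intro j z hz i
    by_cases h : Φ j z = 0
    · have h1 : ∑ y, Φ j (z - y) * q y ≠ 0 := by
        intro h2
        simp [h, h2] at hz
      obtain ⟨y, -, hy⟩ := Finset.exists_ne_zero_of_sum_ne_zero h1
      have h3 := hsupp j _ (left_ne_zero_of_mul hy) i
      have h4 := hq.supp y (right_ne_zero_of_mul hy) i
      have h5 : z i = (z - y) i + y i := by simp
      rw [h5, Fin.val_add]
      refine (Nat.mod_le _ _).trans_lt ?_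
      omega
    · have := hsupp j z h i
      omega
  · intro v
    have h1 : ∀ y, v y - ∑ y', q y' * v (y + y')
        = ∑ j, ∑ z, Φ j z * (v (y + z) - v (y + z + Pi.single j 1)) := by
      intro y
      have := hid (fun z => v (y + z))
      simp only [add_zero] at this
      simpa only [add_assoc] using this
    have h2 : ∑ y, q y * v y - ∑ y, q y * ∑ y', q y' * v (y + y')
        = ∑ j, ∑ z, (∑ y, Φ j (z - y) * q y) * (v z - v (z + Pi.single j 1)) := by
      rw [← Finset.sum_sub_distrib]
      simp_rw [← mul_sub, h1, Finset.mul_sum]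
      rw [Finset.sum_comm]
      refine Finset.sum_congr rfl fun j _ => ?_
      simp_rw [Finset.sum_mul]
      conv_rhs => rw [Finset.sum_comm]
      refine Finset.sum_congr rfl fun y _ => ?_
      refine Fintype.sum_equiv (Equiv.addLeft y) _ _ fun z => ?_
      simp only [Equiv.coe_addLeft, add_sub_cancel_left]
      ring
    simp only [add_mul, Finset.sum_add_distrib]
    rw [← h2, ← hid]
    ring

/-- The Dirichlet form of the jumps in a single direction. -/
noncomputable def bondDir {N d K : ℕ} (a : Site N d → ℝ) (f : GCfg N d K → ℝ) (j : Fin d)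
    (b : Bool) : ℝ :=
  ∑ w : Site N d, ∑ η : GCfg N d K,
    prodBinom a η * ((η w).val * ((K : ℝ) - (η (siteMove w j b)).val))
      * (√(f (cfgJump η w (siteMove w j b))) - √(f η)) ^ 2

theorem dirichletForm_eq_sum_bondDir {N d K : ℕ} (p : Fin d → Bool → ℝ) (a : Site N d → ℝ)
    (f : GCfg N d K → ℝ) :
    dirichletForm p f (prodBinom a) = ∑ j, ∑ b : Bool, p j b * bondDir a f j b := by
  unfold dirichletForm bondDir jumpRate
  refine Finset.sum_congr rfl fun j _ => Finset.sum_congr rfl fun b _ => ?_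
  rw [Finset.mul_sum]
  refine Finset.sum_congr rfl fun w _ => ?_
  rw [Finset.mul_sum]
  refine Finset.sum_congr rfl fun η _ => ?_
  ring

theorem bondDir_nonneg {N d K : ℕ} {a : Site N d → ℝ} (h0 : ∀ x, 0 < a x) (h1 : ∀ x, a x < K)
    (f : GCfg N d K → ℝ) (j : Fin d) (b : Bool) : 0 ≤ bondDir a f j b := by
  refine Finset.sum_nonneg fun w _ => Finset.sum_nonneg fun η _ => ?_
  have h4 : (((η (siteMove w j b)).val : ℕ) : ℝ) ≤ K := by
    exact_mod_cast Nat.lt_succ_iff.1 (η (siteMove w j b)).isLt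
  have := (prodBinom_pos h0 h1 η).le
  have h5 : 0 ≤ (K : ℝ) - (η (siteMove w j b)).val := by linarith
  positivity

/-- Entropic integration by parts, summed over all bonds of a given direction. -/
theorem sum_bond_le {N d K : ℕ} [NeZero N] (hN : 2 ≤ N) {a : Site N d → ℝ} {c₀ η₀ : ℝ}
    (hc : 0 < c₀) (h0 : ∀ x, c₀ ≤ a x) (h1 : ∀ x, a x ≤ K - c₀) (j : Fin d)
    (ha : ∀ x, |a (x + Pi.single j 1) - a x| ≤ η₀)
    {f : GCfg N d K → ℝ} (hf : ∀ η, 0 ≤ f η) {h : Site N d → GCfg N d K → ℝ}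
    (hh : ∀ w η, h w (cfgJump η w (w + Pi.single j 1)) = h w η)
    (hh' : ∀ w η, h w (cfgJump η (w + Pi.single j 1) w) = h w η)
    {β : ℝ} (hβ : 0 < β) (b : Bool) :
    ∑ η, prodBinom a η * f η * ∑ w, h w η * (omVar a η w - omVar a η (w + Pi.single j 1))
      ≤ β * bondDir a f j b
        + (K ^ 2 + K ^ 4 / c₀ ^ 2) / (2 * (K * c₀ ^ 2) ^ 2) / β
            * ∑ η, prodBinom a η * f η * ∑ w, h w η ^ 2
        + η₀ * (K / c₀ ^ 2) ^ 2 * ∑ η, prodBinom a η * f η * ∑ w, |h w η| := by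
  have hpos : ∀ z, 0 < a z := fun z => hc.trans_le (h0 z)
  have hlt : ∀ z, a z < K := fun z => by linarith [h1 z]
  have hν : ∀ η : GCfg N d K, 0 < prodBinom a η := prodBinom_pos hpos hlt
  have hne : ∀ w : Site N d, w ≠ w + Pi.single j 1 := fun w => by
    rw [← siteMove_true]
    exact siteMove_ne hN w j true
  have hswap : ∀ F : Site N d → GCfg N d K → ℝ, ∑ η, prodBinom a η * f η * ∑ w, F w η
      = ∑ w, ∑ η, prodBinom a η * f η * F w η := fun F => by
    rw [Finset.sum_comm]
    simp_rw [Finset.mul_sum]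
  rw [hswap, hswap, hswap, Finset.mul_sum, Finset.mul_sum]
  have habs : ∀ w, 0 ≤ ∑ η, prodBinom a η * f η * |h w η| := fun w =>
    Finset.sum_nonneg fun η _ => mul_nonneg (mul_nonneg (hν η).le (hf η)) (abs_nonneg _)
  cases b
  · have e : bondDir a f j false = ∑ w : Site N d, ∑ η : GCfg N d K,
        prodBinom a η * ((η (w + Pi.single j 1)).val * ((K : ℝ) - (η w).val))
          * (√(f (cfgJump η (w + Pi.single j 1) w)) - √(f η)) ^ 2 := by
      unfold bondDir
      refine (Fintype.sum_equiv (Equiv.addRight (Pi.single j 1)) _ _ fun w => ?_).symm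
      simp only [Equiv.coe_addRight, siteMove_false, add_sub_cancel_right]
    rw [e, Finset.mul_sum, ← Finset.sum_add_distrib, ← Finset.sum_add_distrib]
    refine Finset.sum_le_sum fun w _ => ?_
    have h2 := le_of_abs_le
      (abs_sum_mul_omVar_sub_le hc h0 h1 (hne w).symm hf (hh' w) hβ)
    refine h2.trans (add_le_add_right ?_ _)
    rw [abs_sub_comm]
    exact mul_le_mul_of_nonneg_right (mul_le_mul_of_nonneg_right (ha w) (by positivity)) (habs w)
  · have e : bondDir a f j true = ∑ w : Site N d, ∑ η : GCfg N d K,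
        prodBinom a η * ((η w).val * ((K : ℝ) - (η (w + Pi.single j 1)).val))
          * (√(f (cfgJump η w (w + Pi.single j 1))) - √(f η)) ^ 2 := by
      unfold bondDir
      simp only [siteMove_true]
    rw [e, Finset.mul_sum, ← Finset.sum_add_distrib, ← Finset.sum_add_distrib]
    refine Finset.sum_le_sum fun w _ => ?_
    have h2 := neg_le_of_abs_le (abs_sum_mul_omVar_sub_le hc h0 h1 (hne w) hf (hh w) hβ)
    have h3 : ∑ η, prodBinom a η * f η * (h w η * (omVar a η w - omVar a η (w + Pi.single j 1)))
        = -∑ η, prodBinom a η * f η * (h w η * (omVar a η (w + Pi.single j 1) - omVar a η w)) := by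
      rw [← Finset.sum_neg_distrib]
      exact Finset.sum_congr rfl fun η _ => by ring
    rw [h3]
    refine (neg_le.1 h2).trans (add_le_add_right ?_ _)
    exact mul_le_mul_of_nonneg_right (mul_le_mul_of_nonneg_right (ha w) (by positivity)) (habs w)

/-- Rewriting a nearest neighbour quadratic form with the help of a flow. -/
theorem sum_mul_shift_eq_of_flow {N d : ℕ} [NeZero N] {q : Site N d → ℝ}
    {Φ : Fin d → Site N d → ℝ}
    (hflow : ∀ v : Site N d → ℝ, v 0 - ∑ y, q y * ∑ y', q y' * v (y + y')
        = ∑ j, ∑ z, Φ j z * (v z - v (z + Pi.single j 1)))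
    (e : Site N d) (g w : Site N d → ℝ) :
    ∑ x, g x * w (x + e)
      = ∑ z, (∑ x, q (z - x - e) * g x) * (∑ x, q (x - z) * w x)
        + ∑ j, ∑ z, (∑ x, Φ j (z - x - e) * g x) * (w z - w (z + Pi.single j 1)) := by
  have h1 : ∀ x, w (x + e) = ∑ y, q y * ∑ y', q y' * w (x + e + y + y')
      + ∑ j, ∑ z, Φ j z * (w (x + e + z) - w (x + e + z + Pi.single j 1)) := by
    intro x
    have := hflow (fun z => w (x + e + z))
    simp only [add_zero, ← add_assoc] at this
    linarith
  have h2 : ∀ (Ψ F : Site N d → ℝ) x, ∑ y, Ψ y * F (x + e + y) = ∑ z, Ψ (z - x - e) * F z := by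
    intro Ψ F x
    refine Fintype.sum_equiv (Equiv.addLeft (x + e)) _ _ fun y => ?_
    simp only [Equiv.coe_addLeft]
    congr 2
    abel
  have h3 : ∀ z, ∑ y', q y' * w (z + y') = ∑ x, q (x - z) * w x := by
    intro z
    refine Fintype.sum_equiv (Equiv.addLeft z) _ _ fun y => ?_
    simp
  have h4 : ∀ x, w (x + e) = ∑ z, q (z - x - e) * (∑ x', q (x' - z) * w x')
      + ∑ j, ∑ z, Φ j (z - x - e) * (w z - w (z + Pi.single j 1)) := by
    intro x
    rw [h1 x]
    simp_rw [h3]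
    rw [h2 q (fun z => ∑ x', q (x' - z) * w x')]
    congr 1
    refine Finset.sum_congr rfl fun j _ => ?_
    exact h2 (Φ j) (fun z => w z - w (z + Pi.single j 1)) x
  simp_rw [h4, mul_add, Finset.sum_add_distrib]
  congr 1
  · simp_rw [Finset.mul_sum]
    rw [Finset.sum_comm]
    refine Finset.sum_congr rfl fun z _ => ?_
    rw [← Finset.sum_comm]
    refine Finset.sum_congr rfl fun x' _ => ?_
    rw [Finset.sum_mul]
    exact Finset.sum_congr rfl fun x _ => by ring
  · simp_rw [Finset.mul_sum]
    rw [Finset.sum_comm]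
    refine Finset.sum_congr rfl fun j _ => ?_
    rw [Finset.sum_comm]
    refine Finset.sum_congr rfl fun z _ => ?_
    rw [Finset.sum_mul]
    exact Finset.sum_congr rfl fun x _ => by ring

/-- The current through a bond does not depend on the occupation of its endpoints. -/
theorem sum_flow_cfgJump {N d K : ℕ} [NeZero N] {M : ℕ} (hM : M + 2 ≤ N) {Φ : Site N d → ℝ}
    (hΦ : ∀ z, Φ z ≠ 0 → ∀ i, (z i).val < M) (a c : Site N d → ℝ) (i j : Fin d)
    (w u u' : Site N d) (hu : u = w ∨ u = w + Pi.single j 1)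
    (hu' : u' = w ∨ u' = w + Pi.single j 1) (η : GCfg N d K) :
    ∑ x, Φ (w - x - Pi.single i 1) * (c x * omVar a (cfgJump η u u') x)
      = ∑ x, Φ (w - x - Pi.single i 1) * (c x * omVar a η x) := by
  refine Finset.sum_congr rfl fun x _ => ?_
  by_cases h : Φ (w - x - Pi.single i 1) = 0
  · simp [h]
  have h1 := hΦ _ h i
  set z := w - x - Pi.single i 1 with hz
  have key : ∀ v : Site N d, v = w ∨ v = w + Pi.single j 1 → x ≠ v := by
    rintro v hv rfl
    have h2 : ∃ r : ℕ, 0 < r ∧ r ≤ 2 ∧ (z + r • (Pi.single i 1 : Site N d)) i = 0 := by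
      rcases hv with hv | hv
      · refine ⟨1, by norm_num, by norm_num, ?_⟩
        rw [hz, hv]
        simp
      · by_cases hij : i = j
        · refine ⟨2, by norm_num, le_rfl, ?_⟩
          subst hij
          rw [hz, hv]
          simp only [Pi.add_apply, Pi.sub_apply, two_smul]
          abel
        · refine ⟨1, by norm_num, by norm_num, ?_⟩
          rw [hz, hv]
          simp [hij]
    obtain ⟨r, hr, hr2, hr3⟩ := h2
    have h4 := val_add_nsmul_single z r i (by omega)
    rw [hr3] at h4
    simp at h4
    omega
  congr 2
  unfold omVar
  rw [cfgJump_apply_of_ne η (key u hu) (key u' hu')]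

theorem sum_conv_mul_sq_le {G : Type*} [AddCommGroup G] [Fintype G] {ψ : G → ℝ}
    (hψ : ∀ y, 0 ≤ ψ y) {c : G → ℝ} {g : ℝ} (hc : ∀ x, |c x| ≤ g) (e : G) (v : G → ℝ) :
    ∑ z, (∑ x, ψ (z - x - e) * c x * v x) ^ 2 ≤ (∑ y, ψ y) ^ 2 * g ^ 2 * ∑ x, v x ^ 2 := by
  have h1 := sum_conv_sq_le hψ (fun x => c x * v x)
  have h2 : ∑ z, (∑ x, ψ (z - x - e) * c x * v x) ^ 2
      = ∑ z, (∑ x, ψ (z - x) * (c x * v x)) ^ 2 := by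
    refine Fintype.sum_equiv (Equiv.subRight e) _ _ fun z => ?_
    congr 1
    refine Finset.sum_congr rfl fun x _ => ?_
    simp only [Equiv.subRight_apply]
    rw [sub_right_comm]
    ring
  rw [h2, mul_assoc]
  refine h1.trans (mul_le_mul_of_nonneg_left ?_ (sq_nonneg _))
  rw [Finset.mul_sum]
  refine Finset.sum_le_sum fun x _ => ?_
  rw [mul_pow]
  exact mul_le_mul_of_nonneg_right (sq_le_sq' (by linarith [abs_le.1 (hc x)]) (abs_le.1 (hc x)).2)
    (sq_nonneg _)

theorem sum_sum_conv_mul_sq_le {G : Type*} [AddCommGroup G] [Fintype G] (ψ : G → ℝ)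
    {c : G → ℝ} {g : ℝ} (hc : ∀ x, |c x| ≤ g) (e : G) :
    ∑ z, ∑ x, (ψ (z - x - e) * c x) ^ 2 ≤ Fintype.card G * (g ^ 2 * ∑ y, ψ y ^ 2) := by
  rw [Finset.sum_comm]
  have h1 : ∀ x, ∑ z, (ψ (z - x - e) * c x) ^ 2 ≤ g ^ 2 * ∑ y, ψ y ^ 2 := by
    intro x
    have h2 : ∑ z, ψ (z - x - e) ^ 2 = ∑ y, ψ y ^ 2 :=
      Fintype.sum_equiv ((Equiv.subRight x).trans (Equiv.subRight e)) _ _ fun z => by simp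
    simp_rw [mul_pow]
    rw [← Finset.sum_mul, h2, mul_comm]
    exact mul_le_mul_of_nonneg_right
      (sq_le_sq' (by linarith [abs_le.1 (hc x)]) (abs_le.1 (hc x)).2)
      (Finset.sum_nonneg fun y _ => sq_nonneg _)
  refine (Finset.sum_le_sum fun x _ => h1 x).trans (le_of_eq ?_)
  rw [Finset.sum_const, nsmul_eq_mul, Finset.card_univ]

/-- The block average term of the flow decomposition. -/
theorem sum_average_le_relEnt {Ω G : Type*} [Fintype Ω] [Nonempty Ω] [AddCommGroup G] [Fintype G]
    {μ ν : Ω → ℝ} (hν : ∀ η, 0 < ν η) (hμ : ∀ η, 0 ≤ μ η) (hμ1 : ∑ η, μ η = 1)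
    {ω : Ω → G → ℝ} {S : ℝ} (hS0 : 0 < S) (hS : IsSubGauss ν ω S)
    {q : G → ℝ} (hq : ∀ y, 0 ≤ q y) (hq1 : ∑ y, q y = 1) {r : ℝ} (hqr : ∑ y, q y ^ 2 ≤ r)
    {c : G → ℝ} {g : ℝ} (hg : 0 < g) (hc : ∀ x, |c x| ≤ g) (e : G) :
    ∑ η, μ η * ∑ z, (∑ x, q (z - x - e) * (c x * ω η x)) * (∑ x, q (x - z) * ω η x)
      ≤ 4 * S * g * (relEnt μ ν + Fintype.card G * r) := by
  have h1 := sum_quadratic_le_relEnt hν hμ hμ1 hS0 hS (fun z x => q (z - x - e) * c x)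
    (B := g ^ 2) (by positivity) (fun v => by simpa [hq1] using sum_conv_mul_sq_le hq hc e v)
  have h2 := sum_quadratic_le_relEnt hν hμ hμ1 hS0 hS (fun z x => q (x - z) * 1)
    (B := 1) (by positivity) (fun v => by
      have hq1' : ∑ y, q (-y) = 1 := by
        rw [← hq1]
        exact Fintype.sum_equiv (Equiv.neg G) _ _ fun _ => rfl
      have := sum_conv_mul_sq_le (ψ := fun y => q (-y)) (c := fun _ => 1) (g := 1)
        (fun y => hq _) (fun x => by simp) 0 v
      simpa [hq1'] using this)
  have h3 := sum_sum_conv_mul_sq_le q hc e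
  have h4 : ∑ z, ∑ x, (q (x - z) * 1) ^ 2 ≤ Fintype.card G * r := by
    have h5 := sum_sum_conv_mul_sq_le (fun y => q (-y)) (c := fun _ => 1) (g := 1)
      (fun x => by simp) 0
    have h6 : ∑ y, q (-y) ^ 2 = ∑ y, q y ^ 2 :=
      Fintype.sum_equiv (Equiv.neg G) _ _ fun _ => rfl
    rw [h6] at h5
    simp only [sub_zero, neg_sub, one_pow, one_mul] at h5
    exact h5.trans (by gcongr)
  have h3' : ∑ z, ∑ x, (q (z - x - e) * c x) ^ 2 ≤ g ^ 2 * (Fintype.card G * r) := by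
    refine h3.trans ?_
    have : (Fintype.card G : ℝ) * (g ^ 2 * ∑ y, q y ^ 2) ≤ Fintype.card G * (g ^ 2 * r) := by
      gcongr
    linarith
  have h7 : ∀ η, ∑ z, (∑ x, q (z - x - e) * (c x * ω η x)) * (∑ x, q (x - z) * ω η x)
      ≤ 1 / (2 * g) * ∑ z, (∑ x, q (z - x - e) * c x * ω η x) ^ 2
        + g / 2 * ∑ z, (∑ x, q (x - z) * 1 * ω η x) ^ 2 := by
    intro η
    rw [Finset.mul_sum, Finset.mul_sum, ← Finset.sum_add_distrib]
    refine Finset.sum_le_sum fun z _ => ?_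
    simp only [mul_assoc, one_mul]
    set A := ∑ x, q (z - x - e) * (c x * ω η x)
    set B := ∑ x, q (x - z) * ω η x
    have h8 : 1 / (2 * g) * A ^ 2 + g / 2 * B ^ 2 - A * B = (A - g * B) ^ 2 / (2 * g) := by
      field_simp
      ring
    have h9 : 0 ≤ (A - g * B) ^ 2 / (2 * g) := by positivity
    linarith
  calc ∑ η, μ η * ∑ z, (∑ x, q (z - x - e) * (c x * ω η x)) * (∑ x, q (x - z) * ω η x)
      ≤ ∑ η, μ η * (1 / (2 * g) * ∑ z, (∑ x, q (z - x - e) * c x * ω η x) ^ 2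
        + g / 2 * ∑ z, (∑ x, q (x - z) * 1 * ω η x) ^ 2) :=
        Finset.sum_le_sum fun η _ => mul_le_mul_of_nonneg_left (h7 η) (hμ η)
    _ = 1 / (2 * g) * ∑ η, μ η * ∑ z, (∑ x, q (z - x - e) * c x * ω η x) ^ 2
        + g / 2 * ∑ η, μ η * ∑ z, (∑ x, q (x - z) * 1 * ω η x) ^ 2 := by
        rw [Finset.mul_sum, Finset.mul_sum, ← Finset.sum_add_distrib]
        exact Finset.sum_congr rfl fun η _ => by ring
    _ ≤ 1 / (2 * g) * (4 * S * (g ^ 2 * relEnt μ ν + g ^ 2 * (Fintype.card G * r)))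
        + g / 2 * (4 * S * (1 * relEnt μ ν + Fintype.card G * r)) := by
        have h8 := h1.trans (mul_le_mul_of_nonneg_left (add_le_add_right h3' _)
          (by positivity : 0 ≤ 4 * S))
        have h9 := h2.trans (mul_le_mul_of_nonneg_left (add_le_add_right h4 _)
          (by positivity : 0 ≤ 4 * S))
        gcongr
    _ = 4 * S * g * (relEnt μ ν + Fintype.card G * r) := by
        field_simp
        ring

/-- The current term of the flow decomposition. -/
theorem sum_current_le_relEnt {N d K : ℕ} [NeZero N] (hK : 1 ≤ K) {M : ℕ} (hM : M + 2 ≤ N)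
    {a : Site N d → ℝ} {c₀ η₀ : ℝ} (hc : 0 < c₀) (h0 : ∀ x, c₀ ≤ a x) (h1 : ∀ x, a x ≤ K - c₀)
    (i j : Fin d) (ha : ∀ x, |a (x + Pi.single j 1) - a x| ≤ η₀)
    {f : GCfg N d K → ℝ} (hf : ∀ η, 0 ≤ f η) (hf1 : ∑ η, prodBinom a η * f η = 1)
    {Φ : Site N d → ℝ} (hΦ0 : ∀ z, 0 ≤ Φ z) (hΦ : ∀ z, Φ z ≠ 0 → ∀ i, (z i).val < M)
    {l s : ℝ} (hl : 0 < l) (hΦl : ∑ z, Φ z ≤ l) (hΦs : ∑ z, Φ z ^ 2 ≤ s)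
    {c : Site N d → ℝ} {g : ℝ} (hg : 0 < g) (hcg : ∀ x, |c x| ≤ g) {β : ℝ} (hβ : 0 < β)
    (b : Bool) :
    ∑ η, prodBinom a η * f η * ∑ z, (∑ x, Φ (z - x - Pi.single i 1) * (c x * omVar a η x))
          * (omVar a η z - omVar a η (z + Pi.single j 1))
      ≤ β * bondDir a f j b
        + ((K ^ 2 + K ^ 4 / c₀ ^ 2) / (2 * (K * c₀ ^ 2) ^ 2) / β + 1)
          * (4 * (K / c₀ ^ 2) ^ 2 * (l ^ 2 * g ^ 2
              * relEnt (fun η => prodBinom a η * f η) (prodBinom a)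
            + Fintype.card (Site N d) * (g ^ 2 * s)))
        + Fintype.card (Site N d) * (η₀ * (K / c₀ ^ 2) ^ 2) ^ 2 := by
  have hpos : ∀ z, 0 < a z := fun z => hc.trans_le (h0 z)
  have hlt : ∀ z, a z < K := fun z => by linarith [h1 z]
  have hν : ∀ η : GCfg N d K, 0 < prodBinom a η := prodBinom_pos hpos hlt
  have hK0 : (0 : ℝ) < K := by positivity
  have hη₀ : 0 ≤ η₀ := (abs_nonneg _).trans (ha 0)
  have hμ : ∀ η, 0 ≤ prodBinom a η * f η := fun η => mul_nonneg (hν η).le (hf η)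
  have h2 := sum_bond_le (by omega) hc h0 h1 j ha hf
    (h := fun z η => ∑ x, Φ (z - x - Pi.single i 1) * (c x * omVar a η x))
    (fun w η => sum_flow_cfgJump hM hΦ a c i j w _ _ (Or.inl rfl) (Or.inr rfl) η)
    (fun w η => sum_flow_cfgJump hM hΦ a c i j w _ _ (Or.inr rfl) (Or.inl rfl) η) hβ b
  refine h2.trans ?_
  have h3 := sum_quadratic_le_relEnt hν hμ hf1 (by positivity) (isSubGauss_omVar hK hc h0 h1)
    (fun z x => Φ (z - x - Pi.single i 1) * c x) (B := l ^ 2 * g ^ 2) (by positivity) (fun v => by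
      refine (sum_conv_mul_sq_le hΦ0 hcg (Pi.single i 1) v).trans ?_
      have : (∑ z, Φ z) ^ 2 ≤ l ^ 2 :=
        pow_le_pow_left₀ (Finset.sum_nonneg fun z _ => hΦ0 z) hΦl 2
      gcongr)
  have h4 := sum_sum_conv_mul_sq_le Φ hcg (Pi.single i 1)
  simp only [mul_assoc (Φ _)] at h3
  set h : GCfg N d K → Site N d → ℝ :=
    fun η z => ∑ x, Φ (z - x - Pi.single i 1) * (c x * omVar a η x) with hh
  set X := ∑ η, prodBinom a η * f η * ∑ z, h η z ^ 2 with hX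
  set Y := ∑ η, prodBinom a η * f η * ∑ z, |h η z| with hY
  have h5 : X ≤ 4 * (K / c₀ ^ 2) ^ 2 * (l ^ 2 * g ^ 2
              * relEnt (fun η => prodBinom a η * f η) (prodBinom a)
            + Fintype.card (Site N d) * (g ^ 2 * s)) := by
    refine h3.trans ?_
    have : (Fintype.card (Site N d) : ℝ) * (g ^ 2 * ∑ y, Φ y ^ 2)
        ≤ Fintype.card (Site N d) * (g ^ 2 * s) := by gcongr
    gcongr
    exact h4.trans this
  have h6 : η₀ * (K / c₀ ^ 2) ^ 2 * Y
      ≤ X + Fintype.card (Site N d) * (η₀ * (K / c₀ ^ 2) ^ 2) ^ 2 := by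
    set τ := η₀ * (K / c₀ ^ 2) ^ 2 with hτ
    have h7 : X + Fintype.card (Site N d) * τ ^ 2
        = ∑ η, prodBinom a η * f η * (∑ z, (h η z ^ 2 + τ ^ 2)) := by
      simp only [Finset.sum_add_distrib, Finset.sum_const, Finset.card_univ, nsmul_eq_mul, mul_add]
      rw [← Finset.sum_mul, hf1, one_mul]
    rw [h7, hY, Finset.mul_sum]
    refine Finset.sum_le_sum fun η _ => ?_
    rw [mul_left_comm]
    refine mul_le_mul_of_nonneg_left ?_ (hμ η)
    rw [Finset.mul_sum]
    refine Finset.sum_le_sum fun z _ => ?_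
    rw [← sq_abs (h η z)]
    nlinarith [sq_nonneg (|h η z| - τ), sq_nonneg (|h η z| + τ)]
  set C₁ := ((K : ℝ) ^ 2 + K ^ 4 / c₀ ^ 2) / (2 * (K * c₀ ^ 2) ^ 2) / β with hC₁
  have hC₁0 : 0 ≤ C₁ := by positivity
  have h8 := mul_le_mul_of_nonneg_left h5 (by linarith : 0 ≤ C₁ + 1)
  linarith

theorem abs_quadCoef_le {N d K : ℕ} [NeZero N] {p : Fin d → Bool → ℝ} (hp : ∀ i b, 0 ≤ p i b)
    {P : ℝ} (hP : ∀ i b, p i b ≤ P) {a : Site N d → ℝ} (h0 : ∀ x, 0 < a x) (h1 : ∀ x, a x < K)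
    {η₀ : ℝ} {i : Fin d} (ha : ∀ x, |a (x + Pi.single i 1) - a x| ≤ η₀) (x : Site N d) :
    |quadCoef K p a i x| ≤ 2 * P * K ^ 2 * η₀ := by
  have hK : (0 : ℝ) ≤ K := by positivity
  have key : ∀ b : Bool, ∀ y z : Site N d, ∀ D : ℝ, |D| ≤ η₀ →
      |p i b * (a y * (K - a z) * D)| ≤ P * (K * K * η₀) := by
    intro b y z D hD
    have h2 : 0 ≤ K - a z := by linarith [h1 z]
    have h3 : K - a z ≤ K := by linarith [h0 z]
    rw [abs_mul, abs_mul, abs_mul, abs_of_nonneg (hp i b), abs_of_nonneg (h0 y).le,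
      abs_of_nonneg h2]
    have h4 := (hp i b).trans (hP i b)
    have h5 := (h1 y).le
    have h6 := (h0 y).le
    gcongr
    exact hP i b
  unfold quadCoef
  refine (abs_add_le _ _).trans ?_
  have h2 := key true x (x + Pi.single i 1) _ (ha x)
  have h3 := key false (x + Pi.single i 1) x (a x - a (x + Pi.single i 1))
    (by rw [abs_sub_comm]; exact ha x)
  linarith

theorem entropy_production_algebra {H V S k e C₂ G Γ η F n γ W R : ℝ} (hH : 0 ≤ H) (hV : 0 ≤ V)
    (hS : 0 ≤ S) (hC₂ : 0 ≤ C₂) (hG : 0 ≤ G) (hΓ : 0 ≤ Γ) (hη : 0 ≤ η) (hF : 0 ≤ F) (hW : 0 ≤ W)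
    (hk : 0 ≤ k) (he : 0 ≤ e) (hγ : 0 ≤ γ) :
    H + S / 2 * (V * (k ^ 2 * R ^ 2)) + (Γ * k * (e * (4 * S * (G * η) * (H + V * (1 / W))
        + (e * (C₂ * (4 * S * (4 * F * (G * η) ^ 2 * H
            + V * ((G * η) ^ 2 * (4 * n ^ 2 * γ)))) + V * (η * S) ^ 2)))))
      ≤ (1 + S / 2 * k ^ 2 + k * e * (4 * S * G) + k * e * e * (16 * C₂ * S * G ^ 2)
          + k * e * e * S ^ 2)
        * ((1 + Γ * η + Γ * η ^ 2 * F) * H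
          + V * (R ^ 2 + Γ * η ^ 2 * (n ^ 2 * γ + 1) + Γ * η / W)) := by
  obtain ⟨A₁, hA₁⟩ : ∃ A, A = S / 2 * k ^ 2 := ⟨_, rfl⟩
  obtain ⟨A₂, hA₂⟩ : ∃ A, A = k * e * (4 * S * G) := ⟨_, rfl⟩
  obtain ⟨A₃, hA₃⟩ : ∃ A, A = k * e * e * (16 * C₂ * S * G ^ 2) := ⟨_, rfl⟩
  obtain ⟨A₄, hA₄⟩ : ∃ A, A = k * e * e * S ^ 2 := ⟨_, rfl⟩
  have p1 : 0 ≤ A₁ := by rw [hA₁]; positivity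
  have p2 : 0 ≤ A₂ := by rw [hA₂]; positivity
  have p3 : 0 ≤ A₃ := by rw [hA₃]; positivity
  have p4 : 0 ≤ A₄ := by rw [hA₄]; positivity
  obtain ⟨B₁, hB₁⟩ : ∃ B, B = Γ * η * H := ⟨_, rfl⟩
  obtain ⟨B₂, hB₂⟩ : ∃ B, B = Γ * η ^ 2 * F * H := ⟨_, rfl⟩
  obtain ⟨B₃, hB₃⟩ : ∃ B, B = V * R ^ 2 := ⟨_, rfl⟩
  obtain ⟨B₄, hB₄⟩ : ∃ B, B = V * (Γ * η ^ 2 * (n ^ 2 * γ)) := ⟨_, rfl⟩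
  obtain ⟨B₅, hB₅⟩ : ∃ B, B = V * (Γ * η ^ 2) := ⟨_, rfl⟩
  obtain ⟨B₆, hB₆⟩ : ∃ B, B = V * (Γ * η / W) := ⟨_, rfl⟩
  have q1 : 0 ≤ B₁ := by rw [hB₁]; positivity
  have q2 : 0 ≤ B₂ := by rw [hB₂]; positivity
  have q3 : 0 ≤ B₃ := by rw [hB₃]; positivity
  have q4 : 0 ≤ B₄ := by rw [hB₄]; positivity
  have q5 : 0 ≤ B₅ := by rw [hB₅]; positivity
  have q6 : 0 ≤ B₆ := by rw [hB₆]; positivity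
  calc _ = H + A₁ * B₃ + A₂ * (B₁ + B₆) + A₃ * (B₂ + B₄) + A₄ * B₅ := by
        rw [hA₁, hA₂, hA₃, hA₄, hB₁, hB₂, hB₃, hB₄, hB₅, hB₆]
        ring
    _ ≤ (1 + A₁ + A₂ + A₃ + A₄) * (H + (B₁ + B₂ + B₃ + B₄ + B₅ + B₆)) := by
        have m := mul_nonneg (add_nonneg (add_nonneg (add_nonneg p1 p2) p3) p4) hH
        have n1 : A₁ * B₃ ≤ A₁ * (B₁ + B₂ + B₃ + B₄ + B₅ + B₆) :=
          mul_le_mul_of_nonneg_left (by linarith) p1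
        have n2 : A₂ * (B₁ + B₆) ≤ A₂ * (B₁ + B₂ + B₃ + B₄ + B₅ + B₆) :=
          mul_le_mul_of_nonneg_left (by linarith) p2
        have n3 : A₃ * (B₂ + B₄) ≤ A₃ * (B₁ + B₂ + B₃ + B₄ + B₅ + B₆) :=
          mul_le_mul_of_nonneg_left (by linarith) p3
        have n4 : A₄ * B₅ ≤ A₄ * (B₁ + B₂ + B₃ + B₄ + B₅ + B₆) :=
          mul_le_mul_of_nonneg_left (by linarith) p4
        linear_combination m + n1 + n2 + n3 + n4 + (q1 + q2 + q3 + q4 + q5 + q6)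
    _ = _ := by
        rw [hA₁, hA₂, hA₃, hA₄, hB₁, hB₂, hB₃, hB₄, hB₅, hB₆]
        ring

/-- The entropy production, up to the relative entropy itself. -/
theorem exists_entropy_production_le {d K : ℕ} (hK : 1 ≤ K) {p : Fin d → Bool → ℝ}
    (hp : ∀ i b, 0 ≤ p i b) (hpd : ∀ i, 0 < p i true + p i false) {c₀ : ℝ} (hc : 0 < c₀) :
    ∃ C > 0, ∀ (N : ℕ) [NeZero N] (n : ℕ) (γ η₀ R₀ Γ : ℝ) (a ad : Site N d → ℝ)
      (f : GCfg N d K → ℝ), 2 * 2 ^ n + 2 ≤ N →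
      (∀ k < n, (2 : ℝ) ^ (2 * k) / (2 ^ d) ^ k ≤ γ) → 0 ≤ γ → 0 < η₀ → 0 < Γ →
      (∀ x, c₀ ≤ a x) → (∀ x, a x ≤ K - c₀) →
      (∀ x i, |a (x + Pi.single i 1) - a x| ≤ η₀) →
      (∀ x, |Γ * linCoef K p a x - ad x| ≤ R₀) →
      (∀ η, 0 < f η) → ∑ η, prodBinom a η * f η = 1 →
      Γ * ∑ η, genL p (fun η => Real.log (f η)) η * (prodBinom a η * f η)
          - ∑ η, prodBinom a η * f η * (K * ∑ x, ad x * omVar a η x)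
        ≤ C * ((1 + Γ * η₀ + Γ * η₀ ^ 2 * 4 ^ n)
              * relEnt (fun η => prodBinom a η * f η) (prodBinom a)
            + N ^ d * (R₀ ^ 2 + Γ * η₀ ^ 2 * (n ^ 2 * γ + 1) + Γ * η₀ / (2 ^ d) ^ n)) := by
  have hb : ∀ j, ∃ b, 0 < p j b := by
    intro j
    by_contra! h
    linarith [h true, h false, hpd j]
  choose b hb using hb
  set Q : ℝ := 1 + ∑ j, 1 / p j (b j) with hQ
  have hQ0 : 0 < Q := by
    have := Finset.sum_nonneg fun j (_ : j ∈ Finset.univ) => (one_div_pos.2 (hb j)).le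
    linarith
  have hQj : ∀ j, 1 / p j (b j) ≤ Q := by
    intro j
    have := Finset.single_le_sum (f := fun j => 1 / p j (b j))
      (fun j _ => (one_div_pos.2 (hb j)).le) (Finset.mem_univ j)
    linarith
  set P : ℝ := 1 + ∑ j, ∑ b : Bool, p j b with hPd
  have hP1 : ∀ j b, p j b ≤ P := by
    intro j b
    have h1 := Finset.single_le_sum (f := fun j => ∑ b : Bool, p j b)
      (fun j _ => Finset.sum_nonneg fun b _ => hp j b) (Finset.mem_univ j)
    have h2 := Finset.single_le_sum (f := fun b => p j b) (fun b _ => hp j b) (Finset.mem_univ b)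
    linarith
  have hP0 : 0 < P := by
    have := Finset.sum_nonneg fun j (_ : j ∈ Finset.univ) =>
      Finset.sum_nonneg fun b (_ : b ∈ Finset.univ) => hp j b
    linarith
  have hK0 : (0 : ℝ) < K := by positivity
  set S : ℝ := (K / c₀ ^ 2) ^ 2 with hS
  have hS0 : 0 < S := by positivity
  set C₁ : ℝ := ((K : ℝ) ^ 2 + K ^ 4 / c₀ ^ 2) / (2 * (K * c₀ ^ 2) ^ 2) with hC₁
  have hC₁0 : 0 < C₁ := by positivity
  set θ : ℝ := 1 / (K * (d + 1)) with hθ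
  have hθ0 : 0 < θ := by positivity
  set C₂ : ℝ := C₁ * Q / θ + 1 with hC₂
  have hC₂0 : 0 < C₂ := by positivity
  set G : ℝ := 2 * P * K ^ 2 with hG
  have hG0 : 0 < G := by positivity
  refine ⟨1 + S / 2 * K ^ 2 + K * d * (4 * S * G) + K * d * d * (16 * C₂ * S * G ^ 2)
    + K * d * d * S ^ 2, by positivity, ?_⟩
  intro N _ n γ η₀ R₀ Γ a ad f hn hγ hγ0 hη₀ hΓ h0 h1 ha hR hf hf1
  have hpos : ∀ z, 0 < a z := fun z => hc.trans_le (h0 z)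
  have hlt : ∀ z, a z < K := fun z => by linarith [h1 z]
  have hν : ∀ η : GCfg N d K, 0 < prodBinom a η := prodBinom_pos hpos hlt
  have hμ : ∀ η, 0 ≤ prodBinom a η * f η := fun η => mul_nonneg (hν η).le (hf η).le
  have hsub := isSubGauss_omVar (d := d) (N := N) hK hc h0 h1
  have hV : (Fintype.card (Site N d) : ℝ) = N ^ d := by simp
  obtain ⟨q, Φ, hq0, hq1, hq2, hΦ0, hΦ1, hΦ2, hΦs, hflow⟩ :=
    exists_double_box_flow (N := N) (d := d) (n := n) (by omega) hγ
  set H := relEnt (fun η => prodBinom a η * f η) (prodBinom a) with hH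
  have hH0 : 0 ≤ H := relEnt_nonneg hν (sum_prodBinom a) hμ hf1
  set D := dirichletForm p f (prodBinom a) with hD
  set V : ℝ := (N : ℝ) ^ d with hVd
  have hV0 : 0 ≤ V := by positivity
  have hquad : ∀ i, ∑ η, prodBinom a η * f η
        * ∑ x, quadCoef K p a i x * (omVar a η x * omVar a η (x + Pi.single i 1))
      ≤ 4 * S * (G * η₀) * (H + V * (1 / (2 ^ d) ^ n))
        + (θ * D + d * (C₂ * (4 * S * ((2 * 2 ^ n) ^ 2 * (G * η₀) ^ 2 * H
            + V * ((G * η₀) ^ 2 * (4 * n ^ 2 * γ)))) + V * (η₀ * S) ^ 2)) := by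
    intro i
    have hcq := abs_quadCoef_le hp hP1 hpos hlt (fun x => ha x i)
    have hA := sum_average_le_relEnt hν hμ hf1 hS0 hsub hq0 hq1 hq2
      (by positivity : 0 < G * η₀) hcq (Pi.single i 1)
    rw [hV] at hA
    have hB : ∀ j, ∑ η, prodBinom a η * f η * ∑ z, (∑ x, Φ j (z - x - Pi.single i 1)
          * (quadCoef K p a i x * omVar a η x)) * (omVar a η z - omVar a η (z + Pi.single j 1))
        ≤ θ * (p j (b j) * bondDir a f j (b j))
          + (C₂ * (4 * S * ((2 * 2 ^ n) ^ 2 * (G * η₀) ^ 2 * H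
            + V * ((G * η₀) ^ 2 * (4 * n ^ 2 * γ)))) + V * (η₀ * S) ^ 2) := by
      intro j
      have h2 := sum_current_le_relEnt hK hn hc h0 h1 i j (fun x => ha x j) (fun η => (hf η).le)
        hf1 (hΦ0 j) (hΦs j) (by positivity) (hΦ1 j) (hΦ2 j) (by positivity : 0 < G * η₀) hcq
        (β := θ * p j (b j)) (mul_pos hθ0 (hb j)) (b j)
      rw [hV] at h2
      refine h2.trans ?_
      have h3 : C₁ / (θ * p j (b j)) + 1 ≤ C₂ := by
        have h4 : C₁ / (θ * p j (b j)) = C₁ / θ * (1 / p j (b j)) := by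
          have := (hb j).ne'
          field_simp
        have h5 := mul_le_mul_of_nonneg_left (hQj j) (by positivity : 0 ≤ C₁ / θ)
        have h6 : C₁ * Q / θ = C₁ / θ * Q := by ring
        rw [hC₂, h4, h6]
        linarith
      have h7 : 0 ≤ 4 * S * ((2 * 2 ^ n) ^ 2 * (G * η₀) ^ 2 * H
            + V * ((G * η₀) ^ 2 * (4 * n ^ 2 * γ))) := by positivity
      have h8 := mul_le_mul_of_nonneg_right h3 h7
      rw [mul_assoc θ, add_assoc]
      exact add_le_add_right (add_le_add_left h8 _) _
    have hdec : ∑ η, prodBinom a η * f η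
        * ∑ x, quadCoef K p a i x * (omVar a η x * omVar a η (x + Pi.single i 1))
        = ∑ η, prodBinom a η * f η * ∑ z, (∑ x, q (z - x - Pi.single i 1)
            * (quadCoef K p a i x * omVar a η x)) * (∑ x, q (x - z) * omVar a η x)
          + ∑ j, ∑ η, prodBinom a η * f η * ∑ z, (∑ x, Φ j (z - x - Pi.single i 1)
            * (quadCoef K p a i x * omVar a η x))
              * (omVar a η z - omVar a η (z + Pi.single j 1)) := by
      rw [Finset.sum_comm, ← Finset.sum_add_distrib]
      refine Finset.sum_congr rfl fun η _ => ?_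
      rw [← Finset.mul_sum, ← mul_add, ← sum_mul_shift_eq_of_flow hflow (Pi.single i 1)]
      simp only [mul_assoc]
    rw [hdec]
    refine add_le_add hA ((Finset.sum_le_sum fun j _ => hB j).trans ?_)
    rw [Finset.sum_add_distrib, ← Finset.mul_sum, Finset.sum_const, Finset.card_univ,
      Fintype.card_fin, nsmul_eq_mul]
    refine add_le_add_left (mul_le_mul_of_nonneg_left ?_ hθ0.le) _
    rw [hD, dirichletForm_eq_sum_bondDir]
    exact Finset.sum_le_sum fun j _ => Finset.single_le_sum (f := fun b => p j b * bondDir a f j b)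
      (fun b _ => mul_nonneg (hp j b) (bondDir_nonneg hpos hlt f j b)) (Finset.mem_univ (b j))
  have hlin : ∑ η, prodBinom a η * f η * ∑ x, (K * (Γ * linCoef K p a x - ad x)) * omVar a η x
      ≤ H + S / 2 * (V * (K ^ 2 * R₀ ^ 2)) := by
    refine (sum_linear_le_relEnt hν hμ hf1 hsub _).trans ?_
    have h2 : ∑ x : Site N d, (K * (Γ * linCoef K p a x - ad x)) ^ 2 ≤ V * (K ^ 2 * R₀ ^ 2) := by
      refine (Finset.sum_le_sum fun x _ => (?_ : _ ≤ (K : ℝ) ^ 2 * R₀ ^ 2)).trans (le_of_eq ?_)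
      · rw [mul_pow]
        have h3 := abs_le.1 (hR x)
        exact mul_le_mul_of_nonneg_left (sq_le_sq' h3.1 h3.2) (by positivity)
      · rw [Finset.sum_const, nsmul_eq_mul, Finset.card_univ, hV]
    gcongr
  have hgen := sum_genL_log_le hp hν hf
  have hgen2 := sum_prodBinom_genL (by omega) p hpos hlt f
  have e1 : ∑ η, genL p (fun η => Real.log (f η)) η * (prodBinom a η * f η)
      = ∑ η, genL p (fun η => Real.log (f η)) η * (f η * prodBinom a η) :=
    Finset.sum_congr rfl fun η _ => by ring
  have e2 : Γ * ∑ η, prodBinom a η * genL p f η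
        - ∑ η, prodBinom a η * f η * (K * ∑ x, ad x * omVar a η x)
      = ∑ η, prodBinom a η * f η * ∑ x, (K * (Γ * linCoef K p a x - ad x)) * omVar a η x
        + Γ * K * ∑ i, ∑ η, prodBinom a η * f η
          * ∑ x, quadCoef K p a i x * (omVar a η x * omVar a η (x + Pi.single i 1)) := by
    rw [hgen2, Finset.sum_comm (γ := Fin d), Finset.mul_sum, Finset.mul_sum,
      ← Finset.sum_sub_distrib, ← Finset.sum_add_distrib]
    refine Finset.sum_congr rfl fun η _ => ?_
    rw [← Finset.mul_sum]
    have e3 : ∑ x, (K * (Γ * linCoef K p a x - ad x)) * omVar a η x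
        = K * (Γ * ∑ x, linCoef K p a x * omVar a η x) - K * ∑ x, ad x * omVar a η x := by
      simp only [Finset.mul_sum, ← Finset.sum_sub_distrib]
      exact Finset.sum_congr rfl fun x _ => by ring
    rw [e3]
    ring
  have hquads := Finset.sum_le_sum fun i (_ : i ∈ Finset.univ) => hquad i
  rw [Finset.sum_const, Finset.card_univ, Fintype.card_fin, nsmul_eq_mul] at hquads
  have hD0 : 0 ≤ D := by
    rw [hD, dirichletForm_eq_sum_bondDir]
    exact Finset.sum_nonneg fun j _ => Finset.sum_nonneg fun b _ =>
      mul_nonneg (hp j b) (bondDir_nonneg hpos hlt f j b)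
  have hquads2 := mul_le_mul_of_nonneg_left hquads (by positivity : 0 ≤ Γ * K)
  have hθD : Γ * K * (d * (θ * D)) ≤ Γ * D := by
    have h2 : Γ * K * (d * (θ * D)) = Γ * D * (d / (d + 1)) := by
      rw [hθ]
      field_simp
    rw [h2]
    refine mul_le_of_le_one_right (by positivity) ?_
    rw [div_le_one (by positivity)]
    linarith
  have hgen' := mul_le_mul_of_nonneg_left hgen hΓ.le
  have h4n : ((2 : ℝ) * 2 ^ n) ^ 2 = 4 * 4 ^ n := by
    rw [mul_pow, ← pow_mul, mul_comm n 2, pow_mul]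
    norm_num
  rw [h4n] at hquads2
  have hfin := entropy_production_algebra (n := (n : ℝ)) (F := 4 ^ n) (W := (2 ^ d) ^ n)
    (R := R₀) (k := (K : ℝ)) (e := (d : ℝ)) hH0 hV0 hS0.le hC₂0.le hG0.le hΓ.le hη₀.le
    (by positivity) (by positivity) (by positivity) (by positivity) hγ0
  rw [e1]
  refine le_trans ?_ hfin
  have hsplit : ∀ X Y Z : ℝ, Γ * K * (d * (X + (Y + Z)))
      = Γ * K * (d * Y) + Γ * K * (d * (X + Z)) := fun X Y Z => by ring
  rw [hsplit] at hquads2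
  linarith

theorem hasDerivAt_binomW {K : ℕ} {a : ℝ → ℝ} {a' t : ℝ} (ha : HasDerivAt a a' t) (h0 : 0 < a t)
    (h1 : a t < K) {k : ℕ} (hk : k ≤ K) :
    HasDerivAt (fun s => binomW K (a s) k)
      (binomW K (a t) k * (K * (a' * ((k - a t) / (a t * (K - a t)))))) t := by
  have hK : (0 : ℝ) < K := h0.trans h1
  have h2 : (K : ℝ) - a t ≠ 0 := by linarith
  have h3 : 1 - a t / K ≠ 0 := by
    rw [one_sub_div hK.ne']
    exact div_ne_zero h2 hK.ne'
  have h4 : a t / K ≠ 0 := div_ne_zero h0.ne' hK.ne'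
  have h5 := (ha.div_const (K : ℝ)).fun_pow k
  have h6 := (((ha.div_const (K : ℝ)).const_sub 1).fun_pow (K - k))
  have h7 := (h5.const_mul (K.choose k : ℝ)).mul h6
  have hpow : ∀ (n : ℕ) (x : ℝ), x ≠ 0 → (n : ℝ) * x ^ (n - 1) = n * x ^ n / x := by
    intro n x hx
    cases n with
    | zero => simp
    | succ n =>
      rw [Nat.add_sub_cancel, pow_succ]
      field_simp
  rw [hpow k _ h4, hpow (K - k) _ h3, Nat.cast_sub hk] at h7
  refine h7.congr_deriv ?_
  have e1 : ∀ X Y c : ℝ, c * (k * X / (a t / K) * (a' / K)) * Y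
      + c * X * (((K : ℝ) - k) * Y / (1 - a t / K) * -(a' / K))
      = c * X * Y * (K * (a' * ((k - a t) / (a t * (K - a t))))) := by
    intro X Y c
    rw [one_sub_div hK.ne']
    field_simp
    ring
  exact e1 _ _ _

theorem hasDerivAt_prodBinom {N d K : ℕ} {a : ℝ → Site N d → ℝ} {ad : Site N d → ℝ} {t : ℝ}
    (ha : ∀ x, HasDerivAt (fun s => a s x) (ad x) t) (h0 : ∀ x, 0 < a t x) (h1 : ∀ x, a t x < K)
    (η : GCfg N d K) :
    HasDerivAt (fun s => prodBinom (a s) η)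
      (prodBinom (a t) η * (K * ∑ x, ad x * omVar (a t) η x)) t := by
  have h2 := HasDerivAt.fun_finsetProd (u := Finset.univ) fun x _ =>
    hasDerivAt_binomW (ha x) (h0 x) (h1 x) (Nat.lt_succ_iff.1 (η x).isLt)
  refine h2.congr_deriv ?_
  rw [Finset.mul_sum, Finset.mul_sum]
  refine Finset.sum_congr rfl fun x _ => ?_
  unfold prodBinom
  rw [← Finset.mul_prod_erase Finset.univ _ (Finset.mem_univ x), smul_eq_mul]
  unfold omVar
  ring

theorem hasDerivAt_relEnt {Ω : Type*} [Fintype Ω] {μ ν : ℝ → Ω → ℝ} {μ' ν' : Ω → ℝ} {t : ℝ}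
    (hμ : ∀ η, 0 < μ t η) (hν : ∀ η, 0 < ν t η) (hμd : ∀ η, HasDerivAt (fun s => μ s η) (μ' η) t)
    (hνd : ∀ η, HasDerivAt (fun s => ν s η) (ν' η) t) (hsum : ∑ η, μ' η = 0) :
    HasDerivAt (fun s => relEnt (μ s) (ν s))
      (∑ η, Real.log (μ t η / ν t η) * μ' η - ∑ η, μ t η / ν t η * ν' η) t := by
  have h1 : ∀ η, HasDerivAt
      (fun s => (μ s η / ν s η) * Real.log (μ s η / ν s η) * ν s η)
      (Real.log (μ t η / ν t η) * μ' η + μ' η - μ t η / ν t η * ν' η) t := by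
    intro η
    have h2 := (hμd η).fun_div (hνd η) (hν η).ne'
    have h3 := (h2.fun_mul (h2.log (div_pos (hμ η) (hν η)).ne')).fun_mul (hνd η)
    refine h3.congr_deriv ?_
    have h4 := (hμ η).ne'
    have h5 := (hν η).ne'
    generalize Real.log (μ t η / ν t η) = L
    field_simp
    ring
  refine (HasDerivAt.fun_sum fun η (_ : η ∈ Finset.univ) => h1 η).congr_deriv ?_
  rw [Finset.sum_sub_distrib, Finset.sum_add_distrib, hsum, add_zero]

theorem genL_one {N d K : ℕ} (p : Fin d → Bool → ℝ) (η : GCfg N d K) :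
    genL p (fun _ => (1 : ℝ)) η = 0 := by
  simp [genL]

theorem hasDerivAt_relEnt_of_kolmogorov {N d K : ℕ} {p : Fin d → Bool → ℝ} {Γ : ℝ}
    {μ : ℝ → GCfg N d K → ℝ} {a : ℝ → Site N d → ℝ} {ad : Site N d → ℝ} {t : ℝ}
    (hk : ∀ g : GCfg N d K → ℝ,
      HasDerivAt (fun s => ∑ η, g η * μ s η) (Γ * ∑ η, genL p g η * μ t η) t)
    (hμ : ∀ η, 0 < μ t η)
    (ha : ∀ x, HasDerivAt (fun s => a s x) (ad x) t) (h0 : ∀ x, 0 < a t x)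
    (h1 : ∀ x, a t x < K) :
    HasDerivAt (fun s => relEnt (μ s) (prodBinom (a s)))
      (Γ * ∑ η, genL p (fun η => Real.log (μ t η / prodBinom (a t) η)) η * μ t η
        - ∑ η, μ t η * (K * ∑ x, ad x * omVar (a t) η x)) t := by
  classical
  have h2 : ∀ η, ∃ m', HasDerivAt (fun s => μ s η) m' t := by
    intro η
    refine ⟨_, (hk (fun ξ => if ξ = η then 1 else 0)).congr_of_eventuallyEq ?_⟩
    exact Eventually.of_forall fun s => by simp
  choose μ' hμ' using h2
  have h3 : ∀ g : GCfg N d K → ℝ, ∑ η, g η * μ' η = Γ * ∑ η, genL p g η * μ t η := fun g =>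
    (HasDerivAt.fun_sum fun η (_ : η ∈ Finset.univ) => (hμ' η).const_mul (g η)).unique (hk g)
  have hsum : ∑ η, μ' η = 0 := by
    have := h3 (fun _ => 1)
    simpa [genL_one] using this
  have hν := prodBinom_pos h0 h1
  have h4 := hasDerivAt_relEnt hμ hν hμ' (hasDerivAt_prodBinom ha h0 h1) hsum
  rw [h3] at h4
  refine h4.congr_deriv ?_
  congr 1
  refine Finset.sum_congr rfl fun η _ => ?_
  have := (hν η).ne'
  field_simp

theorem le_of_hasDerivAt_le {h h' : ℝ → ℝ} {A E T : ℝ} (hA : 0 < A) (hE : 0 ≤ E)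
    (hd : ∀ t ∈ Set.Icc 0 T, HasDerivAt h (h' t) t)
    (hle : ∀ t ∈ Set.Icc 0 T, h' t ≤ A * h t + E) :
    ∀ t ∈ Set.Icc 0 T, h t ≤ Real.exp (A * t) * (h 0 + E / A) := by
  have h1 : ∀ t ∈ Set.Icc 0 T, HasDerivAt (fun s => Real.exp (-(A * s)) * (h s + E / A))
      (Real.exp (-(A * t)) * (h' t - (A * h t + E))) t := by
    intro t ht
    have h2 : HasDerivAt (fun s => Real.exp (-(A * s))) (Real.exp (-(A * t)) * -(A * 1)) t :=
      (((hasDerivAt_id t).const_mul A).fun_neg).exp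
    refine (h2.fun_mul ((hd t ht).add_const (E / A))).congr_deriv ?_
    field_simp
    ring
  have hanti : AntitoneOn (fun s => Real.exp (-(A * s)) * (h s + E / A)) (Set.Icc 0 T) := by
    refine antitoneOn_of_deriv_nonpos (convex_Icc 0 T)
      (fun t ht => (h1 t ht).continuousAt.continuousWithinAt)
      (fun t ht => (h1 t (interior_subset ht)).differentiableAt.differentiableWithinAt) ?_
    intro t ht
    rw [(h1 t (interior_subset ht)).deriv]
    exact mul_nonpos_of_nonneg_of_nonpos (Real.exp_pos _).le
      (by linarith [hle t (interior_subset ht)])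
  intro t ht
  have h3 := hanti (Set.left_mem_Icc.2 (ht.1.trans ht.2)) ht ht.1
  simp only [mul_zero, neg_zero, Real.exp_zero, one_mul] at h3
  have h4 : h t + E / A = Real.exp (A * t) * (Real.exp (-(A * t)) * (h t + E / A)) := by
    rw [← mul_assoc, ← Real.exp_add, add_neg_cancel, Real.exp_zero, one_mul]
  have h5 := mul_le_mul_of_nonneg_left h3 (Real.exp_pos (A * t)).le
  have h6 : 0 ≤ E / A := by positivity
  linarith

theorem sum_genL_mul_prodBinom_const {N d K : ℕ} [NeZero N] (hN : 2 ≤ N) (p : Fin d → Bool → ℝ)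
    {r : ℝ} (h0 : 0 < r) (h1 : r < K) (f : GCfg N d K → ℝ) :
    ∑ η, genL p f η * prodBinom (fun _ => r) η = 0 := by
  have := sum_prodBinom_genL hN p (a := fun _ => r) (fun _ => h0) (fun _ => h1) f
  simp only [linCoef, quadCoef, sub_self, mul_zero, add_zero, zero_mul, Finset.sum_const_zero] at this
  simpa only [mul_comm] using this

theorem tendsto_relEnt_mix {Ω : Type*} [Fintype Ω] (μ π' ν : Ω → ℝ) :
    Tendsto (fun δ : ℝ => relEnt (fun η => (1 - δ) * μ η + δ * π' η) ν) (nhds 0)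
      (nhds (relEnt μ ν)) := by
  have hcont : Continuous fun δ : ℝ => relEnt (fun η => (1 - δ) * μ η + δ * π' η) ν := by
    unfold relEnt
    refine continuous_finsetSum _ fun η _ => Continuous.mul ?_ continuous_const
    exact Real.continuous_mul_log.comp (by fun_prop :
      Continuous fun δ : ℝ => ((1 - δ) * μ η + δ * π' η) / ν η)
  have := hcont.tendsto 0
  simpa using this

/-- Propagation of the relative entropy along the Kolmogorov equation. -/
theorem relEnt_le_of_kolmogorov {N d K : ℕ} [NeZero N] (hN : 2 ≤ N) {p : Fin d → Bool → ℝ}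
    {Γ : ℝ} {μ : ℝ → GCfg N d K → ℝ} {a ad : ℝ → Site N d → ℝ} {A E T : ℝ} (hK : 1 ≤ K)
    (hA : 0 < A) (hE : 0 ≤ E)
    (hμ : ∀ t, 0 ≤ t → (∀ η, 0 ≤ μ t η) ∧ ∑ η, μ t η = 1)
    (hk : ∀ (g : GCfg N d K → ℝ) (t : ℝ), 0 ≤ t →
      HasDerivAt (fun s => ∑ η, g η * μ s η) (Γ * ∑ η, genL p g η * μ t η) t)
    (ha : ∀ t ∈ Set.Icc 0 T, ∀ x, HasDerivAt (fun s => a s x) (ad t x) t)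
    (h0 : ∀ t ∈ Set.Icc 0 T, ∀ x, 0 < a t x) (h1 : ∀ t ∈ Set.Icc 0 T, ∀ x, a t x < K)
    (hprod : ∀ t ∈ Set.Icc 0 T, ∀ f : GCfg N d K → ℝ, (∀ η, 0 < f η) →
      ∑ η, prodBinom (a t) η * f η = 1 →
      Γ * ∑ η, genL p (fun η => Real.log (f η)) η * (prodBinom (a t) η * f η)
          - ∑ η, prodBinom (a t) η * f η * (K * ∑ x, ad t x * omVar (a t) η x)
        ≤ A * relEnt (fun η => prodBinom (a t) η * f η) (prodBinom (a t)) + E) :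
    ∀ t ∈ Set.Icc 0 T, relEnt (μ t) (prodBinom (a t))
      ≤ Real.exp (A * t) * (relEnt (μ 0) (prodBinom (a 0)) + E / A) := by
  intro t ht
  have hK0 : (0 : ℝ) < K := by positivity
  have hr0 : (0 : ℝ) < K / 2 := by positivity
  have hr1 : (K : ℝ) / 2 < K := by linarith
  set π₀ : GCfg N d K → ℝ := prodBinom fun _ => (K : ℝ) / 2 with hπ₀
  have hπ0 : ∀ η, 0 < π₀ η := prodBinom_pos (fun _ => hr0) (fun _ => hr1)
  have hπ1 : ∑ η, π₀ η = 1 := sum_prodBinom _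
  have key : ∀ δ ∈ Set.Ioo (0 : ℝ) 1,
      relEnt (fun η => (1 - δ) * μ t η + δ * π₀ η) (prodBinom (a t))
        ≤ Real.exp (A * t)
          * (relEnt (fun η => (1 - δ) * μ 0 η + δ * π₀ η) (prodBinom (a 0)) + E / A) := by
    intro δ hδ
    have hδ1 : 0 < 1 - δ := by linarith [hδ.2]
    have hpos : ∀ s ∈ Set.Icc 0 T, ∀ η, 0 < (1 - δ) * μ s η + δ * π₀ η := fun s hs η =>
      add_pos_of_nonneg_of_pos (mul_nonneg hδ1.le ((hμ s hs.1).1 η)) (mul_pos hδ.1 (hπ0 η))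
    have hmix : ∀ g : GCfg N d K → ℝ, ∀ s, ∑ η, g η * ((1 - δ) * μ s η + δ * π₀ η)
        = (1 - δ) * ∑ η, g η * μ s η + δ * ∑ η, g η * π₀ η := by
      intro g s
      rw [Finset.mul_sum, Finset.mul_sum, ← Finset.sum_add_distrib]
      exact Finset.sum_congr rfl fun η _ => by ring
    have hkδ : ∀ (g : GCfg N d K → ℝ) (s : ℝ), s ∈ Set.Icc 0 T →
        HasDerivAt (fun s => ∑ η, g η * ((1 - δ) * μ s η + δ * π₀ η))
          (Γ * ∑ η, genL p g η * ((1 - δ) * μ s η + δ * π₀ η)) s := by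
      intro g s hs
      simp_rw [hmix]
      refine (((hk g s hs.1).const_mul (1 - δ)).add_const _).congr_deriv ?_
      rw [hπ₀, sum_genL_mul_prodBinom_const hN p hr0 hr1]
      ring
    refine le_of_hasDerivAt_le hA hE (fun s hs => hasDerivAt_relEnt_of_kolmogorov
      (fun g => hkδ g s hs) (hpos s hs) (ha s hs) (h0 s hs) (h1 s hs)) ?_ t ht
    intro s hs
    have hν := prodBinom_pos (h0 s hs) (h1 s hs)
    have hf := hprod s hs (fun η => ((1 - δ) * μ s η + δ * π₀ η) / prodBinom (a s) η)
      (fun η => div_pos (hpos s hs η) (hν η))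
    have e : ∀ η, prodBinom (a s) η * (((1 - δ) * μ s η + δ * π₀ η) / prodBinom (a s) η)
        = (1 - δ) * μ s η + δ * π₀ η := fun η => mul_div_cancel₀ _ (hν η).ne'
    simp only [e] at hf
    refine hf ?_
    rw [Finset.sum_add_distrib, ← Finset.mul_sum, ← Finset.mul_sum, (hμ s hs.1).2, hπ1]
    ring
  have hlim1 := (tendsto_relEnt_mix (μ t) π₀ (prodBinom (a t))).mono_left
    (nhdsWithin_le_nhds (s := Set.Ioi 0))
  have hlim2 := (((tendsto_relEnt_mix (μ 0) π₀ (prodBinom (a 0))).mono_left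
    (nhdsWithin_le_nhds (s := Set.Ioi 0))).add_const (E / A)).const_mul (Real.exp (A * t))
  refine le_of_tendsto_of_tendsto hlim1 hlim2 ?_
  filter_upwards [Ioo_mem_nhdsGT (zero_lt_one' ℝ)] with δ hδ
  exact key δ hδ

theorem exists_bound_of_periodic {d : ℕ} {F : ℝ × (Fin d → ℝ) → ℝ} (hF : Continuous F)
    (hper : ∀ (s : ℝ) (u : Fin d → ℝ) (z : Fin d → ℤ), F (s, fun j => u j + z j) = F (s, u))
    (T : ℝ) : ∃ M, 0 ≤ M ∧ ∀ s ∈ Set.Icc (0 : ℝ) T, ∀ u, |F (s, u)| ≤ M := by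
  have hc : IsCompact (Set.Icc (0 : ℝ) T ×ˢ Set.Icc (0 : Fin d → ℝ) 1) :=
    isCompact_Icc.prod isCompact_Icc
  obtain ⟨M, hM⟩ := hc.exists_bound_of_continuousOn hF.continuousOn
  refine ⟨max M 0, le_max_right _ _, fun s hs u => le_max_of_le_left ?_⟩
  have h1 := hper s (fun j => Int.fract (u j)) (fun j => ⌊u j⌋)
  simp only [Int.fract_add_floor] at h1
  rw [h1]
  exact hM (s, fun j => Int.fract (u j)) ⟨hs, fun j => Int.fract_nonneg _,
    fun j => (Int.fract_lt_one _).le⟩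

/-- The partial derivative in the spatial direction `i`. -/
noncomputable def spaceDeriv {d : ℕ} (F : ℝ × (Fin d → ℝ) → ℝ) (i : Fin d)
    (q : ℝ × (Fin d → ℝ)) : ℝ :=
  fderiv ℝ F q (0, Pi.single i 1)

theorem contDiff_spaceDeriv {d : ℕ} {F : ℝ × (Fin d → ℝ) → ℝ}
    (hF : ContDiff ℝ (⊤ : ℕ∞) F) (i : Fin d) : ContDiff ℝ (⊤ : ℕ∞) (spaceDeriv F i) := by
  have h1 : ContDiff ℝ (⊤ : ℕ∞) (fderiv ℝ F) := hF.fderiv_right (by simp)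
  exact h1.clm_apply contDiff_const

theorem spaceDeriv_periodic {d : ℕ} {F : ℝ × (Fin d → ℝ) → ℝ}
    (hper : ∀ (s : ℝ) (u : Fin d → ℝ) (z : Fin d → ℤ), F (s, fun j => u j + z j) = F (s, u))
    (i : Fin d) (s : ℝ) (u : Fin d → ℝ) (z : Fin d → ℤ) :
    spaceDeriv F i (s, fun j => u j + z j) = spaceDeriv F i (s, u) := by
  have h1 : (fun q : ℝ × (Fin d → ℝ) => F (q + (0, fun j => (z j : ℝ)))) = F := by
    funext q
    have := hper q.1 q.2 z
    simp only [Prod.mk.eta] at this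
    rw [← this]
    congr 1
    ext <;> simp
  have h2 := fderiv_comp_add_right (𝕜 := ℝ) (f := F) (x := (s, u)) (0, fun j => (z j : ℝ))
  rw [h1] at h2
  unfold spaceDeriv
  rw [h2]
  congr 2
  ext <;> simp

theorem hasDerivAt_spaceDeriv {d : ℕ} {F : ℝ × (Fin d → ℝ) → ℝ}
    (hF : ContDiff ℝ (⊤ : ℕ∞) F) (i : Fin d) (s : ℝ) (u : Fin d → ℝ) (h : ℝ) :
    HasDerivAt (fun h : ℝ => F (s, u + h • Pi.single i 1))
      (spaceDeriv F i (s, u + h • Pi.single i 1)) h := by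
  have h1 : HasDerivAt (fun h : ℝ => (s, u + h • (Pi.single i 1 : Fin d → ℝ)))
      (0, (1 : ℝ) • Pi.single i 1) h :=
    (hasDerivAt_const h s).prodMk (((hasDerivAt_id h).smul_const _).const_add u)
  rw [one_smul] at h1
  exact ((hF.differentiable (by simp)).differentiableAt.hasFDerivAt).comp_hasDerivAt h h1

theorem abs_sub_le_of_hasDerivAt {g g' : ℝ → ℝ} {M : ℝ} (hg : ∀ h, HasDerivAt g (g' h) h)
    (hM : ∀ h, |g' h| ≤ M) (h : ℝ) : |g h - g 0| ≤ M * |h| := by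
  have := Convex.norm_image_sub_le_of_norm_hasDerivWithin_le (s := Set.univ) (x := 0) (y := h)
    (fun x _ => (hg x).hasDerivWithinAt) (fun x _ => hM x) convex_univ trivial trivial
  simpa using this

theorem abs_taylor_le_of_hasDerivAt {g g' g'' : ℝ → ℝ} {M : ℝ}
    (hg : ∀ h, HasDerivAt g (g' h) h) (hg' : ∀ h, HasDerivAt g' (g'' h) h)
    (hM : ∀ h, |g'' h| ≤ M) (h : ℝ) : |g h - g 0 - h * g' 0| ≤ M * h ^ 2 := by
  have hM0 : 0 ≤ M := (abs_nonneg _).trans (hM 0)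
  have h1 : ∀ x ∈ Set.uIcc 0 h, ‖g' x - 1 * g' 0‖ ≤ M * |h| := by
    intro x hx
    rw [one_mul]
    refine (abs_sub_le_of_hasDerivAt hg' hM x).trans (mul_le_mul_of_nonneg_left ?_ hM0)
    have := Set.abs_sub_left_of_mem_uIcc hx
    simpa using this
  have := Convex.norm_image_sub_le_of_norm_hasDerivWithin_le (s := Set.uIcc 0 h)
    (f := fun x => g x - x * g' 0) (x := 0) (y := h)
    (fun x _ => ((hg x).fun_sub ((hasDerivAt_id x).mul_const (g' 0))).hasDerivWithinAt)
    h1 (convex_uIcc 0 h) Set.left_mem_uIcc Set.right_mem_uIcc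
  have e : g h - h * g' 0 - (g 0 - 0 * g' 0) = g h - g 0 - h * g' 0 := by ring
  rw [e] at this
  simp only [Real.norm_eq_abs, sub_zero] at this
  rwa [mul_assoc, ← pow_two, sq_abs] at this

theorem exists_siteCoord_add {N d : ℕ} [NeZero N] (x : Site N d) (i : Fin d) :
    ∃ z : Fin d → ℤ, siteCoord (x + Pi.single i 1)
      = fun j => (siteCoord x + ((1 : ℝ) / N) • (Pi.single i 1 : Fin d → ℝ)) j + z j := by
  have hN : (N : ℝ) ≠ 0 := Nat.cast_ne_zero.2 (NeZero.ne N)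
  refine ⟨fun j => if j = i then -(((x i).val + 1) / N : ℕ) else 0, ?_⟩
  funext j
  by_cases h : j = i
  · subst h
    have h1 : ((x + Pi.single j 1 : Site N d) j).val = ((x j).val + 1) % N := by
      simp [Fin.val_add]
    have h2 : ((((x j).val + 1) % N : ℕ) : ℝ) = (x j).val + 1 - N * (((x j).val + 1) / N : ℕ) := by
      have := Nat.mod_add_div ((x j).val + 1) N
      rw [eq_sub_iff_add_eq]
      exact_mod_cast this
    change (((x + Pi.single j 1 : Site N d) j).val : ℝ) / N = _
    rw [h1, h2]
    simp only [siteCoord, Pi.add_apply, Pi.smul_apply, Pi.single_eq_same, if_true, smul_eq_mul]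
    generalize ((x j).val + 1) / N = q
    push_cast
    field_simp
    ring
  · simp [siteCoord, h]

theorem hasDerivAt_transport {d : ℕ} {F : ℝ × (Fin d → ℝ) → ℝ}
    (hF : ContDiff ℝ (⊤ : ℕ∞) F) (a b : ℝ) (m u : Fin d → ℝ) (t : ℝ) :
    HasDerivAt (fun t : ℝ => F (a * t, fun j => u j - b * t * m j))
      (a * deriv (fun s => F (s, fun j => u j - b * t * m j)) (a * t)
        - b * ∑ i, m i * spaceDeriv F i (a * t, fun j => u j - b * t * m j)) t := by
  have hd : ∀ q, HasFDerivAt F (fderiv ℝ F q) q := fun q =>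
    (hF.differentiable (by simp)).differentiableAt.hasFDerivAt
  have h1 : HasDerivAt (fun t : ℝ => (a * t, fun j => u j - b * t * m j))
      (a, fun j => -(b * m j)) t := by
    refine HasDerivAt.prodMk (by simpa using (hasDerivAt_id t).const_mul a)
      (hasDerivAt_pi.2 fun j => ?_)
    simpa using (((hasDerivAt_id t).const_mul b).mul_const (m j)).const_sub (u j)
  have h2 := (hd _).comp_hasDerivAt t h1
  refine h2.congr_deriv ?_
  set q : ℝ × (Fin d → ℝ) := (a * t, fun j => u j - b * t * m j) with hq
  have h3 : deriv (fun s => F (s, fun j => u j - b * t * m j)) (a * t)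
      = fderiv ℝ F q (1, 0) :=
    ((hd q).comp_hasDerivAt (a * t)
      ((hasDerivAt_id (a * t)).prodMk (hasDerivAt_const _ _))).deriv
  rw [h3]
  have h4 : ((a, fun j => -(b * m j)) : ℝ × (Fin d → ℝ))
      = a • (1, 0) + ∑ i, (-(b * m i)) • ((0 : ℝ), (Pi.single i 1 : Fin d → ℝ)) := by
    ext j
    · simp [Prod.fst_sum]
    · simp [Prod.snd_sum, Finset.sum_apply, Pi.single_apply]
  rw [h4, map_add, map_smul, map_sum, Finset.mul_sum, sub_eq_add_neg, ← Finset.sum_neg_distrib]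
  simp only [map_smul, smul_eq_mul, spaceDeriv]
  congr 1
  exact Finset.sum_congr rfl fun i _ => by ring

theorem deriv_update_sq {d : ℕ} {F : ℝ × (Fin d → ℝ) → ℝ}
    (hF : ContDiff ℝ (⊤ : ℕ∞) F) (s : ℝ) (u : Fin d → ℝ) (i : Fin d) :
    deriv (fun h => F (s, Function.update u i h) ^ 2) (u i)
      = 2 * F (s, u) * spaceDeriv F i (s, u) := by
  have h1 : HasDerivAt (fun h : ℝ => (s, Function.update u i h)) (0, Pi.single i 1) (u i) :=
    (hasDerivAt_const _ s).prodMk (hasDerivAt_update u i (u i))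
  have hd : HasFDerivAt F (fderiv ℝ F (s, Function.update u i (u i))) _ :=
    (hF.differentiable (by simp)).differentiableAt.hasFDerivAt
  have h2 := (hd.comp_hasDerivAt (u i) h1).fun_pow 2
  simp only [Function.comp_def, Function.update_eq_self] at h2
  rw [h2.deriv]
  simp [spaceDeriv]

theorem abs_linCoef_add_le {N d K : ℕ} [NeZero N] {p : Fin d → Bool → ℝ} (hp : ∀ i b, 0 ≤ p i b)
    {a : Site N d → ℝ} {x : Site N d} {A h r e : ℝ} {D : Fin d → ℝ} (hA : |a x| ≤ A)
    (he : ∀ i, |a (x + Pi.single i 1) - a x - r * h * D i| ≤ e)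
    (he' : ∀ i, |a (x - Pi.single i 1) - a x + r * h * D i| ≤ e) :
    |linCoef K p a x + r * h * (∑ i, (p i true - p i false) * D i) * (K - 2 * a x)|
      ≤ (K + 2 * A) * e * ∑ i, (p i true + p i false) := by
  have h1 : linCoef K p a x + r * h * (∑ i, (p i true - p i false) * D i) * (K - 2 * a x)
      = ∑ i, (p i true * (K * (a (x - Pi.single i 1) - a x + r * h * D i)
          + a x * ((a (x + Pi.single i 1) - a x - r * h * D i)
            - (a (x - Pi.single i 1) - a x + r * h * D i)))
        + p i false * (K * (a (x + Pi.single i 1) - a x - r * h * D i)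
          + a x * ((a (x - Pi.single i 1) - a x + r * h * D i)
            - (a (x + Pi.single i 1) - a x - r * h * D i)))) := by
    rw [linCoef, Finset.mul_sum, Finset.sum_mul, ← Finset.sum_add_distrib]
    exact Finset.sum_congr rfl fun i _ => by ring
  rw [h1, Finset.mul_sum]
  refine (Finset.abs_sum_le_sum_abs _ _).trans (Finset.sum_le_sum fun i _ => ?_)
  have h2 : ∀ y z : ℝ, |y| ≤ e → |z| ≤ e → |K * y + a x * (z - y)| ≤ (K + 2 * A) * e := by
    intro y z hy hz
    have hK : (0 : ℝ) ≤ K := Nat.cast_nonneg K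
    have h3 : |z - y| ≤ 2 * e := (abs_sub z y).trans (by linarith)
    calc |K * y + a x * (z - y)| ≤ |K * y| + |a x * (z - y)| := abs_add_le _ _
      _ = K * |y| + |a x| * |z - y| := by rw [abs_mul, abs_mul, abs_of_nonneg hK]
      _ ≤ K * e + A * (2 * e) := by
        gcongr
        exact (abs_nonneg _).trans hA
      _ = _ := by ring
  refine (abs_add_le _ _).trans ?_
  rw [abs_mul, abs_mul, abs_of_nonneg (hp i true), abs_of_nonneg (hp i false),
    mul_add ((K + 2 * A) * e), mul_comm ((K + 2 * A) * e) (p i true),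
    mul_comm ((K + 2 * A) * e) (p i false)]
  exact add_le_add (mul_le_mul_of_nonneg_left (h2 _ _ (he' i) (he i)) (hp i true))
    (mul_le_mul_of_nonneg_left (h2 _ _ (he i) (he' i)) (hp i false))

theorem exists_profileGE_bounds {d K : ℕ} {p : Fin d → Bool → ℝ} (hp : ∀ i b, 0 ≤ p i b)
    {ϱs α κ T : ℝ} (hα : 0 < α) (hκα : κ ≤ α)
    {ρ : ℝ → (Fin d → ℝ) → ℝ}
    (hρsmooth : ContDiff ℝ (⊤ : ℕ∞) (fun q : ℝ × (Fin d → ℝ) => ρ q.1 q.2))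
    (hρper : ∀ (s : ℝ) (u : Fin d → ℝ) (z : Fin d → ℤ), ρ s (fun j => u j + z j) = ρ s u)
    (hρpde : ∀ s ∈ Set.Icc (0 : ℝ) T, ∀ u : Fin d → ℝ,
      deriv (fun s' => ρ s' u) s
        = ∑ i, (p i true - p i false)
            * deriv (fun h => ρ s (Function.update u i h) ^ 2) (u i)) :
    ∃ C > 0, ∀ (N : ℕ) [NeZero N], ∃ ad : ℝ → Site N d → ℝ, ∀ t ∈ Set.Icc (0 : ℝ) T,
      ∀ x : Site N d,
      HasDerivAt (fun s => profileGE d K ϱs α κ (fun i => p i true - p i false) ρ N s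
        (siteCoord x)) (ad t x) t ∧
      |profileGE d K ϱs α κ (fun i => p i true - p i false) ρ N t (siteCoord x) - ϱs|
        ≤ C * (N : ℝ) ^ (-α) ∧
      (∀ i, |profileGE d K ϱs α κ (fun i => p i true - p i false) ρ N t
          (siteCoord (x + Pi.single i 1))
        - profileGE d K ϱs α κ (fun i => p i true - p i false) ρ N t (siteCoord x)|
        ≤ C * (N : ℝ) ^ (-1 - α)) ∧
      |(N : ℝ) ^ ((1 : ℝ) + κ) * linCoef K p (fun y => profileGE d K ϱs α κ
        (fun i => p i true - p i false) ρ N t (siteCoord y)) x - ad t x|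
        ≤ C * (N : ℝ) ^ (κ - 1 - α) := by
  classical
  set F : ℝ × (Fin d → ℝ) → ℝ := fun q => ρ q.1 q.2 with hFdef
  have hper : ∀ (s : ℝ) (u : Fin d → ℝ) (z : Fin d → ℤ),
      F (s, fun j => u j + z j) = F (s, u) := hρper
  obtain ⟨M0, hM0, hb0⟩ := exists_bound_of_periodic hρsmooth.continuous hper T
  have hb1' := fun i => exists_bound_of_periodic (contDiff_spaceDeriv hρsmooth i).continuous
    (spaceDeriv_periodic hper i) T
  choose M1 hM1 hb1 using hb1'
  have hb2' := fun i => exists_bound_of_periodic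
    (contDiff_spaceDeriv (contDiff_spaceDeriv hρsmooth i) i).continuous
    (spaceDeriv_periodic (spaceDeriv_periodic hper i) i) T
  choose M2 hM2 hb2 using hb2'
  set P := ∑ i, (p i true + p i false) with hP
  have hP0 : 0 ≤ P := Finset.sum_nonneg fun i _ => add_nonneg (hp i _) (hp i _)
  set M := M0 + (∑ i, M1 i) + ∑ i, M2 i with hM
  have hs1 : 0 ≤ ∑ i, M1 i := Finset.sum_nonneg fun i _ => hM1 i
  have hs2 : 0 ≤ ∑ i, M2 i := Finset.sum_nonneg fun i _ => hM2 i
  have hM_nonneg : 0 ≤ M := by positivity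
  have hb0' : ∀ s ∈ Set.Icc (0 : ℝ) T, ∀ u, |F (s, u)| ≤ M := fun s hs u =>
    (hb0 s hs u).trans (by linarith)
  have hb1' : ∀ i, ∀ s ∈ Set.Icc (0 : ℝ) T, ∀ u, |spaceDeriv F i (s, u)| ≤ M := fun i s hs u =>
    (hb1 i s hs u).trans (by
      have := Finset.single_le_sum (fun j _ => hM1 j) (Finset.mem_univ i)
      linarith)
  have hb2' : ∀ i, ∀ s ∈ Set.Icc (0 : ℝ) T, ∀ u,
      |spaceDeriv (spaceDeriv F i) i (s, u)| ≤ M := fun i s hs u =>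
    (hb2 i s hs u).trans (by
      have := Finset.single_le_sum (fun j _ => hM2 j) (Finset.mem_univ i)
      linarith)
  set A := |ϱs| + M with hA
  have hA0 : 0 ≤ A := by positivity
  refine ⟨M + 1 + (K + 2 * A) * M * P, by positivity, fun N _ => ?_⟩
  have hN1 : (1 : ℝ) ≤ N := by exact_mod_cast NeZero.one_le
  have hN0 : (0 : ℝ) < N := by linarith
  have hC1 : M ≤ M + 1 + (K + 2 * A) * M * P := by
    have : 0 ≤ (K + 2 * A) * M * P := by positivity
    linarith
  have hC2 : (K + 2 * A) * M * P ≤ M + 1 + (K + 2 * A) * M * P := by linarith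
  set b := (N : ℝ) ^ κ * ((K : ℝ) - 2 * ϱs) with hb
  set σ := (N : ℝ) ^ (κ - α) with hσ
  set r := (N : ℝ) ^ (-α) with hr
  have hr0 : 0 < r := Real.rpow_pos_of_pos hN0 _
  have hr1 : r ≤ 1 := Real.rpow_le_one_of_one_le_of_nonpos hN1 (by linarith)
  have hσ0 : 0 < σ := Real.rpow_pos_of_pos hN0 _
  have hσ1 : σ ≤ 1 := Real.rpow_le_one_of_one_le_of_nonpos hN1 (by linarith)
  set m : Fin d → ℝ := fun i => p i true - p i false with hm
  have hprof : ∀ t u, profileGE d K ϱs α κ m ρ N t u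
      = ϱs + r * F (σ * t, fun j => u j - b * t * m j) := fun t u => rfl
  refine ⟨fun t x => r * (σ * deriv (fun s => F (s, fun j => siteCoord x j - b * t * m j)) (σ * t)
        - b * ∑ i, m i * spaceDeriv F i (σ * t, fun j => siteCoord x j - b * t * m j)),
    fun t ht x => ?_⟩
  have hst : σ * t ∈ Set.Icc (0 : ℝ) T :=
    ⟨mul_nonneg hσ0.le ht.1, (mul_le_of_le_one_left ht.1 hσ1).trans ht.2⟩
  set v : Fin d → ℝ := fun j => siteCoord x j - b * t * m j with hv
  have hplus : ∀ (y : Site N d) (i : Fin d),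
      F (σ * t, fun j => siteCoord (y + Pi.single i 1) j - b * t * m j)
        = F (σ * t, (fun j => siteCoord y j - b * t * m j)
          + ((1 : ℝ) / N) • (Pi.single i 1 : Fin d → ℝ)) := by
    intro y i
    obtain ⟨z, hz⟩ := exists_siteCoord_add y i
    rw [hz]
    refine Eq.trans ?_ (hper (σ * t) _ z)
    congr 2
    funext j
    simp only [Pi.add_apply, Pi.smul_apply]
    ring
  have hminus : ∀ i : Fin d,
      F (σ * t, fun j => siteCoord (x - Pi.single i 1) j - b * t * m j)
        = F (σ * t, v + (-((1 : ℝ) / N)) • (Pi.single i 1 : Fin d → ℝ)) := by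
    intro i
    obtain ⟨z, hz⟩ := exists_siteCoord_add (x - Pi.single i 1) i
    rw [sub_add_cancel] at hz
    rw [← hper (σ * t) _ z]
    congr 2
    funext j
    simp only [Pi.add_apply, Pi.smul_apply, hv, hz]
    simp only [neg_smul]
    simp
    ring
  have hbx : |profileGE d K ϱs α κ m ρ N t (siteCoord x) - ϱs| ≤ M * r := by
    rw [hprof, add_sub_cancel_left, abs_mul, abs_of_pos hr0, mul_comm]
    exact mul_le_mul_of_nonneg_right (hb0' _ hst _) hr0.le
  refine ⟨((hasDerivAt_transport hρsmooth σ b m (siteCoord x) t).const_mul r).const_add ϱs,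
    hbx.trans (mul_le_mul_of_nonneg_right hC1 hr0.le), fun i => ?_, ?_⟩
  · rw [hprof, hprof, hplus]
    have h1 := abs_sub_le_of_hasDerivAt (hasDerivAt_spaceDeriv hρsmooth i (σ * t) v)
      (fun h => hb1' i _ hst _) ((1 : ℝ) / N)
    rw [zero_smul, add_zero] at h1
    rw [add_sub_add_left_eq_sub, ← mul_sub, abs_mul, abs_of_pos hr0]
    have h2 : (N : ℝ) ^ (-1 - α) = r * |(1 : ℝ) / N| := by
      rw [abs_of_pos (by positivity), one_div, ← Real.rpow_neg_one, hr, ← Real.rpow_add hN0]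
      congr 1
      ring
    rw [h2]
    calc r * |F (σ * t, v + ((1 : ℝ) / N) • Pi.single i 1) - F (σ * t, v)|
        ≤ r * (M * |(1 : ℝ) / N|) := mul_le_mul_of_nonneg_left h1 hr0.le
      _ = M * (r * |(1 : ℝ) / N|) := by ring
      _ ≤ _ := mul_le_mul_of_nonneg_right hC1 (by positivity)
  · have hax : |profileGE d K ϱs α κ m ρ N t (siteCoord x)| ≤ A := by
      have h1 := abs_add_le (profileGE d K ϱs α κ m ρ N t (siteCoord x) - ϱs) ϱs
      rw [sub_add_cancel] at h1
      have h2 : M * r ≤ M := mul_le_of_le_one_right hM_nonneg hr1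
      linarith
    have hT : ∀ (i : Fin d) (h : ℝ), |F (σ * t, v + h • (Pi.single i 1 : Fin d → ℝ)) - F (σ * t, v)
        - h * spaceDeriv F i (σ * t, v)| ≤ M * h ^ 2 := by
      intro i h
      have h1 := abs_taylor_le_of_hasDerivAt (hasDerivAt_spaceDeriv hρsmooth i (σ * t) v)
        (hasDerivAt_spaceDeriv (contDiff_spaceDeriv hρsmooth i) i (σ * t) v)
        (fun h => hb2' i _ hst _) h
      simpa only [zero_smul, add_zero] using h1
    have h1 := abs_linCoef_add_le (K := K) hp (x := x) (r := r) (h := (1 : ℝ) / N)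
      (e := r * (M * ((1 : ℝ) / N) ^ 2))
      (a := fun y => profileGE d K ϱs α κ m ρ N t (siteCoord y))
      (D := fun i => spaceDeriv F i (σ * t, v)) hax
      (fun i => by
        have := mul_le_mul_of_nonneg_left (hT i ((1 : ℝ) / N)) hr0.le
        rw [← abs_of_pos hr0, ← abs_mul, abs_of_pos hr0] at this
        refine le_trans (le_of_eq ?_) this
        simp only [hprof, hplus]
        congr 1
        simp only [← hv]
        ring)
      (fun i => by
        have := mul_le_mul_of_nonneg_left (hT i (-((1 : ℝ) / N))) hr0.le
        rw [← abs_of_pos hr0, ← abs_mul, abs_of_pos hr0, neg_sq] at this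
        refine le_trans (le_of_eq ?_) this
        simp only [hprof, hminus]
        congr 1
        simp only [← hv]
        ring)
    have hpde : deriv (fun s => F (s, v)) (σ * t)
        = 2 * F (σ * t, v) * ∑ i, m i * spaceDeriv F i (σ * t, v) := by
      have h2 := hρpde (σ * t) hst v
      have h3 : ∀ i, deriv (fun h => ρ (σ * t) (Function.update v i h) ^ 2) (v i)
        = 2 * F (σ * t, v) * spaceDeriv F i (σ * t, v) := deriv_update_sq hρsmooth (σ * t) v
      simp only [h3] at h2
      rw [Finset.mul_sum]
      refine h2.trans (Finset.sum_congr rfl fun i _ => ?_)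
      simp only [hm]
      ring
    set S := ∑ i, m i * spaceDeriv F i (σ * t, v) with hS
    set Γ := (N : ℝ) ^ ((1 : ℝ) + κ) with hΓ
    have hΓ0 : 0 < Γ := Real.rpow_pos_of_pos hN0 _
    have e1 : Γ * ((1 : ℝ) / N) = (N : ℝ) ^ κ := by
      rw [hΓ, one_div, ← Real.rpow_neg_one, ← Real.rpow_add hN0]
      congr 1
      ring
    have e2 : (N : ℝ) ^ κ * r = σ := by
      rw [hσ, hr, ← Real.rpow_add hN0]
      congr 1
    have e3 : Γ * (r * ((1 : ℝ) / N) ^ 2) = (N : ℝ) ^ (κ - 1 - α) := by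
      rw [show Γ * (r * ((1 : ℝ) / N) ^ 2) = (Γ * ((1 : ℝ) / N)) * r * ((1 : ℝ) / N) by ring, e1,
        e2, hσ, one_div, ← Real.rpow_neg_one, ← Real.rpow_add hN0]
      congr 1
      ring
    have key : Γ * linCoef K p (fun y => profileGE d K ϱs α κ m ρ N t (siteCoord y)) x
        - r * (σ * deriv (fun s => F (s, v)) (σ * t) - b * S)
        = Γ * (linCoef K p (fun y => profileGE d K ϱs α κ m ρ N t (siteCoord y)) x
          + r * ((1 : ℝ) / N) * S * (K - 2 * profileGE d K ϱs α κ m ρ N t (siteCoord x))) := by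
      rw [hpde, mul_add, show Γ * (r * ((1 : ℝ) / N) * S
        * (K - 2 * profileGE d K ϱs α κ m ρ N t (siteCoord x)))
        = (Γ * ((1 : ℝ) / N)) * r * S * (K - 2 * profileGE d K ϱs α κ m ρ N t (siteCoord x)) by ring,
        e1, hprof, ← hv, hb, ← e2]
      ring
    rw [key, abs_mul, abs_of_pos hΓ0, ← e3]
    calc _ ≤ Γ * ((K + 2 * A) * (r * (M * ((1 : ℝ) / N) ^ 2)) * P) :=
          mul_le_mul_of_nonneg_left h1 hΓ0.le
      _ = (K + 2 * A) * M * P * (Γ * (r * ((1 : ℝ) / N) ^ 2)) := by ring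
      _ ≤ _ := mul_le_mul_of_nonneg_right hC2 (by positivity)

theorem tendsto_natCast_rpow_of_neg {y : ℝ} (hy : y < 0) :
    Tendsto (fun N : ℕ => (N : ℝ) ^ y) atTop (nhds 0) := by
  have := (tendsto_rpow_neg_atTop (neg_pos.2 hy)).comp tendsto_natCast_atTop_atTop
  simpa [Function.comp_def] using this

/-- The dyadic scale `n` with `2 ^ n ≤ N ^ s < 2 ^ (n + 1)`. -/
noncomputable def dyadicScale (s : ℝ) (N : ℕ) : ℕ := Nat.log 2 ⌊(N : ℝ) ^ s⌋₊

theorem two_pow_dyadicScale_le {s : ℝ} (hs : 0 ≤ s) {N : ℕ} (hN : 1 ≤ N) :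
    (2 : ℝ) ^ dyadicScale s N ≤ (N : ℝ) ^ s := by
  have h1 : (1 : ℝ) ≤ (N : ℝ) ^ s := Real.one_le_rpow (by exact_mod_cast hN) hs
  have h2 : ⌊(N : ℝ) ^ s⌋₊ ≠ 0 := (Nat.floor_pos.2 h1).ne'
  have h3 : ((2 ^ dyadicScale s N : ℕ) : ℝ) ≤ (⌊(N : ℝ) ^ s⌋₊ : ℝ) :=
    Nat.cast_le.2 (Nat.pow_log_le_self 2 h2)
  push_cast at h3
  exact h3.trans (Nat.floor_le (by linarith))

theorem rpow_le_two_mul_two_pow_dyadicScale {s : ℝ} {N : ℕ} :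
    (N : ℝ) ^ s ≤ 2 * 2 ^ dyadicScale s N := by
  have h1 : ⌊(N : ℝ) ^ s⌋₊ + 1 ≤ 2 ^ (dyadicScale s N + 1) :=
    Nat.lt_pow_succ_log_self (by norm_num) _
  have h2 : ((⌊(N : ℝ) ^ s⌋₊ + 1 : ℕ) : ℝ) ≤ ((2 ^ (dyadicScale s N + 1) : ℕ) : ℝ) :=
    Nat.cast_le.2 h1
  push_cast at h2
  rw [pow_succ] at h2
  linarith [Nat.lt_floor_add_one ((N : ℝ) ^ s)]

theorem dyadicScale_le {s δ : ℝ} (hs : 0 ≤ s) (hδ : 0 < δ) {N : ℕ} (hN : 1 ≤ N) :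
    (dyadicScale s N : ℝ) ≤ s / (δ * Real.log 2) * (N : ℝ) ^ δ := by
  have hN0 : (0 : ℝ) < N := by exact_mod_cast hN
  have hl : 0 < Real.log 2 := Real.log_pos (by norm_num)
  have h1 := Real.log_le_log (by positivity) (two_pow_dyadicScale_le hs hN)
  rw [Real.log_pow, Real.log_rpow hN0] at h1
  have h2 := mul_le_mul_of_nonneg_left (Real.log_le_rpow_div hN0.le hδ) hs
  have h3 := h1.trans h2
  rw [← le_div_iff₀ hl] at h3
  refine h3.trans (le_of_eq ?_)
  field_simp

theorem exists_dyadic_exponent {d : ℕ} {α κ : ℝ} (hd : 1 ≤ d) (hα : 0 < α) (hκ : 0 < κ)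
    (hκα : κ ≤ α) (hαd : α < (d : ℝ) / 2)
    (hcase : (d = 1 ∧ α < 1 / 2 ∧ κ < 1 - 2 * α) ∨ (2 ≤ d ∧ κ < 1)) :
    ∃ s : ℝ, 0 < s ∧ s < 1 ∧ 2 * s ≤ 1 + 2 * α - κ ∧ κ + α < d * s ∧ κ < 1 ∧
      (d = 1 → s + κ < 1) := by
  rcases hcase with ⟨rfl, h1, h2⟩ | ⟨h1, h2⟩
  · have h3 : κ + α < min (1 - κ) ((1 + 2 * α - κ) / 2) :=
      lt_min (by linarith) (by linarith)
    obtain ⟨s, hs1, hs2⟩ := exists_between h3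
    have := hs2.trans_le (min_le_left _ _)
    have := hs2.trans_le (min_le_right _ _)
    refine ⟨s, by linarith, by linarith, by linarith, by simpa using hs1, by linarith,
      fun _ => by linarith⟩
  · have hd2 : (2 : ℝ) ≤ d := by exact_mod_cast h1
    have hd0 : (0 : ℝ) < d := by linarith
    have h3 : (κ + α) / d < min 1 ((1 + 2 * α - κ) / 2) := by
      refine lt_min ((div_lt_one hd0).2 (by linarith)) ?_
      exact (div_le_div_of_nonneg_left (by linarith) (by norm_num) hd2).trans_lt (by linarith)
    obtain ⟨s, hs1, hs2⟩ := exists_between h3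
    have := hs2.trans_le (min_le_left _ _)
    have := hs2.trans_le (min_le_right _ _)
    have hs0 : 0 < s := (by positivity : 0 < (κ + α) / d).trans hs1
    refine ⟨s, hs0, by linarith, by linarith, ?_, h2, fun h => by omega⟩
    rwa [div_lt_iff₀ hd0, mul_comm] at hs1

theorem exists_dyadic_scale {d : ℕ} {α κ : ℝ} (hd : 1 ≤ d) (hα : 0 < α) (hκ : 0 < κ)
    (hκα : κ ≤ α) (hαd : α < (d : ℝ) / 2)
    (hcase : (d = 1 ∧ α < 1 / 2 ∧ κ < 1 - 2 * α) ∨ (2 ≤ d ∧ κ < 1)) :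
    ∃ (n : ℕ → ℕ) (γ : ℕ → ℝ), (∀ N, 0 ≤ γ N) ∧
      (∀ N, ∀ k < n N, (2 : ℝ) ^ (2 * k) / (2 ^ d) ^ k ≤ γ N) ∧
      (∀ᶠ N in atTop, 2 * 2 ^ n N + 2 ≤ N) ∧
      (∀ᶠ N : ℕ in atTop, (N : ℝ) ^ (κ - 1 - 2 * α) * 4 ^ n N ≤ 1) ∧
      Tendsto (fun N : ℕ => (N : ℝ) ^ (κ - 1) * ((n N : ℝ) ^ 2 * γ N + 1)) atTop (nhds 0) ∧
      Tendsto (fun N : ℕ => (N : ℝ) ^ (κ + α) / (2 ^ d) ^ n N) atTop (nhds 0) := by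
  obtain ⟨s, hs0, hs1, hs2, hs3, hκ1, hs4⟩ := exists_dyadic_exponent hd hα hκ hκα hαd hcase
  set s' : ℝ := if d = 1 then s else 0 with hs'
  have hs'1 : s' + κ < 1 := by
    by_cases h : d = 1
    · simpa [hs', h] using hs4 h
    · simpa [hs', h] using hκ1
  set δ := (1 - κ - s') / 4 with hδ
  have hδ0 : 0 < δ := by
    rw [hδ]
    linarith
  refine ⟨dyadicScale s, fun N => if d = 1 then 2 ^ dyadicScale s N else 1, ?_, ?_, ?_, ?_, ?_, ?_⟩
  · intro N
    dsimp only
    split_ifs <;> positivity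
  · intro N k hk
    dsimp only
    split_ifs with h
    · subst h
      have h1 : (2 : ℝ) ^ (2 * k) / (2 ^ 1) ^ k = 2 ^ k := by
        rw [pow_one, two_mul, pow_add]
        field_simp
      rw [h1]
      exact pow_le_pow_right₀ (by norm_num) hk.le
    · rw [div_le_one (by positivity), ← pow_mul]
      refine pow_le_pow_right₀ (by norm_num) (Nat.mul_le_mul_right k ?_)
      omega
  · have h1 := (tendsto_natCast_rpow_of_neg (y := s - 1) (by linarith)).eventually
      (gt_mem_nhds (show (0 : ℝ) < 1 / 4 by norm_num))
    filter_upwards [h1, eventually_ge_atTop 4] with N hN1 hN4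
    have hN0 : (0 : ℝ) < N := by
      have : 0 < N := by omega
      exact_mod_cast this
    rw [Real.rpow_sub_one hN0.ne', div_lt_iff₀ hN0] at hN1
    have h2 := two_pow_dyadicScale_le hs0.le (N := N) (by omega)
    have h3 : (4 : ℝ) ≤ N := by exact_mod_cast hN4
    have h4 : (2 * 2 ^ dyadicScale s N + 2 : ℝ) ≤ N := by linarith
    exact_mod_cast h4
  · filter_upwards [eventually_ge_atTop 1] with N hN
    have hN0 : (0 : ℝ) < N := by exact_mod_cast hN
    have h1 : (4 : ℝ) ^ dyadicScale s N ≤ (N : ℝ) ^ (2 * s) := by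
      have h2 := pow_le_pow_left₀ (by positivity) (two_pow_dyadicScale_le hs0.le hN) 2
      rw [← pow_mul, mul_comm _ 2, pow_mul, ← Real.rpow_mul_natCast hN0.le] at h2
      norm_num at h2
      rwa [mul_comm]
    calc (N : ℝ) ^ (κ - 1 - 2 * α) * 4 ^ dyadicScale s N
        ≤ (N : ℝ) ^ (κ - 1 - 2 * α) * (N : ℝ) ^ (2 * s) := by gcongr
      _ = (N : ℝ) ^ (κ - 1 - 2 * α + 2 * s) := (Real.rpow_add hN0 _ _).symm
      _ ≤ 1 := Real.rpow_le_one_of_one_le_of_nonpos (by exact_mod_cast hN) (by linarith)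
  · set c := (s / (δ * Real.log 2)) ^ 2 with hc
    have h1 : Tendsto (fun N : ℕ => c * (N : ℝ) ^ (κ - 1 + 2 * δ + s') + (N : ℝ) ^ (κ - 1)) atTop
        (nhds 0) := by
      have := ((tendsto_natCast_rpow_of_neg (y := κ - 1 + 2 * δ + s')
        (by rw [hδ]; linarith)).const_mul c).add
        (tendsto_natCast_rpow_of_neg (y := κ - 1) (by linarith))
      simpa using this
    refine squeeze_zero' (Eventually.of_forall fun N => ?_) ?_ h1
    · have : (0 : ℝ) ≤ if d = 1 then 2 ^ dyadicScale s N else 1 := by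
        split_ifs <;> positivity
      positivity
    · filter_upwards [eventually_ge_atTop 1] with N hN
      have hN0 : (0 : ℝ) < N := by exact_mod_cast hN
      have h2 : (if d = 1 then (2 : ℝ) ^ dyadicScale s N else 1) ≤ (N : ℝ) ^ s' := by
        by_cases h : d = 1
        · simpa [hs', h] using two_pow_dyadicScale_le hs0.le hN
        · simp [hs', h]
      have h3 : (dyadicScale s N : ℝ) ^ 2 ≤ c * (N : ℝ) ^ (2 * δ) := by
        have := pow_le_pow_left₀ (by positivity) (dyadicScale_le hs0.le hδ0 hN) 2
        rw [mul_pow, ← Real.rpow_mul_natCast hN0.le] at this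
        refine this.trans (le_of_eq ?_)
        rw [hc, Nat.cast_ofNat, mul_comm 2 δ]
      have hc0 : 0 ≤ c := sq_nonneg _
      have h4 : (0 : ℝ) ≤ if d = 1 then 2 ^ dyadicScale s N else 1 := by
        split_ifs <;> positivity
      calc _ ≤ (N : ℝ) ^ (κ - 1) * (c * (N : ℝ) ^ (2 * δ) * (N : ℝ) ^ s' + 1) := by gcongr
        _ = _ := by
          rw [Real.rpow_add hN0, Real.rpow_add hN0]
          ring
  · have h1 : Tendsto (fun N : ℕ => (2 : ℝ) ^ d * (N : ℝ) ^ (κ + α - d * s)) atTop (nhds 0) := by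
      simpa using (tendsto_natCast_rpow_of_neg (y := κ + α - d * s) (by linarith)).const_mul
        ((2 : ℝ) ^ d)
    refine squeeze_zero' (Eventually.of_forall fun N => by positivity) ?_ h1
    filter_upwards [eventually_ge_atTop 1] with N hN
    have hN0 : (0 : ℝ) < N := by exact_mod_cast hN
    have h2 := pow_le_pow_left₀ (by positivity)
      (rpow_le_two_mul_two_pow_dyadicScale (s := s) (N := N)) d
    rw [mul_pow, ← pow_mul, mul_comm (dyadicScale s N), pow_mul,
      ← Real.rpow_mul_natCast hN0.le, mul_comm s] at h2
    rw [div_le_iff₀ (by positivity), Real.rpow_sub hN0]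
    have h3 : 0 < (N : ℝ) ^ ((d : ℝ) * s) := by positivity
    have h4 : 0 < (N : ℝ) ^ (κ + α) := by positivity
    calc (N : ℝ) ^ (κ + α)
        = (N : ℝ) ^ (κ + α) / (N : ℝ) ^ ((d : ℝ) * s) * (N : ℝ) ^ ((d : ℝ) * s) := by field_simp
      _ ≤ (N : ℝ) ^ (κ + α) / (N : ℝ) ^ ((d : ℝ) * s)
          * (2 ^ d * (2 ^ d) ^ dyadicScale s N) := by gcongr
      _ = _ := by ring

theorem tendsto_relEnt_profileGE {d K : ℕ} (hd : 1 ≤ d) (hK : 1 ≤ K)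
    {p : Fin d → Bool → ℝ} (hp : ∀ i b, 0 ≤ p i b) (hpd : ∀ i, 0 < p i true + p i false)
    {ϱs : ℝ} (hϱs : ϱs ∈ Set.Ioo (0 : ℝ) (K : ℝ))
    {α κ T : ℝ} (hα : 0 < α) (hκ : 0 < κ) (hκα : κ ≤ α) (hαd : α < (d : ℝ) / 2)
    {ρ : ℝ → (Fin d → ℝ) → ℝ}
    (hρsmooth : ContDiff ℝ (⊤ : ℕ∞) (fun q : ℝ × (Fin d → ℝ) => ρ q.1 q.2))
    (hρper : ∀ (s : ℝ) (u : Fin d → ℝ) (z : Fin d → ℤ), ρ s (fun j => u j + z j) = ρ s u)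
    (hρpde : ∀ s ∈ Set.Icc (0 : ℝ) T, ∀ u : Fin d → ℝ,
      deriv (fun s' => ρ s' u) s
        = ∑ i, (p i true - p i false)
            * deriv (fun h => ρ s (Function.update u i h) ^ 2) (u i))
    {μ : (N : ℕ) → ℝ → GCfg N d K → ℝ}
    (hμprob : ∀ (N : ℕ) (t : ℝ), 0 ≤ t → (∀ η, 0 ≤ μ N t η) ∧ ∑ η, μ N t η = 1)
    (hkolm : ∀ (N : ℕ), 1 ≤ N → ∀ (f : GCfg N d K → ℝ) (t : ℝ), 0 ≤ t →
      HasDerivAt (fun s => ∑ η, f η * μ N s η)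
        ((N : ℝ) ^ ((1 : ℝ) + κ) * ∑ η, genL p f η * μ N t η) t)
    (h0 : Tendsto (fun N : ℕ => (N : ℝ) ^ (2 * α - (d : ℝ)) * relEnt (μ N 0)
      (prodBinom fun x : Site N d =>
        profileGE d K ϱs α κ (fun i => p i true - p i false) ρ N 0 (siteCoord x))) atTop (nhds 0))
    (hcase : (d = 1 ∧ α < 1 / 2 ∧ κ < 1 - 2 * α) ∨ (2 ≤ d ∧ κ < 1))
    {t : ℝ} (ht : t ∈ Set.Icc (0 : ℝ) T) :
    Tendsto (fun N : ℕ => (N : ℝ) ^ (2 * α - (d : ℝ)) * relEnt (μ N t)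
      (prodBinom fun x : Site N d =>
        profileGE d K ϱs α κ (fun i => p i true - p i false) ρ N t (siteCoord x))) atTop
      (nhds 0) := by
  obtain ⟨n, γ, hγ0, hγ, hnN, hn4, hn2, hnd⟩ := exists_dyadic_scale hd hα hκ hκα hαd hcase
  obtain ⟨D, hD0, hD⟩ := exists_profileGE_bounds (K := K) (ϱs := ϱs) hp hα hκα hρsmooth hρper hρpde
  set c₀ := min ϱs (K - ϱs) / 2 with hc₀
  have hc₀0 : 0 < c₀ := half_pos (lt_min hϱs.1 (sub_pos.2 hϱs.2))
  have hc1 : 2 * c₀ ≤ ϱs := by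
    rw [hc₀]
    linarith [min_le_left ϱs (K - ϱs)]
  have hc2 : 2 * c₀ ≤ K - ϱs := by
    rw [hc₀]
    linarith [min_le_right ϱs (K - ϱs)]
  obtain ⟨C, hC0, hC⟩ := exists_entropy_production_le (d := d) hK hp hpd hc₀0
  set A := C * (1 + D + D ^ 2) with hA
  have hA0 : 0 < A := by positivity
  set e : ℕ → ℝ := fun N => (D * (N : ℝ) ^ (κ - 1 - α)) ^ 2
    + D ^ 2 * (N : ℝ) ^ (κ - 1 - 2 * α) * ((n N : ℝ) ^ 2 * γ N + 1)
    + D * (N : ℝ) ^ (κ - α) / (2 ^ d) ^ n N with he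
  have he0 : ∀ N, 0 ≤ e N := fun N => by
    have := hγ0 N
    simp only [he]
    positivity
  have hκ1 : κ < 1 := by
    rcases hcase with ⟨_, _, h⟩ | ⟨_, h⟩ <;> linarith
  have heN : Tendsto (fun N : ℕ => (N : ℝ) ^ (2 * α) * e N) atTop (nhds 0) := by
    have h1 := (((tendsto_natCast_rpow_of_neg (y := 2 * κ - 2) (by linarith)).const_mul
      (D ^ 2)).add (hn2.const_mul (D ^ 2))).add (hnd.const_mul D)
    simp only [mul_zero, add_zero] at h1
    refine h1.congr' ?_
    filter_upwards [eventually_ge_atTop 1] with N hN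
    have hN0 : (0 : ℝ) < N := by exact_mod_cast hN
    have e1 : (N : ℝ) ^ (2 * κ - 2) = (N : ℝ) ^ (2 * α) * ((N : ℝ) ^ (κ - 1 - α)) ^ 2 := by
      rw [← Real.rpow_mul_natCast hN0.le, ← Real.rpow_add hN0]
      congr 1
      push_cast
      ring
    have e2 : (N : ℝ) ^ (κ - 1) = (N : ℝ) ^ (2 * α) * (N : ℝ) ^ (κ - 1 - 2 * α) := by
      rw [← Real.rpow_add hN0]
      congr 1
      ring
    have e3 : (N : ℝ) ^ (κ + α) = (N : ℝ) ^ (2 * α) * (N : ℝ) ^ (κ - α) := by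
      rw [← Real.rpow_add hN0]
      congr 1
      ring
    rw [e1, e2, e3]
    simp only [he]
    ring
  have hsmall := (tendsto_natCast_rpow_of_neg (y := -α) (by linarith)).eventually
    (gt_mem_nhds (div_pos hc₀0 hD0))
  have hlim : Tendsto (fun N : ℕ => Real.exp (A * t) * ((N : ℝ) ^ (2 * α - (d : ℝ))
      * relEnt (μ N 0) (prodBinom fun x : Site N d =>
        profileGE d K ϱs α κ (fun i => p i true - p i false) ρ N 0 (siteCoord x))
      + C * ((N : ℝ) ^ (2 * α) * e N) / A)) atTop (nhds 0) := by
    have := (h0.add ((heN.const_mul C).div_const A)).const_mul (Real.exp (A * t))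
    simpa using this
  have hmain : ∀ᶠ N : ℕ in atTop,
      0 ≤ relEnt (μ N t) (prodBinom fun x : Site N d =>
        profileGE d K ϱs α κ (fun i => p i true - p i false) ρ N t (siteCoord x)) ∧
      relEnt (μ N t) (prodBinom fun x : Site N d =>
        profileGE d K ϱs α κ (fun i => p i true - p i false) ρ N t (siteCoord x))
      ≤ Real.exp (A * t) * (relEnt (μ N 0) (prodBinom fun x : Site N d =>
        profileGE d K ϱs α κ (fun i => p i true - p i false) ρ N 0 (siteCoord x))
        + C * ((N : ℝ) ^ d * e N) / A) := by
    filter_upwards [hnN, hn4, hsmall, eventually_ge_atTop 2] with N hN1 hN2 hN3 hN4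
    have : NeZero N := ⟨by omega⟩
    have hN0 : (0 : ℝ) < N := by
      have : 0 < N := by omega
      exact_mod_cast this
    obtain ⟨ad, had⟩ := hD N
    set a : ℝ → Site N d → ℝ := fun s x =>
      profileGE d K ϱs α κ (fun i => p i true - p i false) ρ N s (siteCoord x) with ha
    have hab : ∀ s ∈ Set.Icc (0 : ℝ) T, ∀ x, c₀ ≤ a s x ∧ a s x ≤ K - c₀ := by
      intro s hs x
      have h1 := (had s hs x).2.1
      rw [lt_div_iff₀ hD0, mul_comm] at hN3
      have h2 := abs_le.1 (h1.trans hN3.le)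
      constructor
      · have := h2.1
        simp only [ha]
        linarith
      · have := h2.2
        simp only [ha]
        linarith
    have hpos : ∀ s ∈ Set.Icc (0 : ℝ) T, ∀ x, 0 < a s x := fun s hs x =>
      hc₀0.trans_le (hab s hs x).1
    have hlt : ∀ s ∈ Set.Icc (0 : ℝ) T, ∀ x, a s x < K := fun s hs x => by
      linarith [(hab s hs x).2]
    set Γ := (N : ℝ) ^ ((1 : ℝ) + κ) with hΓ
    have hη0 : 0 < D * (N : ℝ) ^ (-1 - α) := by positivity
    have e1 : Γ * (D * (N : ℝ) ^ (-1 - α)) = D * (N : ℝ) ^ (κ - α) := by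
      rw [hΓ, show κ - α = (1 + κ) + (-1 - α) by ring,
        Real.rpow_add hN0 (1 + κ)]
      ring
    have e2 : Γ * (D * (N : ℝ) ^ (-1 - α)) ^ 2 = D ^ 2 * (N : ℝ) ^ (κ - 1 - 2 * α) := by
      rw [hΓ, show κ - 1 - 2 * α = (1 + κ) + (-1 - α) + (-1 - α) by ring,
        Real.rpow_add hN0 (1 + κ + (-1 - α)), Real.rpow_add hN0 (1 + κ)]
      ring
    have h1 : (N : ℝ) ^ (κ - α) ≤ 1 := Real.rpow_le_one_of_one_le_of_nonpos
      (by exact_mod_cast (by omega : 1 ≤ N)) (by linarith)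
    have hA1 : C * (1 + Γ * (D * (N : ℝ) ^ (-1 - α))
        + Γ * (D * (N : ℝ) ^ (-1 - α)) ^ 2 * 4 ^ n N) ≤ A := by
      rw [e1, e2, hA, mul_assoc (D ^ 2)]
      have h3 : D * (N : ℝ) ^ (κ - α) ≤ D := mul_le_of_le_one_right hD0.le h1
      have h4 : D ^ 2 * ((N : ℝ) ^ (κ - 1 - 2 * α) * 4 ^ n N) ≤ D ^ 2 :=
        mul_le_of_le_one_right (by positivity) hN2
      gcongr
    have hE0 : 0 ≤ C * ((N : ℝ) ^ d * e N) := by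
      have := he0 N
      positivity
    refine ⟨relEnt_nonneg (prodBinom_pos (hpos t ht) (hlt t ht)) (sum_prodBinom _)
      (hμprob N t ht.1).1 (hμprob N t ht.1).2, ?_⟩
    refine relEnt_le_of_kolmogorov hN4 (T := T) (Γ := Γ) (μ := μ N) (a := a) (ad := ad) hK hA0 hE0
      (hμprob N) (hkolm N (by omega)) (fun s hs x => (had s hs x).1) hpos hlt
      (fun s hs f hf hf1 => ?_) t ht
    have h5 := hC N (n N) (γ N) (D * (N : ℝ) ^ (-1 - α)) (D * (N : ℝ) ^ (κ - 1 - α)) Γ (a s) (ad s)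
      f hN1 (hγ N) (hγ0 N) hη0 (by positivity) (fun x => (hab s hs x).1)
      (fun x => (hab s hs x).2) (fun x i => (had s hs x).2.2.1 i)
      (fun x => (had s hs x).2.2.2) hf hf1
    have h6 : 0 ≤ relEnt (fun η => prodBinom (a s) η * f η) (prodBinom (a s)) :=
      relEnt_nonneg (prodBinom_pos (hpos s hs) (hlt s hs)) (sum_prodBinom _)
        (fun η => (mul_pos (prodBinom_pos (hpos s hs) (hlt s hs) η) (hf η)).le) hf1
    refine h5.trans ?_
    rw [mul_add, ← mul_assoc]
    refine add_le_add (mul_le_mul_of_nonneg_right hA1 h6) (le_of_eq ?_)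
    rw [e1, e2]
  refine squeeze_zero' ?_ ?_ hlim
  · filter_upwards [hmain] with N hN
    exact mul_nonneg (by positivity) hN.1
  · filter_upwards [hmain, eventually_ge_atTop 1] with N hN hN1
    have hN0 : (0 : ℝ) < N := by exact_mod_cast hN1
    refine (mul_le_mul_of_nonneg_left hN.2 (by positivity :
      (0 : ℝ) ≤ (N : ℝ) ^ (2 * α - (d : ℝ)))).trans (le_of_eq ?_)
    have e1 : (N : ℝ) ^ (2 * α) = (N : ℝ) ^ (2 * α - (d : ℝ)) * (N : ℝ) ^ d := by
      rw [← Real.rpow_natCast, ← Real.rpow_add hN0]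
      congr 1
      ring
    rw [e1]
    ring

theorem eventually_abs_sub_lt_of_periodic {d : ℕ} {E : Type*} [TopologicalSpace E]
    {F : E × (Fin d → ℝ) → ℝ} (hF : Continuous F)
    (hper : ∀ (e : E) (u : Fin d → ℝ) (z : Fin d → ℤ), F (e, fun j => u j + z j) = F (e, u))
    (e₀ : E) {ε : ℝ} (hε : 0 < ε) :
    ∀ᶠ e in nhds e₀, ∀ u, |F (e, u) - F (e₀, u)| < ε := by
  have h1 : ∀ᶠ e in nhds e₀, ∀ u ∈ Set.Icc (0 : Fin d → ℝ) 1, |F (e, u) - F (e₀, u)| < ε := by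
    refine isCompact_Icc.eventually_forall_of_forall_eventually fun u _ => ?_
    have hc : Continuous fun q : E × (Fin d → ℝ) => |F (q.1, q.2) - F (e₀, q.2)| := by fun_prop
    exact hc.continuousAt.eventually (gt_mem_nhds (by simpa using hε))
  filter_upwards [h1] with e he u
  have h2 := fun e => hper e (fun j => Int.fract (u j)) (fun j => ⌊u j⌋)
  simp only [Int.fract_add_floor] at h2
  rw [h2, h2]
  exact he _ ⟨fun j => Int.fract_nonneg _, fun j => (Int.fract_lt_one _).le⟩

theorem setIntegral_unitCube_comp_add {d : ℕ} {g : (Fin d → ℝ) → ℝ}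
    (hper : ∀ (u : Fin d → ℝ) (z : Fin d → ℤ), g (fun j => u j + z j) = g u) (c : Fin d → ℝ) :
    ∫ u in Set.Icc (0 : Fin d → ℝ) 1, g (c + u) = ∫ u in Set.Icc (0 : Fin d → ℝ) 1, g u := by
  have hI : (Set.pi Set.univ fun _ : Fin d => Set.Ico (0 : ℝ) 1)
      =ᵐ[MeasureTheory.volume] Set.Icc (0 : Fin d → ℝ) 1 :=
    MeasureTheory.Measure.univ_pi_Ico_ae_eq_Icc
  have : Countable (Submodule.span ℤ (Set.range (Pi.basisFun ℝ (Fin d)))).toAddSubgroup :=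
    inferInstanceAs (Countable (Submodule.span ℤ (Set.range (Pi.basisFun ℝ (Fin d)))))
  have hD := ZSpan.isAddFundamentalDomain' (Pi.basisFun ℝ (Fin d)) MeasureTheory.volume
  rw [ZSpan.fundamentalDomain_pi_basisFun] at hD
  rw [← MeasureTheory.setIntegral_congr_set hI, ← MeasureTheory.setIntegral_congr_set hI,
    hD.setIntegral_eq (hD.vadd_of_comm c) (f := g)]
  · rw [← Set.image_vadd]
    exact ((MeasureTheory.measurePreserving_add_left MeasureTheory.volume c).setIntegral_image_emb
      (measurableEmbedding_addLeft c) g _).symm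
  · rintro ⟨z, hz⟩ x
    obtain ⟨k, hk⟩ : ∃ k : Fin d → ℤ, ∀ j, (k j : ℝ) = z j := by
      have h := ((Pi.basisFun ℝ (Fin d)).mem_span_iff_repr_mem ℤ z).1 hz
      choose k hk using h
      exact ⟨k, fun j => by simpa using hk j⟩
    rw [← hper x k]
    congr 1
    funext j
    rw [hk, add_comm]
    rfl

theorem tendsto_riemann_sum {d : ℕ} {g : (Fin d → ℝ) → ℝ} (hg : Continuous g)
    (hper : ∀ (u : Fin d → ℝ) (z : Fin d → ℤ), g (fun j => u j + z j) = g u)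
    (w : ℕ → Fin d → ℝ) :
    Tendsto (fun N : ℕ => ((N : ℝ) ^ d)⁻¹ * ∑ x : Site N d, g (siteCoord x + w N)) atTop
      (nhds (∫ u in Set.Icc (0 : Fin d → ℝ) 1, g u)) := by
  classical
  rw [Metric.tendsto_atTop]
  intro ε hε
  have hF : Continuous fun q : (Fin d → ℝ) × (Fin d → ℝ) => g (q.2 + q.1) := by fun_prop
  obtain ⟨δ, hδ, hball⟩ := Metric.eventually_nhds_iff.1 (eventually_abs_sub_lt_of_periodic hF
    (fun e u z => by
      rw [← hper (u + e) z]
      congr 1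
      funext j
      simp only [Pi.add_apply]
      ring) 0 (half_pos hε))
  obtain ⟨N₀, hN₀⟩ := exists_nat_gt (1 / δ)
  refine ⟨N₀ + 1, fun N hN => ?_⟩
  have : NeZero N := ⟨by omega⟩
  have hN0 : (0 : ℝ) < N := Nat.cast_pos.2 (NeZero.pos N)
  have hNd : (0 : ℝ) < (N : ℝ) ^ d := by positivity
  have hNδ : 1 / (N : ℝ) < δ := by
    have : (N₀ : ℝ) ≤ N := by exact_mod_cast (by omega : N₀ ≤ N)
    rw [div_lt_iff₀ hN0]
    rw [div_lt_iff₀ hδ] at hN₀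
    nlinarith
  set G : (Fin d → ℝ) → ℝ := fun v => ∑ x : Site N d, g (siteCoord x + v) with hG
  have hGc : Continuous G := continuous_finsetSum _ fun x _ => by fun_prop
  have hcard : ((Finset.univ : Finset (Site N d)).card : ℝ) = (N : ℝ) ^ d := by
    simp
  have hGper : ∀ i, Function.Periodic G (((1 : ℝ) / N) • (Pi.single i 1 : Fin d → ℝ)) := by
    intro i v
    simp only [hG]
    rw [← Equiv.sum_comp (Equiv.addRight (Pi.single i 1 : Site N d))
      (fun x => g (siteCoord x + v))]
    refine Finset.sum_congr rfl fun x _ => ?_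
    obtain ⟨z, hz⟩ := exists_siteCoord_add x i
    rw [Equiv.coe_addRight, hz]
    refine (hper _ z).symm.trans ?_
    congr 1
    funext j
    simp only [Pi.add_apply]
    ring
  have hGosc : ∀ v v', |G v - G v'| ≤ (N : ℝ) ^ d * (ε / 2) := by
    intro v v'
    set k : Fin d → ℤ := fun j => ⌊N * (v j - v' j)⌋ with hk
    set s : Fin d → ℝ := fun j => k j * (1 / N) with hs
    have h1 : ∀ t : Finset (Fin d), Function.Periodic G
        (∑ j ∈ t, k j • (((1 : ℝ) / N) • (Pi.single j 1 : Fin d → ℝ))) := by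
      intro t
      induction t using Finset.induction_on with
      | empty => simp [Function.Periodic]
      | insert j t hj ih =>
        rw [Finset.sum_insert hj]
        exact ((hGper j).zsmul _).add_period ih
    have h2 : ∑ j, k j • (((1 : ℝ) / N) • (Pi.single j 1 : Fin d → ℝ)) = s := by
      funext j
      simp [Finset.sum_apply, Pi.single_apply, hs, mul_comm]
    have h3 := h1 Finset.univ v'
    rw [h2] at h3
    have h4 : dist (v - (v' + s)) 0 < δ := by
      rw [dist_zero_right]
      refine lt_of_le_of_lt ((pi_norm_le_iff_of_nonneg (by positivity)).2 fun j => ?_) hNδ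
      have h5 : (v - (v' + s)) j = Int.fract (N * (v j - v' j)) * (1 / N) := by
        simp only [Int.fract, Pi.sub_apply, Pi.add_apply, hs, hk]
        field_simp
        ring
      rw [h5, Real.norm_eq_abs, abs_of_nonneg (mul_nonneg (Int.fract_nonneg _) (by positivity))]
      exact mul_le_of_le_one_left (by positivity) (Int.fract_lt_one _).le
    have h6 := hball h4
    rw [← h3, ← hcard, ← nsmul_eq_mul]
    simp only [hG]
    rw [← Finset.sum_sub_distrib]
    refine (Finset.abs_sum_le_sum_abs _ _).trans (Finset.sum_le_card_nsmul _ _ _ fun x _ => ?_)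
    have h7 := h6 (siteCoord x + (v' + s))
    rw [add_zero, add_add_sub_cancel] at h7
    exact h7.le
  have hvol : MeasureTheory.volume.real (Set.Icc (0 : Fin d → ℝ) 1) = 1 := by
    simp [MeasureTheory.measureReal_def, Real.volume_Icc_pi]
  have hIntg : ∀ f : (Fin d → ℝ) → ℝ, Continuous f →
      MeasureTheory.IntegrableOn f (Set.Icc (0 : Fin d → ℝ) 1) MeasureTheory.volume :=
    fun f hf => hf.continuousOn.integrableOn_compact isCompact_Icc
  have hGint : ∫ v in Set.Icc (0 : Fin d → ℝ) 1, G v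
      = (N : ℝ) ^ d * ∫ u in Set.Icc (0 : Fin d → ℝ) 1, g u := by
    simp only [hG]
    rw [MeasureTheory.integral_finsetSum _ fun x _ => hIntg _ (by fun_prop)]
    simp only [setIntegral_unitCube_comp_add hper]
    rw [Finset.sum_const, nsmul_eq_mul, hcard]
  have hmain : |G (w N) - (N : ℝ) ^ d * ∫ u in Set.Icc (0 : Fin d → ℝ) 1, g u|
      ≤ (N : ℝ) ^ d * (ε / 2) := by
    have h1 : ∫ v in Set.Icc (0 : Fin d → ℝ) 1, (G (w N) - G v)
        = G (w N) - (N : ℝ) ^ d * ∫ u in Set.Icc (0 : Fin d → ℝ) 1, g u := by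
      rw [MeasureTheory.integral_sub (hIntg _ continuous_const) (hIntg _ hGc), hGint,
        MeasureTheory.setIntegral_const, hvol, one_smul]
    have h2 := MeasureTheory.norm_setIntegral_le_of_norm_le_const
      (μ := MeasureTheory.volume) (s := Set.Icc (0 : Fin d → ℝ) 1) (f := fun v => G (w N) - G v)
      (C := (N : ℝ) ^ d * (ε / 2)) isCompact_Icc.measure_lt_top (fun v _ => hGosc (w N) v)
    rwa [h1, hvol, mul_one, Real.norm_eq_abs] at h2
  rw [Real.dist_eq]
  have e1 : ((N : ℝ) ^ d)⁻¹ * G (w N) - ∫ u in Set.Icc (0 : Fin d → ℝ) 1, g u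
      = ((N : ℝ) ^ d)⁻¹ * (G (w N) - (N : ℝ) ^ d * ∫ u in Set.Icc (0 : Fin d → ℝ) 1, g u) := by
    rw [mul_sub, inv_mul_cancel_left₀ hNd.ne']
  rw [e1, abs_mul, abs_of_pos (inv_pos.2 hNd), inv_mul_lt_iff₀ hNd]
  exact hmain.trans_lt (mul_lt_mul_of_pos_left (half_lt_self hε) hNd)

theorem tendsto_riemann_sum_of_tendsto {d : ℕ} {F : ℝ × (Fin d → ℝ) → ℝ} (hF : Continuous F)
    (hper : ∀ (s : ℝ) (u : Fin d → ℝ) (z : Fin d → ℤ), F (s, fun j => u j + z j) = F (s, u))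
    {σ : ℕ → ℝ} {s : ℝ} (hσ : Tendsto σ atTop (nhds s)) (w : ℕ → Fin d → ℝ) :
    Tendsto (fun N : ℕ => ((N : ℝ) ^ d)⁻¹ * ∑ x : Site N d, F (σ N, siteCoord x + w N)) atTop
      (nhds (∫ u in Set.Icc (0 : Fin d → ℝ) 1, F (s, u))) := by
  have h1 := tendsto_riemann_sum (g := fun u => F (s, u)) (by fun_prop) (hper s) w
  refine h1.congr_dist ?_
  rw [Metric.tendsto_atTop]
  intro ε hε
  obtain ⟨N₀, hN₀⟩ := eventually_atTop.1
    (hσ.eventually (eventually_abs_sub_lt_of_periodic hF hper s (half_pos hε)))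
  refine ⟨N₀ + 1, fun N hN => ?_⟩
  have hN0 : (0 : ℝ) < N := by
    have : 0 < N := by omega
    exact_mod_cast this
  have hNd : (0 : ℝ) < (N : ℝ) ^ d := by positivity
  have hcard : ((Finset.univ : Finset (Site N d)).card : ℝ) = (N : ℝ) ^ d := by simp
  rw [Real.dist_eq, sub_zero, abs_of_nonneg dist_nonneg, Real.dist_eq, abs_sub_comm, ← mul_sub,
    ← Finset.sum_sub_distrib, abs_mul, abs_of_pos (inv_pos.2 hNd)]
  refine lt_of_le_of_lt ?_ (half_lt_self hε)
  rw [inv_mul_le_iff₀ hNd, ← hcard, ← nsmul_eq_mul]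
  exact (Finset.abs_sum_le_sum_abs _ _).trans
    (Finset.sum_le_card_nsmul _ _ _ fun x _ => (hN₀ N (by omega) _).le)

theorem sum_filter_lt_abs_le {Ω : Type*} [Fintype Ω] {μ : Ω → ℝ} (hμ : ∀ η, 0 ≤ μ η)
    (X : Ω → ℝ) {δ : ℝ} (hδ : 0 < δ) [DecidablePred fun η => δ < |X η|] :
    ∑ η ∈ Finset.univ.filter (fun η => δ < |X η|), μ η ≤ (∑ η, μ η * X η ^ 2) / δ ^ 2 := by
  rw [le_div_iff₀ (by positivity), Finset.sum_mul, Finset.sum_filter]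
  refine Finset.sum_le_sum fun η _ => ?_
  split_ifs with h
  · refine mul_le_mul_of_nonneg_left ?_ (hμ η)
    rw [← sq_abs (X η)]
    exact pow_le_pow_left₀ hδ.le h.le 2
  · exact mul_nonneg (hμ η) (sq_nonneg _)

/-- Second moment bound for a linear statistic of the centred occupation variables. -/
theorem sum_mul_sq_field_le {N d K : ℕ} [NeZero N] (hK : 1 ≤ K) {a : Site N d → ℝ} {c₀ : ℝ}
    (hc : 0 < c₀) (h0 : ∀ x, c₀ ≤ a x) (h1 : ∀ x, a x ≤ K - c₀) {μ : GCfg N d K → ℝ}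
    (hμ : ∀ η, 0 ≤ μ η) (hμ1 : ∑ η, μ η = 1) {b : Site N d → ℝ} {M : ℝ} (hM : 0 < M)
    (hb : ∀ x, |b x| ≤ M) :
    ∑ η, μ η * (∑ x, (((η x).val : ℝ) - a x) * b x) ^ 2
      ≤ 4 * (K / c₀ ^ 2) ^ 2 * (K ^ 2 * M) ^ 2 * ((N : ℝ) ^ d * (relEnt μ (prodBinom a) + 1)) := by
  have hK0 : (0 : ℝ) < K := by positivity
  have ha0 : ∀ x, 0 < a x := fun x => hc.trans_le (h0 x)
  have ha1 : ∀ x, a x < K := fun x => by linarith [h1 x]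
  have hN0 : (0 : ℝ) < N := Nat.cast_pos.2 (NeZero.pos N)
  set C : Unit → Site N d → ℝ := fun _ x => a x * (K - a x) * b x with hC
  have hCsq : ∑ x, C () x ^ 2 ≤ (N : ℝ) ^ d * (K ^ 2 * M) ^ 2 := by
    have hcard : ((Finset.univ : Finset (Site N d)).card : ℝ) = (N : ℝ) ^ d := by simp
    rw [← hcard, ← nsmul_eq_mul]
    refine Finset.sum_le_card_nsmul _ _ _ fun x _ => ?_
    rw [← sq_abs]
    refine pow_le_pow_left₀ (abs_nonneg _) ?_ 2
    have h2 := ha0 x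
    have h3 : 0 < K - a x := sub_pos.2 (ha1 x)
    simp only [hC]
    rw [abs_mul, abs_of_pos (mul_pos h2 h3), sq]
    exact mul_le_mul (mul_le_mul (ha1 x).le (by linarith) h3.le hK0.le) (hb x) (abs_nonneg _)
      (by positivity)
  have h := sum_quadratic_le_relEnt (prodBinom_pos ha0 ha1) hμ hμ1
    (S := (K / c₀ ^ 2) ^ 2) (by positivity) (isSubGauss_omVar hK hc h0 h1) C
    (B := (N : ℝ) ^ d * (K ^ 2 * M) ^ 2) (by positivity) (fun v => by
      rw [Fintype.sum_unique]
      exact (Finset.sum_mul_sq_le_sq_mul_sq _ _ _).trans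
        (mul_le_mul_of_nonneg_right hCsq (Finset.sum_nonneg fun x _ => sq_nonneg _)))
  simp only [Fintype.sum_unique] at h
  have e : ∀ η : GCfg N d K, ∑ x, C () x * omVar a η x
      = ∑ x, (((η x).val : ℝ) - a x) * b x := fun η => Finset.sum_congr rfl fun x _ => by
    have h2 := (ha0 x).ne'
    have h3 : K - a x ≠ 0 := (sub_pos.2 (ha1 x)).ne'
    simp only [hC, omVar]
    field_simp
  change ∑ η, μ η * (∑ x, C () x * omVar a η x) ^ 2 ≤ _ at h
  simp only [e] at h
  refine h.trans ?_
  have h4 : 0 ≤ 4 * (K / c₀ ^ 2) ^ 2 := by positivity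
  refine (mul_le_mul_of_nonneg_left (add_le_add_right hCsq _) h4).trans (le_of_eq ?_)
  ring

open MeasureTheory in
/-- Law of large numbers for the perturbed density field of the generalized exclusion
process (Theorem `coro1`): under the hypotheses of the relative entropy estimate and
`α < d/2`, for every `t ∈ [0,T]`, continuous `ℤ^d`-periodic `φ` and `ε > 0`, the
`μ_{N,t}`-probability that
`| N^{α−d} Σ_x (η_x − ϱ*) φ(x/N − N^κ λ t m) − ∫_{𝕋^d} ρ^{(α,κ)}(t,u) φ(u) du | > ε`
tends to `0` as `N → ∞`, where `ρ^{(α,κ)} = ρ` if `κ = α` and `= ρ^ini` if `κ < α`. -/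
theorem statement1 (d K : ℕ) (hd : 1 ≤ d) (hK : 1 ≤ K)
    (p : Fin d → Bool → ℝ) (hp : ∀ i b, 0 ≤ p i b)
    (hpd : ∀ i, 0 < p i true + p i false)
    (hm : (fun i => p i true - p i false) ≠ (0 : Fin d → ℝ))
    (ϱs : ℝ) (hϱs : ϱs ∈ Set.Ioo (0 : ℝ) (K : ℝ))
    (α κ T : ℝ) (hα : 0 < α) (hκ : 0 < κ) (hκα : κ ≤ α) (hT : 0 < T)
    (hαd : α < (d : ℝ) / 2)
    (ρini : (Fin d → ℝ) → ℝ) (ρ : ℝ → (Fin d → ℝ) → ℝ)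
    (hρ0 : ∀ u, ρ 0 u = ρini u)
    (hρsmooth : ContDiff ℝ (⊤ : ℕ∞) (fun q : ℝ × (Fin d → ℝ) => ρ q.1 q.2))
    (hρper : ∀ (s : ℝ) (u : Fin d → ℝ) (z : Fin d → ℤ),
      ρ s (fun j => u j + z j) = ρ s u)
    (hρpde : ∀ s ∈ Set.Icc (0 : ℝ) T, ∀ u : Fin d → ℝ,
      deriv (fun s' => ρ s' u) s
        = ∑ i, (p i true - p i false)
            * deriv (fun h => ρ s (Function.update u i h) ^ 2) (u i))
    (μ : (N : ℕ) → ℝ → GCfg N d K → ℝ)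
    (hμprob : ∀ (N : ℕ) (t : ℝ), 0 ≤ t → (∀ η, 0 ≤ μ N t η) ∧ ∑ η, μ N t η = 1)
    (hkolm : ∀ (N : ℕ), 1 ≤ N → ∀ (f : GCfg N d K → ℝ) (t : ℝ), 0 ≤ t →
      HasDerivAt (fun s => ∑ η, f η * μ N s η)
        ((N : ℝ) ^ ((1 : ℝ) + κ) * ∑ η, genL p f η * μ N t η) t)
    (HN : ℕ → ℝ → ℝ)
    (hHN : ∀ (N : ℕ) (t : ℝ), HN N t = relEnt (μ N t)
      (prodBinom fun x : Site N d =>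
        profileGE d K ϱs α κ (fun i => p i true - p i false) ρ N t (siteCoord x)))
    (h0 : Tendsto (fun N : ℕ => (N : ℝ) ^ (2 * α - (d : ℝ)) * HN N 0) atTop (nhds 0))
    (hcase : (d = 1 ∧ α < 1 / 2 ∧ κ < 1 - 2 * α) ∨ (2 ≤ d ∧ κ < 1)) :
    ∀ t ∈ Set.Icc (0 : ℝ) T, ∀ φ : (Fin d → ℝ) → ℝ, Continuous φ →
      (∀ (u : Fin d → ℝ) (z : Fin d → ℤ), φ (fun j => u j + z j) = φ u) →
      ∀ ε : ℝ, 0 < ε →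
      Tendsto (fun N : ℕ =>
          ∑ η ∈ Finset.univ.filter (fun η : GCfg N d K =>
            ε < |(N : ℝ) ^ (α - (d : ℝ)) *
                ∑ x : Site N d, (((η x).val : ℝ) - ϱs) *
                  φ (fun j => (x j : ℝ) / N
                    - (N : ℝ) ^ κ * ((K : ℝ) - 2 * ϱs) * t * (p j true - p j false))
              - ∫ u in Set.Icc (0 : Fin d → ℝ) 1,
                  (if κ = α then ρ t u else ρini u) * φ u|),
            μ N t η)
        atTop (nhds 0) := by
  intro t ht φ hφ hφper ε hε
  classical
  simp only [hHN] at h0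
  have hH := tendsto_relEnt_profileGE hd hK hp hpd hϱs hα hκ hκα hαd hρsmooth hρper hρpde hμprob
    hkolm h0 hcase ht
  obtain ⟨D, hD0, hD⟩ := exists_profileGE_bounds (K := K) (ϱs := ϱs) hp hα hκα hρsmooth hρper hρpde
  obtain ⟨M₀, hM₀, hφb⟩ := exists_bound_of_periodic
    (F := fun q : ℝ × (Fin d → ℝ) => φ q.2) (by fun_prop) (fun _ => hφper) 0
  set M := M₀ + 1 with hM
  have hM0 : 0 < M := by positivity
  have hφM : ∀ u, |φ u| ≤ M := fun u =>
    (hφb 0 (Set.left_mem_Icc.2 le_rfl) u).trans (by linarith)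
  set c₀ := min ϱs (K - ϱs) / 2 with hc₀
  have hc₀0 : 0 < c₀ := half_pos (lt_min hϱs.1 (sub_pos.2 hϱs.2))
  have hc1 : 2 * c₀ ≤ ϱs := by
    rw [hc₀]
    linarith [min_le_left ϱs (K - ϱs)]
  have hc2 : 2 * c₀ ≤ K - ϱs := by
    rw [hc₀]
    linarith [min_le_right ϱs (K - ϱs)]
  set w : ℕ → Fin d → ℝ := fun N j =>
    -((N : ℝ) ^ κ * ((K : ℝ) - 2 * ϱs) * t * (p j true - p j false)) with hw
  set σ : ℕ → ℝ := fun N => (N : ℝ) ^ (κ - α) * t with hσ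
  set a : (N : ℕ) → Site N d → ℝ := fun N x =>
    profileGE d K ϱs α κ (fun i => p i true - p i false) ρ N t (siteCoord x) with ha
  have ha_eq : ∀ N x, a N x = ϱs + (N : ℝ) ^ (-α) * ρ (σ N) (siteCoord x + w N) := fun N x => rfl
  set I := ∫ u in Set.Icc (0 : Fin d → ℝ) 1, (if κ = α then ρ t u else ρini u) * φ u with hI
  have hdet : Tendsto (fun N : ℕ => ((N : ℝ) ^ d)⁻¹
      * ∑ x : Site N d, ρ (σ N) (siteCoord x + w N) * φ (siteCoord x + w N)) atTop (nhds I) := by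
    have hF : Continuous fun q : ℝ × (Fin d → ℝ) => ρ q.1 q.2 * φ q.2 :=
      hρsmooth.continuous.mul (by fun_prop)
    have hFper : ∀ (s : ℝ) (u : Fin d → ℝ) (z : Fin d → ℤ),
        ρ s (fun j => u j + z j) * φ (fun j => u j + z j) = ρ s u * φ u := fun s u z => by
      rw [hρper, hφper]
    rcases eq_or_lt_of_le hκα with h | h
    · have hs : Tendsto σ atTop (nhds t) := by
        refine tendsto_const_nhds.congr fun N => ?_
        simp [hσ, h]
      simpa [hI, h] using tendsto_riemann_sum_of_tendsto hF hFper hs w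
    · have hs : Tendsto σ atTop (nhds 0) := by
        simpa using (tendsto_natCast_rpow_of_neg (sub_neg.2 h)).mul_const t
      simpa [hI, h.ne, hρ0] using tendsto_riemann_sum_of_tendsto hF hFper hs w
  have hlim : Tendsto (fun N : ℕ => 4 * (K / c₀ ^ 2) ^ 2 * (K ^ 2 * M) ^ 2
      * ((N : ℝ) ^ (2 * α - (d : ℝ)) * relEnt (μ N t) (prodBinom (a N))
        + (N : ℝ) ^ (2 * α - (d : ℝ))) / (ε / 2) ^ 2) atTop (nhds 0) := by
    have := ((hH.add (tendsto_natCast_rpow_of_neg (y := 2 * α - (d : ℝ)) (by linarith))).const_mul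
      (4 * (K / c₀ ^ 2) ^ 2 * (K ^ 2 * M) ^ 2)).div_const ((ε / 2) ^ 2)
    simpa using this
  refine squeeze_zero' (Eventually.of_forall fun N =>
    Finset.sum_nonneg fun η _ => (hμprob N t ht.1).1 η) ?_ hlim
  have hsmall := (tendsto_natCast_rpow_of_neg (y := -α) (by linarith)).eventually
    (gt_mem_nhds (div_pos hc₀0 hD0))
  filter_upwards [hsmall, Metric.tendsto_nhds.1 hdet (ε / 2) (half_pos hε),
    eventually_ge_atTop 1] with N hN1 hN2 hN3
  have : NeZero N := ⟨by omega⟩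
  have hN0 : (0 : ℝ) < N := Nat.cast_pos.2 hN3
  have hab : ∀ x, c₀ ≤ a N x ∧ a N x ≤ K - c₀ := by
    intro x
    obtain ⟨ad, had⟩ := hD N
    rw [lt_div_iff₀ hD0, mul_comm] at hN1
    have h2 := abs_le.1 ((had t ht x).2.1.trans hN1.le)
    constructor
    · have := h2.1
      simp only [ha]
      linarith
    · have := h2.2
      simp only [ha]
      linarith
  have hprob := hμprob N t ht.1
  set Y : GCfg N d K → ℝ := fun η =>
    ∑ x, (((η x).val : ℝ) - a N x) * φ (siteCoord x + w N) with hY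
  set X : GCfg N d K → ℝ := fun η => (N : ℝ) ^ (α - (d : ℝ)) * Y η with hX
  have hsq : ∑ η, μ N t η * X η ^ 2 ≤ 4 * (K / c₀ ^ 2) ^ 2 * (K ^ 2 * M) ^ 2
      * ((N : ℝ) ^ (2 * α - (d : ℝ)) * relEnt (μ N t) (prodBinom (a N))
        + (N : ℝ) ^ (2 * α - (d : ℝ))) := by
    have h1 := sum_mul_sq_field_le hK hc₀0 (fun x => (hab x).1) (fun x => (hab x).2)
      hprob.1 hprob.2 (b := fun x => φ (siteCoord x + w N)) hM0 (fun x => hφM _)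
    have e1 : ((N : ℝ) ^ (α - (d : ℝ))) ^ 2 * (N : ℝ) ^ d = (N : ℝ) ^ (2 * α - (d : ℝ)) := by
      rw [← Real.rpow_natCast, ← Real.rpow_natCast, ← Real.rpow_mul hN0.le, ← Real.rpow_add hN0]
      congr 1
      push_cast
      ring
    have e2 : ∑ η, μ N t η * X η ^ 2
        = ((N : ℝ) ^ (α - (d : ℝ))) ^ 2 * ∑ η, μ N t η * Y η ^ 2 := by
      rw [Finset.mul_sum]
      refine Finset.sum_congr rfl fun η _ => ?_
      simp only [hX]
      ring
    rw [e2]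
    refine (mul_le_mul_of_nonneg_left h1 (sq_nonneg _)).trans (le_of_eq ?_)
    rw [← e1]
    ring
  refine le_trans ?_ ((sum_filter_lt_abs_le hprob.1 X (half_pos hε)).trans
    (div_le_div_of_nonneg_right hsq (sq_nonneg _)))
  refine Finset.sum_le_sum_of_subset_of_nonneg (fun η hη => ?_) fun η _ _ => hprob.1 η
  rw [Finset.mem_filter] at hη ⊢
  refine ⟨hη.1, ?_⟩
  have e3 : (N : ℝ) ^ (α - (d : ℝ)) * ∑ x : Site N d, (((η x).val : ℝ) - ϱs) *
      φ (fun j => (x j : ℝ) / N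
        - (N : ℝ) ^ κ * ((K : ℝ) - 2 * ϱs) * t * (p j true - p j false))
      = X η + ((N : ℝ) ^ d)⁻¹
        * ∑ x : Site N d, ρ (σ N) (siteCoord x + w N) * φ (siteCoord x + w N) := by
    have e4 : ((N : ℝ) ^ d)⁻¹ = (N : ℝ) ^ (α - (d : ℝ)) * (N : ℝ) ^ (-α) := by
      rw [← Real.rpow_natCast, ← Real.rpow_neg hN0.le, ← Real.rpow_add hN0]
      congr 1
      ring
    simp only [hX, hY]
    rw [e4, mul_assoc ((N : ℝ) ^ (α - (d : ℝ))) ((N : ℝ) ^ (-α)), ← mul_add,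
      Finset.mul_sum (a := (N : ℝ) ^ (-α)), ← Finset.sum_add_distrib]
    congr 1
    refine Finset.sum_congr rfl fun x _ => ?_
    change _ * φ (siteCoord x + w N) = _
    rw [ha_eq]
    ring
  have h5 := hη.2
  rw [e3] at h5
  rw [Real.dist_eq] at hN2
  have h6 := abs_add_le (X η) (((N : ℝ) ^ d)⁻¹
    * ∑ x : Site N d, ρ (σ N) (siteCoord x + w N) * φ (siteCoord x + w N) - I)
  rw [← add_sub_assoc] at h6
  linarith
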